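/- arXiv:2409.08819 — 6 statements merged into one kernel-verified Lean document; each statement's English description precedes it below -/
import Mathlib

section
/- Let P be a trivial poset, i.e. a finite poset containing neither an induced copy of the V-shaped poset 𝕍 nor an induced copy of the Λ-shaped poset 𝚲. Then for every positive integer n, n + h(P) − 1 ≤ R(P, Q_n) ≤ n + h(P) + α(w(P)) − 1. -/
open Finset

/-- The poset Ramsey number `R(P,Q)`: the least `N` such that every blue/red coloring of the
Boolean lattice `Q_N` (subsets of `Fin N` ordered by inclusion, colors as `Bool` with
`true` = blue, `false` = red) contains a blue induced copy of `P` or a red induced copy of `Q`,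
where an induced copy is the image of an order embedding. -/
noncomputable def posetRamsey (P : Type*) (Q : Type*) [PartialOrder P] [PartialOrder Q] : ℕ :=
  sInf {N : ℕ | ∀ c : Finset (Fin N) → Bool,
    (∃ e : P ↪o Finset (Fin N), ∀ p, c (e p) = true) ∨
    (∃ e : Q ↪o Finset (Fin N), ∀ q, c (e q) = false)}

/-- The V-shaped poset `𝕍`: a bottom element below two incomparable elements. -/
inductive VPoset : Type
  | bot | left | right
  deriving DecidableEq

instance : PartialOrder VPoset where
  le a b := a = b ∨ a = VPoset.bot
  le_refl a := Or.inl rfl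
  le_trans a b c h₁ h₂ := by
    rcases h₁ with rfl | h₁
    · exact h₂
    · exact Or.inr h₁
  le_antisymm a b h₁ h₂ := by
    rcases h₁ with rfl | h₁
    · rfl
    · rcases h₂ with rfl | h₂
      · rfl
      · exact h₁.trans h₂.symm

/-- The Λ-shaped poset `𝚲`: a top element above two incomparable elements. -/
inductive LPoset : Type
  | top | left | right
  deriving DecidableEq

instance : PartialOrder LPoset where
  le a b := a = b ∨ b = LPoset.top
  le_refl a := Or.inl rfl
  le_trans a b c h₁ h₂ := by
    rcases h₂ with rfl | h₂
    · exact h₁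
    · exact Or.inr h₂
  le_antisymm a b h₁ h₂ := by
    rcases h₁ with rfl | h₁
    · rfl
    · rcases h₂ with rfl | h₂
      · rfl
      · exact h₂.trans h₁.symm

/-- The height of a poset: the largest number of pairwise comparable elements. -/
noncomputable def height (P : Type*) [PartialOrder P] : ℕ :=
  sSup {n : ℕ | ∃ S : Finset P, S.card = n ∧ IsChain (· ≤ ·) (S : Set P)}

/-- The width of a poset: the largest number of pairwise incomparable elements. -/
noncomputable def width (P : Type*) [PartialOrder P] : ℕ :=
  sSup {n : ℕ | ∃ S : Finset P, S.card = n ∧ IsAntichain (· ≤ ·) (S : Set P)}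

/-- The Sperner number `α(m)`: the least `N` such that the Boolean lattice `Q_N` contains
an antichain of size `m`. -/
noncomputable def sperner (m : ℕ) : ℕ :=
  sInf {N : ℕ | ∃ S : Finset (Finset (Fin N)), S.card = m ∧
    IsAntichain (· ≤ ·) (S : Set (Finset (Fin N)))}

theorem le_or_le_of_le_of_le_of_isEmpty_lPoset {P : Type*} [PartialOrder P]
    (hL : IsEmpty (LPoset ↪o P)) {a b t : P} (ha : a ≤ t) (hb : b ≤ t) : a ≤ b ∨ b ≤ a := by
  by_contra! h
  obtain ⟨hab, hba⟩ := h
  have hta : ¬ t ≤ a := fun hta => hba (hb.trans hta)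
  have htb : ¬ t ≤ b := fun htb => hab (ha.trans htb)
  refine hL.false (OrderEmbedding.ofMapLEIff
    (fun x => match x with | .top => t | .left => a | .right => b) ?_)
  rintro (_ | _ | _) (_ | _ | _) <;> simp [LE.le] <;> assumption

theorem le_or_le_of_le_of_le_of_isEmpty_vPoset {P : Type*} [PartialOrder P]
    (hV : IsEmpty (VPoset ↪o P)) {a b t : P} (ha : t ≤ a) (hb : t ≤ b) : a ≤ b ∨ b ≤ a := by
  by_contra! h
  obtain ⟨hab, hba⟩ := h
  have hta : ¬ a ≤ t := fun hta => hab (hta.trans hb)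
  have htb : ¬ b ≤ t := fun htb => hba (htb.trans ha)
  refine hV.false (OrderEmbedding.ofMapLEIff
    (fun x => match x with | .bot => t | .left => a | .right => b) ?_)
  rintro (_ | _ | _) (_ | _ | _) <;> simp [LE.le] <;> assumption

/-- In a trivial poset, comparability is an equivalence relation. -/
def comparabilitySetoid {P : Type*} [PartialOrder P] (hV : IsEmpty (VPoset ↪o P))
    (hL : IsEmpty (LPoset ↪o P)) : Setoid P where
  r a b := a ≤ b ∨ b ≤ a
  iseqv :=
    { refl := fun a => Or.inl le_rfl
      symm := fun h => h.symm
      trans := by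
        rintro a b c (hab | hba) (hbc | hcb)
        · exact Or.inl (hab.trans hbc)
        · exact le_or_le_of_le_of_le_of_isEmpty_lPoset hL hab hcb
        · exact le_or_le_of_le_of_le_of_isEmpty_vPoset hV hba hbc
        · exact Or.inr (hcb.trans hba) }

theorem bddAbove_card_finset (P : Type*) [Fintype P] (p : Finset P → Prop) :
    BddAbove {n : ℕ | ∃ S : Finset P, S.card = n ∧ p S} :=
  ⟨Fintype.card P, by rintro _ ⟨S, rfl, -⟩; exact S.card_le_univ⟩

theorem card_le_height {P : Type*} [PartialOrder P] [Fintype P] {S : Finset P}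
    (hS : IsChain (· ≤ ·) (S : Set P)) : S.card ≤ height P :=
  le_csSup (bddAbove_card_finset P _) ⟨S, rfl, hS⟩

theorem card_le_width {P : Type*} [PartialOrder P] [Fintype P] {S : Finset P}
    (hS : IsAntichain (· ≤ ·) (S : Set P)) : S.card ≤ width P :=
  le_csSup (bddAbove_card_finset P _) ⟨S, rfl, hS⟩

theorem exists_isChain_card_eq_height (P : Type*) [PartialOrder P] [Fintype P] :
    ∃ S : Finset P, S.card = height P ∧ IsChain (· ≤ ·) (S : Set P) :=
  Nat.sSup_mem (s := {n : ℕ | ∃ S : Finset P, S.card = n ∧ IsChain (· ≤ ·) (S : Set P)})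
    ⟨0, ∅, by simp⟩ (bddAbove_card_finset P _)

theorem height_pos (P : Type*) [PartialOrder P] [Fintype P] [Nonempty P] : 0 < height P := by
  obtain ⟨p⟩ := ‹Nonempty P›
  have h := card_le_height (S := {p}) (by simp)
  rw [card_singleton] at h
  exact h

theorem exists_isAntichain_card_eq_sperner (m : ℕ) :
    ∃ S : Finset (Finset (Fin (sperner m))), S.card = m ∧
      IsAntichain (· ≤ ·) (S : Set (Finset (Fin (sperner m)))) := by
  refine Nat.sInf_mem (s := {N : ℕ | ∃ S : Finset (Finset (Fin N)), S.card = m ∧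
    IsAntichain (· ≤ ·) (S : Set (Finset (Fin N)))}) ⟨m, univ.map ⟨_, singleton_injective⟩, ?_, ?_⟩
  · simp
  · intro a ha b hb hab hle
    simp only [coe_map, Function.Embedding.coeFn_mk, coe_univ, Set.image_univ,
      Set.mem_range] at ha hb
    obtain ⟨i, rfl⟩ := ha
    obtain ⟨j, rfl⟩ := hb
    simp_all

/-- A trivial poset embeds into a disjoint union of `width P` chains of length `height P`, where
the chains are indexed by an antichain in the Boolean lattice of dimension
`sperner (width P)`. -/
theorem exists_chain_decomposition {P : Type*} [PartialOrder P] [Fintype P]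
    (hV : IsEmpty (VPoset ↪o P)) (hL : IsEmpty (LPoset ↪o P)) :
    ∃ (a : P → Finset (Fin (sperner (width P)))) (l : P → ℕ),
      (∀ p, l p < height P) ∧ (∀ p q, a p ≤ a q → a p = a q) ∧
      ∀ p q, p ≤ q ↔ a p = a q ∧ l p ≤ l q := by
  classical
  let s := comparabilitySetoid hV hL
  have hcard : Fintype.card (Quotient s) ≤ width P := by
    rw [← card_univ, ← card_image_of_injective univ Quotient.out_injective]
    refine card_le_width ?_
    intro x hx y hy hxy hle
    simp only [coe_image, coe_univ, Set.image_univ, Set.mem_range] at hx hy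
    obtain ⟨i, rfl⟩ := hx
    obtain ⟨j, rfl⟩ := hy
    exact hxy (congrArg _ (Quotient.out_equiv_out.1 (Or.inl hle)))
  obtain ⟨T, hT, hTanti⟩ := exists_isAntichain_card_eq_sperner (width P)
  obtain ⟨g⟩ : Nonempty (Quotient s ↪ T) :=
    Function.Embedding.nonempty_of_card_le (by simpa [hT] using hcard)
  have ha (p q : P) :
      (g (Quotient.mk s p) : Finset (Fin (sperner (width P)))) = g (Quotient.mk s q) ↔
        p ≤ q ∨ q ≤ p := by
    rw [Subtype.coe_inj, g.injective.eq_iff, Quotient.eq]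
    rfl
  have hl {p q : P} (h : p < q) : (univ.filter (· < p)).card < (univ.filter (· < q)).card := by
    refine card_lt_card (Finset.ssubset_iff_of_subset ?_ |>.2 ⟨p, by simpa using h, by simp⟩)
    exact monotone_filter_right _ fun x _ hx => hx.trans h
  refine ⟨fun p => g (Quotient.mk s p), fun p => (univ.filter (· < p)).card, fun p => ?_,
    fun p q h => ?_, fun p q => ?_⟩
  · refine lt_of_lt_of_le (card_lt_card (t := univ.filter (· ≤ p)) ?_) (card_le_height ?_)
    · refine Finset.ssubset_iff_of_subset ?_ |>.2 ⟨p, by simp, by simp⟩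
      exact monotone_filter_right _ fun x _ hx => hx.le
    · intro x hx y hy _
      exact le_or_le_of_le_of_le_of_isEmpty_lPoset hL (by simpa using hx) (by simpa using hy)
  · exact hTanti.eq (g _).2 (g _).2 h
  · simp only [ha]
    refine ⟨fun h => ⟨Or.inl h, ?_⟩, ?_⟩
    · exact card_le_card (monotone_filter_right _ fun x _ hx => hx.trans_le h)
    · rintro ⟨h | h, hle⟩
      · exact h
      · rcases h.eq_or_lt with rfl | h
        · exact le_rfl
        · exact absurd (hl h) hle.not_gt

/-- A two-colored product of a poset with a chain of length `h` contains either a chain of length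
`h` meeting every level in the first color, or a monotone section in the second color. -/
theorem exists_monotone_chain_or_section {β : Type*} [Preorder β] (h : ℕ) (c : β → ℕ → Bool) :
    (∃ s : ℕ → β, Monotone s ∧ ∀ i < h, c (s i) i = true) ∨
    (∃ f : β → ℕ, Monotone f ∧ ∀ x, f x < h ∧ c x (f x) = false) := by
  classical
  let reach (l : ℕ) (x : β) : Prop :=
    ∃ s : ℕ → β, Monotone s ∧ (∀ i, s i ≤ x) ∧ ∀ i < l, c (s i) i = true
  by_cases hr : ∃ x, reach h x
  · obtain ⟨x, s, hs, -, hc⟩ := hr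
    exact Or.inl ⟨s, hs, hc⟩
  push Not at hr
  have hh : h ≠ 0 ∨ IsEmpty β := by
    by_contra! hcon
    obtain ⟨rfl, ⟨x⟩⟩ := hcon
    exact hr x ⟨fun _ => x, monotone_const, fun _ => le_rfl, by simp⟩
  have hex (x : β) : ∃ l, ¬ reach (l + 1) x := by
    rcases hh with hh | hh
    · exact ⟨h - 1, by rw [Nat.sub_add_cancel (Nat.pos_of_ne_zero hh)]; exact hr x⟩
    · exact hh.elim x
  refine Or.inr ⟨fun x => Nat.find (hex x), fun x y hxy => ?_, fun x => ⟨?_, ?_⟩⟩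
  · refine Nat.find_min' _ ?_
    rintro ⟨s, hs, hsx, hc⟩
    exact Nat.find_spec (hex y) ⟨s, hs, fun i => (hsx i).trans hxy, hc⟩
  · have hpos : 0 < h := Nat.pos_of_ne_zero (hh.resolve_right fun he => he.elim x)
    have : Nat.find (hex x) ≤ h - 1 :=
      Nat.find_min' _ (by rw [Nat.sub_add_cancel hpos]; exact hr x)
    exact this.trans_lt (Nat.sub_lt hpos one_pos)
  · have hreach : reach (Nat.find (hex x)) x := by
      rcases Nat.eq_zero_or_pos (Nat.find (hex x)) with h0 | h0
      · rw [h0]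
        exact ⟨fun _ => x, monotone_const, fun _ => le_rfl, by simp⟩
      · have := Nat.find_min (hex x) (Nat.sub_lt h0 one_pos)
        rwa [not_not, Nat.sub_one_add_one h0.ne'] at this
    obtain ⟨s, hs, hsx, hc⟩ := hreach
    by_contra hblue
    rw [Bool.not_eq_false] at hblue
    refine Nat.find_spec (hex x)
      ⟨fun i => if i < Nat.find (hex x) then s i else x, fun i j hij => ?_, fun i => ?_,
        fun i hi => ?_⟩
    · dsimp only
      split_ifs with h1 h2 h2
      · exact hs hij
      · exact hsx i
      · omega
      · exact le_rfl
    · dsimp only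
      split_ifs
      · exact hsx i
      · exact le_rfl
    · dsimp only
      split_ifs with h1
      · exact hc i h1
      · rwa [show i = Nat.find (hex x) by omega]

/-- The product of the Boolean lattice of dimension `n`, a chain of length `h`, and the Boolean
lattice of dimension `k` embeds into the Boolean lattice of dimension `n + h + k - 1`. -/
theorem exists_boolean_prod_chain_embedding (n h k : ℕ) (hh : 0 < h) :
    ∃ d : Finset (Fin n) → ℕ → Finset (Fin k) → Finset (Fin (n + h + k - 1)),
      ∀ X Y i j A B, i < h → j < h → (d X i A ≤ d Y j B ↔ X ≤ Y ∧ i ≤ j ∧ A ≤ B) := by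
  have e : (Fin n ⊕ Fin (h - 1)) ⊕ Fin k ≃ Fin (n + h + k - 1) :=
    Fintype.equivFinOfCardEq (by simp; omega)
  refine ⟨fun X i A => ((X.disjSum (univ.filter fun j : Fin (h - 1) => j.val < i)).disjSum A).map
    e.toEmbedding, fun X Y i j A B hi hj => ?_⟩
  simp only [map_subset_map]
  constructor
  · intro hsub
    refine ⟨fun x hx => ?_, ?_, fun x hx => ?_⟩
    · simpa using @hsub (Sum.inl (Sum.inl x)) (by simpa using hx)
    · by_contra! hlt
      simpa [hlt] using @hsub (Sum.inl (Sum.inr ⟨j, by omega⟩))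
    · simpa using @hsub (Sum.inr x) (by simpa using hx)
  · rintro ⟨hX, hij, hA⟩
    exact disjSum_mono (disjSum_mono hX
      (monotone_filter_right _ fun x _ (hx : x.val < i) => hx.trans_le hij)) hA

theorem ramsey_property_of_trivial (P : Type*) [PartialOrder P] [Fintype P] [Nonempty P]
    (hV : IsEmpty (VPoset ↪o P)) (hL : IsEmpty (LPoset ↪o P)) (n : ℕ)
    (c : Finset (Fin (n + height P + sperner (width P) - 1)) → Bool) :
    (∃ e : P ↪o Finset (Fin (n + height P + sperner (width P) - 1)), ∀ p, c (e p) = true) ∨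
    (∃ e : Finset (Fin n) ↪o Finset (Fin (n + height P + sperner (width P) - 1)),
      ∀ q, c (e q) = false) := by
  obtain ⟨a, l, hl, ha, hle⟩ := exists_chain_decomposition hV hL
  obtain ⟨d, hd⟩ :=
    exists_boolean_prod_chain_embedding n (height P) (sperner (width P)) (height_pos P)
  by_cases hred : ∃ (A : _) (f : Finset (Fin n) → ℕ), Monotone f ∧
      ∀ x, f x < height P ∧ c (d x (f x) A) = false
  · obtain ⟨A, f, hf, hfx⟩ := hred
    refine Or.inr ⟨OrderEmbedding.ofMapLEIff (fun X => d X (f X) A) fun X Y => ?_,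
      fun X => (hfx X).2⟩
    rw [hd _ _ _ _ _ _ (hfx X).1 (hfx Y).1]
    exact ⟨fun h => h.1, fun h => ⟨h, hf h, le_rfl⟩⟩
  · have hblue (A : Finset (Fin (sperner (width P)))) : ∃ s : ℕ → Finset (Fin n), Monotone s ∧
        ∀ i < height P, c (d (s i) i A) = true :=
      (exists_monotone_chain_or_section (height P) fun x i => c (d x i A)).resolve_right
        fun h => hred ⟨A, h⟩
    choose s hs hsc using hblue
    refine Or.inl ⟨OrderEmbedding.ofMapLEIff (fun p => d (s (a p) (l p)) (l p) (a p))
      fun p q => ?_, fun p => hsc _ _ (hl p)⟩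
    rw [hd _ _ _ _ _ _ (hl p) (hl q), hle]
    constructor
    · rintro ⟨-, h, h'⟩
      exact ⟨ha _ _ h', h⟩
    · rintro ⟨h, h'⟩
      exact ⟨h ▸ hs _ h', h', h.le⟩

theorem StrictMono.add_card_le {α : Type*} {f : Finset α → ℕ} (hf : StrictMono f)
    (X : Finset α) : f ∅ + X.card ≤ f X := by
  classical
  induction X using Finset.induction_on with
  | empty => simp
  | insert x X hx ih =>
    have := hf (ssubset_insert hx)
    rw [card_insert_of_notMem hx]
    omega

theorem le_of_ramsey_property (P : Type*) [PartialOrder P] [Fintype P] [Nonempty P] (n N : ℕ)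
    (hN : ∀ c : Finset (Fin N) → Bool, (∃ e : P ↪o Finset (Fin N), ∀ p, c (e p) = true) ∨
      (∃ e : Finset (Fin n) ↪o Finset (Fin N), ∀ q, c (e q) = false)) :
    n + height P - 1 ≤ N := by
  have hpos := height_pos P
  rcases hN fun X => decide (X.card < height P - 1) with ⟨e, he⟩ | ⟨e, he⟩
  · simp only [decide_eq_true_eq] at he
    obtain ⟨S, hS, hchain⟩ := exists_isChain_card_eq_height P
    have hmono : StrictMono fun p => (e p).card := fun p q h => card_lt_card (e.strictMono h)
    have hcard : S.card ≤ (range (height P - 1)).card := by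
      refine card_le_card_of_injOn (fun p => (e p).card) (fun p _ => by simpa using he p) ?_
      intro p hp q hq hpq
      by_contra hne
      rcases hchain hp hq hne with h | h
      · exact (hmono (h.lt_of_ne hne)).ne hpq
      · exact (hmono (h.lt_of_ne' hne)).ne' hpq
    rw [card_range, hS] at hcard
    omega
  · simp only [decide_eq_false_iff_not, not_lt] at he
    have hmono : StrictMono fun X => (e X).card := fun p q h => card_lt_card (e.strictMono h)
    have h1 := hmono.add_card_le univ
    have h2 := card_le_univ (e univ)
    have h3 := he ∅
    simp only [card_univ, Fintype.card_fin] at h1 h2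
    omega

/-- If `P` is a trivial poset (a finite poset containing no induced copy of
`𝕍` and no induced copy of `𝚲`), then for every positive integer `n`,
`n + h(P) - 1 ≤ R(P, Q_n) ≤ n + h(P) + α(w(P)) - 1`. -/
theorem trivial_poset_ramsey (P : Type*) [PartialOrder P] [Fintype P] [Nonempty P]
    (hV : IsEmpty (VPoset ↪o P)) (hL : IsEmpty (LPoset ↪o P))
    (n : ℕ) (hn : 0 < n) :
    n + height P - 1 ≤ posetRamsey P (Finset (Fin n)) ∧
    posetRamsey P (Finset (Fin n)) ≤ n + height P + sperner (width P) - 1 := by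
  have hmem := ramsey_property_of_trivial P hV hL n
  refine ⟨le_of_ramsey_property P n _ ?_, Nat.sInf_le hmem⟩
  exact Nat.sInf_mem (s := {N : ℕ | ∀ c : Finset (Fin N) → Bool,
    (∃ e : P ↪o Finset (Fin N), ∀ p, c (e p) = true) ∨
    (∃ e : Finset (Fin n) ↪o Finset (Fin N), ∀ q, c (e q) = false)}) ⟨_, hmem⟩
end

section
/- Let P be a non-trivial poset, i.e. a finite poset containing an induced copy of the V-shaped poset 𝕍 or of the Λ-shaped poset 𝚲. Then for every integer n ≥ 2^16, R(P, Q_n) ≥ n + (1/15)·(n / log n). -/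
open Finset

/-- Every two-coloring of a large enough Boolean lattice has a blue copy of `P` or a red copy of
`Q_n`. -/
theorem posetRamsey_set_nonempty (P : Type*) [PartialOrder P] [Fintype P] (n : ℕ) :
    {N : ℕ | ∀ c : Finset (Fin N) → Bool,
      (∃ e : P ↪o Finset (Fin N), ∀ p, c (e p) = true) ∨
      (∃ e : Finset (Fin n) ↪o Finset (Fin N), ∀ q, c (e q) = false)}.Nonempty := by
  classical
  let G := Fin n ⊕ (Fin (n + 1) × P)
  refine ⟨Fintype.card G, fun c => ?_⟩
  let E : Finset G ↪o Finset (Fin (Fintype.card G)) :=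
    Finset.mapEmbedding (Fintype.equivFin G).toEmbedding
  let blob (T : Finset (Fin n)) (U : Finset P) : Finset G :=
    univ.filter (fun g => Sum.elim (fun i => i ∈ T)
      (fun w => w.1.val < T.card ∨ (w.1.val = T.card ∧ w.2 ∈ U)) g)
  have hcard (T : Finset (Fin n)) : T.card < n + 1 := by
    have := T.card_le_univ
    simp at this
    omega
  by_cases h : ∃ T : Finset (Fin n), ∀ p : P, c (E (blob T (univ.filter (· ≤ p)))) = true
  · left
    obtain ⟨T, hT⟩ := h
    refine ⟨OrderEmbedding.ofMapLEIff (fun p => E (blob T (univ.filter (· ≤ p)))) ?_, hT⟩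
    intro p q
    rw [E.le_iff_le]
    constructor
    · intro hpq
      have := @hpq (Sum.inr (⟨T.card, hcard T⟩, p)) (by simp [blob])
      simpa [blob] using this
    · intro hpq g hg
      rcases g with i | w
      · simpa [blob] using hg
      · simp only [blob, mem_filter, mem_univ, true_and, Sum.elim_inr] at hg ⊢
        exact hg.imp id (fun h => ⟨h.1, h.2.trans hpq⟩)
  · right
    push Not at h
    choose r hr using h
    refine ⟨OrderEmbedding.ofMapLEIff
      (fun T => E (blob T (univ.filter (· ≤ r T)))) ?_, fun q => Bool.eq_false_of_not_eq_true (hr q)⟩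
    intro S T
    rw [E.le_iff_le]
    constructor
    · intro hST i hi
      have := @hST (Sum.inl i) (by simpa [blob] using hi)
      simpa [blob] using this
    · intro hST
      rcases eq_or_ne S T with rfl | hne
      · exact le_rfl
      · have hlt := Finset.card_lt_card (lt_of_le_of_ne hST hne)
        intro g hg
        rcases g with i | w
        · simp only [blob, mem_filter, mem_univ, true_and, Sum.elim_inl] at hg ⊢
          exact hST hg
        · simp only [blob, mem_filter, mem_univ, true_and, Sum.elim_inr] at hg ⊢
          left
          omega

/-- The sequence `s` lists distinct elements of the `k`-set `Y`. -/
def IsNode {Z : Type*} (k : ℕ) (Y : Finset Z) (s : List Z) : Prop :=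
  Y.card = k ∧ s.Nodup ∧ ∀ y ∈ s, y ∈ Y

theorem IsNode.length_le {Z : Type*} {k : ℕ} {Y : Finset Z} {s : List Z}
    (h : IsNode k Y s) : s.length ≤ k := by
  classical
  rw [← List.toFinset_card_of_nodup h.2.1, ← h.1]
  exact Finset.card_le_card fun y hy => h.2.2 y (by simpa using hy)

/-- The binary encoding of a sequence of numbers, with complementary bits stored separately. -/
def listCode {N : ℕ} (k b : ℕ) (s : List (Fin N)) : Finset (Fin k × Fin b × Bool) :=
  univ.filter fun a => ∃ y, s[a.1.val]? = some y ∧ y.val.testBit a.2.1 = a.2.2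

theorem listCode_mono {N k b : ℕ} {s t : List (Fin N)} (h : s <+: t) :
    listCode k b s ⊆ listCode k b t := by
  intro a ha
  simp only [listCode, mem_filter, mem_univ, true_and] at ha ⊢
  obtain ⟨y, hy, hb⟩ := ha
  obtain ⟨u, rfl⟩ := h
  refine ⟨y, ?_, hb⟩
  rw [List.getElem?_append_left (List.getElem?_eq_some_iff.1 hy).1, hy]

theorem eq_of_testBit_lt {b x y : ℕ} (hx : x < 2 ^ b) (hy : y < 2 ^ b)
    (h : ∀ j < b, x.testBit j = y.testBit j) : x = y := by
  refine Nat.eq_of_testBit_eq fun j => ?_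
  by_cases hj : j < b
  · exact h j hj
  · have hp : 2 ^ b ≤ 2 ^ j := Nat.pow_le_pow_right (by norm_num) (by omega)
    rw [Nat.testBit_lt_two_pow (hx.trans_le hp), Nat.testBit_lt_two_pow (hy.trans_le hp)]

theorem prefix_of_listCode_subset {N k b : ℕ} (hb : 0 < b) (hN : N ≤ 2 ^ b) {s t : List (Fin N)}
    (hs : s.length ≤ k) (h : listCode k b s ⊆ listCode k b t) : s <+: t := by
  rw [List.prefix_iff_getElem?]
  intro p hp
  have key (j : Fin b) : ∃ z, t[p]? = some z ∧ z.val.testBit j = s[p].val.testBit j := by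
    have := @h (⟨p, by omega⟩, j, s[p].val.testBit j) (by simp [listCode, hp])
    simpa [listCode] using this
  obtain ⟨z, hz, -⟩ := key ⟨0, hb⟩
  rw [hz]
  congr 1
  refine Fin.ext (eq_of_testBit_lt (z.2.trans_le hN) (s[p].2.trans_le hN) fun j hj => ?_)
  obtain ⟨w, hw, hbit⟩ := key ⟨j, hj⟩
  rw [hz, Option.some_inj] at hw
  rw [hw]
  exact hbit

/-- The polynomial over `ZMod q` whose roots are the elements of `Y`. -/
noncomputable def rootPoly {N : ℕ} (q : ℕ) (Y : Finset (Fin N)) : Polynomial (ZMod q) :=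
  ∏ y ∈ Y, (Polynomial.X - Polynomial.C (y.val : ZMod q))

theorem natCast_zmod_injOn {q x y : ℕ} (hx : x < q) (hy : y < q)
    (h : (x : ZMod q) = y) : x = y := by
  rw [ZMod.natCast_eq_natCast_iff'] at h
  rwa [Nat.mod_eq_of_lt hx, Nat.mod_eq_of_lt hy] at h

theorem rootPoly_eval_eq_zero {N q : ℕ} [Fact q.Prime] (hN : N ≤ q) (Y : Finset (Fin N))
    (z : Fin N) : (rootPoly q Y).eval (z.val : ZMod q) = 0 ↔ z ∈ Y := by
  simp only [rootPoly, Polynomial.eval_prod, Finset.prod_eq_zero_iff, Polynomial.eval_sub,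
    Polynomial.eval_X, Polynomial.eval_C, sub_eq_zero]
  constructor
  · rintro ⟨y, hy, h⟩
    have := natCast_zmod_injOn (z.2.trans_le hN) (y.2.trans_le hN) h
    rwa [Fin.ext this]
  · exact fun h => ⟨z, h, rfl⟩

theorem rootPoly_injective {N q : ℕ} [Fact q.Prime] (hN : N ≤ q) :
    Function.Injective (rootPoly q : Finset (Fin N) → _) := by
  intro Y Y' h
  ext z
  rw [← rootPoly_eval_eq_zero hN, h, rootPoly_eval_eq_zero hN]

theorem natDegree_rootPoly {N q : ℕ} [Fact q.Prime] (Y : Finset (Fin N)) :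
    (rootPoly q Y).natDegree = Y.card := by
  exact Polynomial.natDegree_finsetProd_X_sub_C_eq_card Y _

/-- The binary encoding of the values of `rootPoly q Y` at `0, …, L - 1`. -/
noncomputable def setCode {N : ℕ} (q L b : ℕ) (Y : Finset (Fin N)) :
    Finset (Fin L × Fin b × Bool) :=
  univ.filter fun a =>
    ((rootPoly q Y).eval (a.1.val : ZMod q)).val.testBit a.2.1 = a.2.2

theorem lt_card_setCode_sdiff {N q k b : ℕ} [Fact q.Prime] (hN : N ≤ q) (hb : q ≤ 2 ^ b)
    (hL : 3 * k + 1 ≤ q) {Y Y' : Finset (Fin N)} (hY : Y.card = k) (hY' : Y'.card = k)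
    (hne : Y ≠ Y') :
    2 * k < (setCode q (3 * k + 1) b Y \ setCode q (3 * k + 1) b Y').card := by
  classical
  set L := 3 * k + 1 with hLdef
  let f := rootPoly q Y
  let g := rootPoly q Y'
  have hfg : f - g ≠ 0 := sub_ne_zero.2 fun h => hne (rootPoly_injective hN h)
  let A : Finset (Fin L) := univ.filter fun x => f.eval (x.val : ZMod q) = g.eval (x.val : ZMod q)
  have hA : A.card ≤ k := by
    have hinj : Set.InjOn (fun x : Fin L => (x.val : ZMod q)) A := fun x _ y _ h =>
      Fin.ext (natCast_zmod_injOn (x.2.trans_le hL) (y.2.trans_le hL) h)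
    rw [← Finset.card_image_of_injOn hinj]
    have hsub : A.image (fun x : Fin L => (x.val : ZMod q)) ⊆ (f - g).roots.toFinset := by
      intro z hz
      obtain ⟨x, hx, rfl⟩ := Finset.mem_image.1 hz
      simp only [A, mem_filter, mem_univ, true_and] at hx
      simp [hfg, hx]
    calc _ ≤ _ := Finset.card_le_card hsub
      _ ≤ _ := Multiset.toFinset_card_le _
      _ ≤ _ := Polynomial.card_roots' _
      _ ≤ max f.natDegree g.natDegree := Polynomial.natDegree_sub_le _ _
      _ = k := by simp [f, g, natDegree_rootPoly, hY, hY']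
  have hsub : Aᶜ ⊆ (setCode q L b Y \ setCode q L b Y').image Prod.fst := by
    intro x hx
    simp only [A, mem_compl, mem_filter, mem_univ, true_and] at hx
    have hbit : ∃ j < b, (f.eval (x.val : ZMod q)).val.testBit j ≠
        (g.eval (x.val : ZMod q)).val.testBit j := by
      by_contra! hcon
      exact hx (ZMod.val_injective q (eq_of_testBit_lt ((ZMod.val_lt _).trans_le hb)
        ((ZMod.val_lt _).trans_le hb) hcon))
    obtain ⟨j, hj, hbit⟩ := hbit
    refine Finset.mem_image.2 ⟨(x, ⟨j, hj⟩, (f.eval (x.val : ZMod q)).val.testBit j), ?_, rfl⟩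
    simp only [setCode, mem_sdiff, mem_filter, mem_univ, true_and]
    exact ⟨rfl, hbit.symm⟩
  have h1 := (Finset.card_le_card hsub).trans Finset.card_image_le
  rw [Finset.card_compl, Fintype.card_fin] at h1
  omega

/-- A type embeds into the complement of a finset that leaves enough room. -/
theorem exists_embedding_avoiding {Z α : Type*} [Fintype Z] [DecidableEq Z] [Fintype α]
    (S : Finset Z) (h : S.card + Fintype.card α ≤ Fintype.card Z) :
    ∃ f : α ↪ Z, ∀ a, f a ∉ S := by
  have hc : Fintype.card α ≤ Fintype.card {z // z ∈ Sᶜ} := by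
    rw [Fintype.card_coe, Finset.card_compl]
    omega
  obtain ⟨f⟩ := Function.Embedding.nonempty_of_card_le hc
  exact ⟨f.trans (Function.Embedding.subtype _), fun a => Finset.mem_compl.1 (f a).2⟩

/-- Pairwise incomparable trees, one for each `k`-set `Y`, whose vertices are indexed by the
sequences of distinct elements of `Y`. -/
theorem exists_trees {N k b q : ℕ} [Fact q.Prime] (hN : N ≤ q) (hb : q ≤ 2 ^ b)
    (hroom : 8 * (k * b) + 2 * b + k ≤ N) :
    ∃ B : Finset (Fin N) → List (Fin N) → Finset (Fin N),
      (∀ Y s, IsNode k Y s → B Y s ∩ Y = s.toFinset) ∧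
      (∀ Y s t, s <+: t → B Y s ⊆ B Y t) ∧
      (∀ Y s Y' t, IsNode k Y s → IsNode k Y' t → B Y s ⊆ B Y' t → Y = Y' ∧ s <+: t) := by
  classical
  have hb0 : 0 < b := by
    rcases Nat.eq_zero_or_pos b with rfl | h
    · have := (Fact.out : q.Prime).two_le
      simp at hb
      omega
    · exact h
  have hkb : k ≤ k * b := Nat.le_mul_of_pos_right k hb0
  have hL : 3 * k + 1 ≤ q := by omega
  obtain ⟨j, -⟩ := exists_embedding_avoiding (Z := Fin N) (α := Fin (3 * k + 1) × Fin b × Bool) ∅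
    (by simp; nlinarith)
  have hι (Y : Finset (Fin N)) : ∃ f : Fin k × Fin b × Bool ↪ Fin N,
      Y.card = k → ∀ a, f a ∉ univ.map j ∪ Y := by
    by_cases hY : Y.card = k
    · obtain ⟨f, hf⟩ := exists_embedding_avoiding (α := Fin k × Fin b × Bool) (univ.map j ∪ Y) (by
        have := Finset.card_union_le (univ.map j) Y
        simp at this ⊢
        nlinarith)
      exact ⟨f, fun _ => hf⟩
    · obtain ⟨f, -⟩ := exists_embedding_avoiding (Z := Fin N) (α := Fin k × Fin b × Bool) ∅
        (by simp; nlinarith)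
      exact ⟨f, fun h => absurd h hY⟩
  choose ι hι using hι
  have hιj (Y) (hY : Y.card = k) (a c) : ι Y a ≠ j c := fun h =>
    hι Y hY a (by simp [h])
  have hιY (Y) (hY : Y.card = k) (a) : ι Y a ∉ Y := fun h => hι Y hY a (by simp [h])
  let B : Finset (Fin N) → List (Fin N) → Finset (Fin N) := fun Y s =>
    ((setCode q (3 * k + 1) b Y).map j \ Y) ∪ s.toFinset ∪ (listCode k b s).map (ι Y)
  refine ⟨B, ?_, ?_, ?_⟩
  · intro Y s hs
    ext z
    simp only [B, mem_inter, mem_union, mem_sdiff, List.mem_toFinset, Finset.mem_map]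
    constructor
    · rintro ⟨(⟨-, h⟩ | h) | ⟨a, -, rfl⟩, hz⟩
      · exact absurd hz h
      · exact h
      · exact absurd hz (hιY Y hs.1 a)
    · exact fun h => ⟨Or.inl (Or.inr h), hs.2.2 z h⟩
  · intro Y s t hst
    refine Finset.union_subset_union (Finset.union_subset_union_right ?_)
      (Finset.map_subset_map.2 (listCode_mono hst))
    intro z hz
    simp only [List.mem_toFinset] at hz ⊢
    exact hst.subset hz
  · intro Y s Y' t hs ht hsub
    have hYY : Y = Y' := by
      by_contra hne
      have hlt := lt_card_setCode_sdiff hN hb hL hs.1 ht.1 hne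
      have hsub' : (setCode q (3 * k + 1) b Y \ setCode q (3 * k + 1) b Y').map j ⊆ Y ∪ Y' := by
        intro z hz
        obtain ⟨c, hc, rfl⟩ := Finset.mem_map.1 hz
        rw [mem_sdiff] at hc
        by_cases hcY : j c ∈ Y
        · exact mem_union_left _ hcY
        · have hmem : j c ∈ B Y' t := hsub (by simp [B, hc.1, hcY])
          simp only [B, mem_union, mem_sdiff, List.mem_toFinset, Finset.mem_map] at hmem
          rcases hmem with (⟨⟨d, hd, hdc⟩, -⟩ | h) | ⟨a, -, ha⟩
          · exact absurd (j.injective hdc ▸ hd) hc.2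
          · exact mem_union_right _ (ht.2.2 _ h)
          · exact absurd ha (hιj Y' ht.1 a c)
      have h1 := (Finset.card_le_card hsub').trans (Finset.card_union_le _ _)
      rw [Finset.card_map, hs.1, ht.1] at h1
      omega
    subst hYY
    refine ⟨rfl, prefix_of_listCode_subset hb0 (hN.trans hb) hs.length_le fun a ha => ?_⟩
    have hmem : ι Y a ∈ B Y t := hsub (by simp [B, ha])
    simp only [B, mem_union, mem_sdiff, List.mem_toFinset, Finset.mem_map] at hmem
    rcases hmem with (⟨⟨d, -, hd⟩, -⟩ | h) | ⟨a', hat, h⟩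
    · exact absurd hd.symm (hιj Y hs.1 a d)
    · exact absurd (ht.2.2 _ h) (hιY Y hs.1 a)
    · exact (ι Y).injective h ▸ hat

/-- An embedding of `Q_n` into `Q(Z)` selects `n` elements of `Z` on which it acts as the
identity. -/
theorem exists_mem_iff_of_embedding {Z : Type*} {n : ℕ} (e : Finset (Fin n) ↪o Finset Z) :
    ∃ x : Fin n ↪ Z, ∀ i S, x i ∈ e S ↔ i ∈ S := by
  classical
  have hx (i : Fin n) : ∃ z, z ∈ e {i} ∧ z ∉ e {i}ᶜ := by
    have : ¬ e {i} ≤ e {i}ᶜ := by simp [e.le_iff_le]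
    exact Finset.not_subset.1 this
  choose x hx hx' using hx
  have key (i S) : x i ∈ e S ↔ i ∈ S := by
    constructor
    · intro h
      by_contra hi
      exact hx' i (e.monotone (Finset.subset_compl_comm.1 (by simpa using hi)) h)
    · intro h
      exact e.monotone (by simpa using h) (hx i)
  refine ⟨⟨x, fun i i' h => ?_⟩, key⟩
  have := (key i {i'}).1 (h ▸ hx i')
  simpa using this

/-- A coloring of `Q_(n+k)` without a blue copy of `𝚲` or a red copy of `Q_n`. -/
theorem exists_coloring {n k b q : ℕ} [Fact q.Prime] (hN : n + k ≤ q) (hb : q ≤ 2 ^ b)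
    (hroom : 8 * (k * b) + 2 * b ≤ n) :
    ∃ c : Finset (Fin (n + k)) → Bool,
      (¬ ∃ e : LPoset ↪o Finset (Fin (n + k)), ∀ p, c (e p) = true) ∧
      (¬ ∃ e : Finset (Fin n) ↪o Finset (Fin (n + k)), ∀ p, c (e p) = false) := by
  classical
  obtain ⟨B, hBY, hmono, hB⟩ := exists_trees hN hb (by omega : 8 * (k * b) + 2 * b + k ≤ n + k)
  refine ⟨fun S => decide (∃ Y s, IsNode k Y s ∧ B Y s = S), ?_, ?_⟩
  · rintro ⟨e, he⟩
    simp only [decide_eq_true_eq] at he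
    obtain ⟨Y, s, hs, h1⟩ := he .left
    obtain ⟨Y', s', hs', h2⟩ := he .right
    obtain ⟨Y'', t, ht, h3⟩ := he .top
    have hl : e .left ≤ e .top := e.le_iff_le.2 (Or.inr rfl)
    have hr : e .right ≤ e .top := e.le_iff_le.2 (Or.inr rfl)
    have hlr : ¬ e .left ≤ e .right := by
      rw [e.le_iff_le]
      rintro (h | h) <;> cases h
    have hrl : ¬ e .right ≤ e .left := by
      rw [e.le_iff_le]
      rintro (h | h) <;> cases h
    rw [← h1, ← h3] at hl
    rw [← h2, ← h3] at hr
    rw [← h1, ← h2] at hlr hrl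
    obtain ⟨rfl, hp⟩ := hB _ _ _ _ hs ht hl
    obtain ⟨rfl, hp'⟩ := hB _ _ _ _ hs' ht hr
    rcases List.prefix_or_prefix_of_prefix hp hp' with h | h
    · exact hlr (hmono _ _ _ h)
    · exact hrl (hmono _ _ _ h)
  · rintro ⟨e, he⟩
    simp only [decide_eq_false_iff_not] at he
    obtain ⟨x, hx⟩ := exists_mem_iff_of_embedding e
    let Y : Finset (Fin (n + k)) := (univ.map x)ᶜ
    have hY : Y.card = k := by simp [Y, Finset.card_compl]
    let T (s : List (Fin (n + k))) : Finset (Fin n) := univ.filter fun i => x i ∈ B Y s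
    have key (m : ℕ) : ∃ s, IsNode k Y s ∧ s.length = m ∧ ∀ y ∈ s, y ∈ e (T s) := by
      induction m with
      | zero => exact ⟨[], ⟨hY, List.nodup_nil, by simp⟩, rfl, by simp⟩
      | succ m ih =>
        obtain ⟨s, hs, hlen, hse⟩ := ih
        obtain ⟨y, hyY, hye, hys⟩ : ∃ y ∈ Y, y ∈ e (T s) ∧ y ∉ s := by
          by_contra! hcon
          refine he (T s) ⟨Y, s, hs, ?_⟩
          ext z
          by_cases hz : z ∈ Y
          · have h1 : z ∈ B Y s ↔ z ∈ s := by
              rw [← List.mem_toFinset, ← hBY Y s hs]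
              simp [hz]
            rw [h1]
            exact ⟨hse z, hcon z hz⟩
          · simp only [Y, mem_compl, not_not, Finset.mem_map, mem_univ, true_and] at hz
            obtain ⟨i, rfl⟩ := hz
            rw [hx]
            simp [T]
        refine ⟨s ++ [y], ⟨hY, ?_, ?_⟩, by simp [hlen], ?_⟩
        · rw [List.nodup_append]
          refine ⟨hs.2.1, List.nodup_singleton y, ?_⟩
          intro a ha z hz
          rw [List.mem_singleton] at hz
          rintro rfl
          exact hys (hz ▸ ha)
        · intro z hz
          rcases List.mem_append.1 hz with h | h
          · exact hs.2.2 z h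
          · rw [List.mem_singleton] at h
            exact h ▸ hyY
        · have hTT : T s ≤ T (s ++ [y]) := by
            intro i hi
            simp only [T, mem_filter, mem_univ, true_and] at hi ⊢
            exact hmono Y _ _ (List.prefix_append s [y]) hi
          intro z hz
          refine e.monotone hTT ?_
          rcases List.mem_append.1 hz with h | h
          · exact hse z h
          · rw [List.mem_singleton] at h
            exact h ▸ hye
    obtain ⟨s, hs, hlen, -⟩ := key (k + 1)
    have := hs.length_le
    omega

/-- Conjugating by complements turns an embedding of `𝕍` into one of `𝚲`. -/
theorem exists_LPoset_embedding_compl {Z : Type*} [Fintype Z] [DecidableEq Z]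
    (e : VPoset ↪o Finset Z) :
    ∃ f : LPoset ↪o Finset Z, ∀ p, ∃ v, f p = (e v)ᶜ := by
  let g : LPoset → VPoset := fun
    | .top => .bot
    | .left => .left
    | .right => .right
  have hg (a b : LPoset) : g b ≤ g a ↔ a ≤ b := by
    change (g b = g a ∨ g b = VPoset.bot) ↔ (a = b ∨ b = LPoset.top)
    cases a <;> cases b <;> simp [g]
  exact ⟨OrderEmbedding.ofMapLEIff (fun p => (e (g p))ᶜ) fun a b => by
    rw [compl_le_compl_iff_le, e.le_iff_le, hg], fun p => ⟨g p, rfl⟩⟩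

theorem exists_coloring_of_nontrivial {P : Type*} [PartialOrder P]
    (hP : Nonempty (VPoset ↪o P) ∨ Nonempty (LPoset ↪o P))
    {n k b q : ℕ} [Fact q.Prime] (hN : n + k ≤ q) (hb : q ≤ 2 ^ b)
    (hroom : 8 * (k * b) + 2 * b ≤ n) :
    ∃ c : Finset (Fin (n + k)) → Bool,
      (¬ ∃ e : P ↪o Finset (Fin (n + k)), ∀ p, c (e p) = true) ∧
      (¬ ∃ e : Finset (Fin n) ↪o Finset (Fin (n + k)), ∀ p, c (e p) = false) := by
  obtain ⟨c, hblue, hred⟩ := exists_coloring hN hb hroom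
  rcases hP with ⟨⟨i⟩⟩ | ⟨⟨i⟩⟩
  · refine ⟨fun S => c Sᶜ, ?_, ?_⟩
    · rintro ⟨e, he⟩
      obtain ⟨f, hf⟩ := exists_LPoset_embedding_compl (i.trans e)
      refine hblue ⟨f, fun p => ?_⟩
      obtain ⟨v, hv⟩ := hf p
      rw [hv]
      exact he (i v)
    · rintro ⟨e, he⟩
      exact hred ⟨OrderEmbedding.ofMapLEIff (fun S => (e Sᶜ)ᶜ) fun S T => by
        rw [compl_le_compl_iff_le, e.le_iff_le, compl_le_compl_iff_le], fun S => he Sᶜ⟩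
  · exact ⟨c, fun ⟨e, he⟩ => hblue ⟨i.trans e, fun p => he (i p)⟩, hred⟩

/-- A coloring of `Q_M` without the forbidden copies bounds the poset Ramsey number. -/
theorem lt_posetRamsey {P : Type*} [PartialOrder P] [Fintype P] {n M : ℕ}
    (c : Finset (Fin M) → Bool)
    (hblue : ¬ ∃ e : P ↪o Finset (Fin M), ∀ p, c (e p) = true)
    (hred : ¬ ∃ e : Finset (Fin n) ↪o Finset (Fin M), ∀ p, c (e p) = false) :
    M < posetRamsey P (Finset (Fin n)) := by
  refine Nat.lt_of_succ_le (le_csInf (posetRamsey_set_nonempty P n) fun m hm => ?_)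
  by_contra! hlt
  let E : Finset (Fin m) ↪o Finset (Fin M) :=
    Finset.mapEmbedding (Fin.castLEEmb (by omega : m ≤ M))
  rcases hm (fun S => c (E S)) with ⟨e, he⟩ | ⟨e, he⟩
  · exact hblue ⟨e.trans E, he⟩
  · exact hred ⟨e.trans E, he⟩

theorem six_mul_add_le_two_pow {l : ℕ} (hl : 16 ≤ l) : 6 * l + 18 ≤ 2 ^ l := by
  induction l, hl using Nat.le_induction with
  | base => norm_num
  | succ l hl ih =>
    rw [pow_succ]
    omega

/-- If `P` is a non-trivial poset (a finite poset containing an induced copy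
of `𝕍` or of `𝚲`), then for every integer `n ≥ 2^16`,
`R(P, Q_n) ≥ n + (1/15)·(n / log n)` (log base 2). -/
theorem nontrivial_poset_ramsey_lower (P : Type*) [PartialOrder P] [Fintype P]
    (hP : Nonempty (VPoset ↪o P) ∨ Nonempty (LPoset ↪o P))
    (n : ℕ) (hn : 2 ^ 16 ≤ n) :
    (n : ℝ) + (1 / 15) * ((n : ℝ) / Real.logb 2 (n : ℝ)) ≤
      (posetRamsey P (Finset (Fin n)) : ℝ) := by
  set k := ⌊(n : ℝ) / (15 * Real.logb 2 n)⌋₊ with hk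
  set l := Nat.log 2 n with hl
  have hn0 : n ≠ 0 := by
    rintro rfl
    norm_num at hn
  have hl16 : 16 ≤ l := Nat.le_log_of_pow_le (by norm_num) hn
  have hllog : (l : ℝ) ≤ Real.logb 2 n := by
    have := Real.natLog_le_logb n 2
    exact_mod_cast this
  have hl16' : (16 : ℝ) ≤ l := by exact_mod_cast hl16
  have hlog : (0 : ℝ) < 15 * Real.logb 2 n := by linarith
  have hkl : 15 * (k * l) ≤ n := by
    have h1 : (k : ℝ) ≤ n / (15 * Real.logb 2 n) := Nat.floor_le (by positivity)
    rw [le_div_iff₀ hlog] at h1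
    have h2 : (k : ℝ) * l ≤ k * Real.logb 2 n := by gcongr
    have h3 : (15 : ℝ) * (k * l) ≤ n := by linarith
    exact_mod_cast h3
  have hpow : 2 ^ l ≤ n := Nat.pow_log_le_self 2 hn0
  have hpow' : n < 2 ^ (l + 1) := Nat.lt_pow_succ_log_self (by norm_num) n
  have hsix := six_mul_add_le_two_pow hl16
  have h16k : 16 * k ≤ k * l := by
    rw [mul_comm]
    exact Nat.mul_le_mul_left k hl16
  have hkn : k ≤ n := by omega
  obtain ⟨q, hq, hNq, hq2⟩ := Nat.exists_prime_lt_and_le_two_mul (n + k) (by omega)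
  have : Fact q.Prime := ⟨hq⟩
  have hb : q ≤ 2 ^ (l + 3) := by
    have : 2 ^ (l + 3) = 4 * 2 ^ (l + 1) := by ring
    omega
  have hroom : 8 * (k * (l + 3)) + 2 * (l + 3) ≤ n := by
    rw [mul_add]
    omega
  obtain ⟨c, hblue, hred⟩ := exists_coloring_of_nontrivial hP hNq.le hb hroom
  have hlt : n + k + 1 ≤ posetRamsey P (Finset (Fin n)) := lt_posetRamsey c hblue hred
  have hlt' : (n : ℝ) + k + 1 ≤ posetRamsey P (Finset (Fin n)) := by exact_mod_cast hlt
  have hfloor : (n : ℝ) / (15 * Real.logb 2 n) < k + 1 := Nat.lt_floor_add_one _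
  have heq : (1 / 15) * ((n : ℝ) / Real.logb 2 n) = n / (15 * Real.logb 2 n) := by
    rw [div_mul_div_comm, one_mul]
  rw [heq]
  linarith
end

section
/- For every integer n ≥ 2^16, R(𝚲, Q_n) ≥ n + (1/15)·(n / log n), where 𝚲 is the 3-element Λ-shaped poset. -/
open Finset

/-- The encoding of the word `S`: its `i`-th letter `y` contributes the points of `α` that `D`
assigns to `(i, b, bits y b)`, so that distinct letters have incomparable encodings. -/
def wordCode {α : Type*} [Fintype α] [DecidableEq α] {k r : ℕ} (D : Fin k × Fin r × Bool ↪ α)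
    (bits : α → Fin r → Bool) (S : List α) : Finset α :=
  univ.filter fun x => ∃ i : Fin k, ∃ b y, S[(i : ℕ)]? = some y ∧ x = D (i, b, bits y b)

/-- A vertex of the shrub on `Y`, indexed by a word `S` of distinct letters of `Y`. -/
def shrub {α : Type*} [Fintype α] [DecidableEq α] {k m r : ℕ} (P : Fin m × Fin r × Bool ↪ α)
    (D : Finset α → (Fin k × Fin r × Bool ↪ α)) (w : Finset α → Fin m → Fin r → Bool)
    (bits : α → Fin r → Bool) (Y : Finset α) (S : List α) : Finset α :=
  S.toFinset ∪ (univ.filter fun x => x ∉ Y ∧ ∃ j b, x = P (j, b, w Y j b)) ∪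
    wordCode (D Y) bits S

section Shrub

variable {α : Type*} [Fintype α] [DecidableEq α] {k m r : ℕ} {P : Fin m × Fin r × Bool ↪ α}
  {D : Finset α → (Fin k × Fin r × Bool ↪ α)} {w : Finset α → Fin m → Fin r → Bool}
  {bits : α → Fin r → Bool}

theorem mem_shrub {Y : Finset α} {S : List α} {x : α} :
    x ∈ shrub P D w bits Y S ↔ x ∈ S ∨ (x ∉ Y ∧ ∃ j b, x = P (j, b, w Y j b)) ∨
      ∃ i : Fin k, ∃ b y, S[(i : ℕ)]? = some y ∧ x = D Y (i, b, bits y b) := by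
  simp [shrub, wordCode]

theorem shrub_mono {Y : Finset α} {S T : List α} (h : S <+: T) :
    shrub P D w bits Y S ⊆ shrub P D w bits Y T := by
  intro x hx
  rw [mem_shrub] at hx ⊢
  rcases hx with hx | hx | ⟨i, b, y, hy, rfl⟩
  · exact Or.inl (h.subset hx)
  · exact Or.inr (Or.inl hx)
  · refine Or.inr (Or.inr ⟨i, b, y, ?_, rfl⟩)
    obtain ⟨U, rfl⟩ := h
    rw [List.getElem?_append_left (List.getElem?_eq_some_iff.1 hy).1]
    exact hy

theorem mem_shrub_of_mem {Y : Finset α} {S : List α} (hD : ∀ i, D Y i ∉ Y) {x : α} (hx : x ∈ Y) :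
    x ∈ shrub P D w bits Y S ↔ x ∈ S := by
  rw [mem_shrub]
  constructor
  · rintro (h | h | ⟨i, b, y, -, rfl⟩)
    · exact h
    · exact absurd hx h.1
    · exact absurd hx (hD _)
  · exact Or.inl

theorem prefix_of_shrub_subset (hr : 0 < r) (hbits : Function.Injective bits) {Y : Finset α}
    (hDY : ∀ i, D Y i ∉ Y) (hDP : ∀ i, D Y i ∉ Set.range P) {S T : List α}
    (hS : S.length ≤ k) (hT : ∀ y ∈ T, y ∈ Y)
    (h : shrub P D w bits Y S ⊆ shrub P D w bits Y T) : S <+: T := by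
  rw [List.prefix_iff_getElem?]
  intro i hi
  have key : ∀ b, ∃ y, T[i]? = some y ∧ bits S[i] b = bits y b := by
    intro b
    have hm : D Y (⟨i, hi.trans_le hS⟩, b, bits S[i] b) ∈ shrub P D w bits Y S :=
      mem_shrub.2 (Or.inr (Or.inr ⟨⟨i, hi.trans_le hS⟩, b, S[i], by simp, rfl⟩))
    rcases mem_shrub.1 (h hm) with h1 | ⟨-, j, b', h1⟩ | ⟨i', b', y, hy, h1⟩
    · exact absurd (hT _ h1) (hDY _)
    · exact absurd ⟨_, h1.symm⟩ (hDP _)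
    · have := (D Y).injective h1
      simp only [Prod.mk.injEq] at this
      obtain ⟨rfl, rfl, h2⟩ := this
      exact ⟨y, hy, h2⟩
  obtain ⟨y, hy, -⟩ := key ⟨0, hr⟩
  rw [hy]
  have : bits S[i] = bits y := by
    funext b
    obtain ⟨y', hy', h'⟩ := key b
    rw [hy] at hy'
    cases hy'
    exact h'
  rw [hbits this]

theorem eq_of_shrub_subset (hm : 3 * k < m) {Y Y' : Finset α}
    (hDP : ∀ i, D Y' i ∉ Set.range P) (hY : #Y = k) (hY' : #Y' = k)
    (hw : k < #(univ.filter fun j => w Y j = w Y' j) → Y = Y') {S T : List α}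
    (hT : ∀ y ∈ T, y ∈ Y')
    (h : shrub P D w bits Y S ⊆ shrub P D w bits Y' T) : Y = Y' := by
  apply hw
  let proj : α → Finset (Fin m) := fun x => univ.filter fun j => ∃ q, P (j, q) = x
  have hproj : ∀ x, #(proj x) ≤ 1 := by
    intro x
    rw [card_le_one]
    intro a ha b hb
    simp only [proj, mem_filter, mem_univ, true_and] at ha hb
    obtain ⟨q, rfl⟩ := ha
    obtain ⟨q', h'⟩ := hb
    exact (congrArg Prod.fst (P.injective h')).symm
  have hcover : (univ : Finset (Fin m)) ⊆
      (univ.filter fun j => w Y j = w Y' j) ∪ (Y ∪ Y').biUnion proj := by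
    intro j _
    by_contra hj
    simp only [mem_union, mem_filter, mem_univ, true_and, mem_biUnion, not_or, not_exists,
      not_and, proj] at hj
    obtain ⟨h1, h2⟩ := hj
    apply h1
    funext b
    have hP : P (j, b, w Y j b) ∈ shrub P D w bits Y S :=
      mem_shrub.2 (Or.inr (Or.inl ⟨fun hx => h2 _ (Or.inl hx) _ rfl, j, b, rfl⟩))
    rcases mem_shrub.1 (h hP) with h3 | ⟨-, j', b', h3⟩ | ⟨i', b', y, hy, h3⟩
    · exact absurd rfl (h2 _ (Or.inr (hT _ h3)) _)
    · have := P.injective h3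
      simp only [Prod.mk.injEq] at this
      obtain ⟨rfl, rfl, h4⟩ := this
      exact h4
    · exact absurd ⟨_, h3⟩ (hDP _)
  have h1 := card_le_card hcover
  have h2 := card_union_le (univ.filter fun j => w Y j = w Y' j) ((Y ∪ Y').biUnion proj)
  have h3 : #((Y ∪ Y').biUnion proj) ≤ #(Y ∪ Y') * 1 :=
    card_biUnion_le_card_mul _ _ _ fun x _ => hproj x
  have h4 := card_union_le Y Y'
  rw [card_univ, Fintype.card_fin] at h1
  omega

end Shrub

/-- Every copy of `Q_n` in a Boolean lattice restricts to the identity on some `n`-element set. -/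
theorem exists_coordinates {α : Type*} [DecidableEq α] {n : ℕ}
    (e : Finset (Fin n) ↪o Finset α) :
    ∃ x : Fin n ↪ α, ∀ S i, x i ∈ e S ↔ i ∈ S := by
  have h : ∀ i : Fin n, ∃ a, a ∈ e {i} ∧ a ∉ e (univ.erase i) := by
    intro i
    rw [← not_subset]
    intro hs
    have : ({i} : Finset (Fin n)) ≤ univ.erase i := e.le_iff_le.1 hs
    exact absurd (this (mem_singleton_self i)) (notMem_erase i _)
  choose x hx hx' using h
  have hmem : ∀ S i, x i ∈ e S ↔ i ∈ S := by
    intro S i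
    constructor
    · intro hi
      by_contra hiS
      have : S ≤ univ.erase i := fun j hj => mem_erase.2 ⟨fun h => hiS (h ▸ hj), mem_univ j⟩
      exact hx' i (e.le_iff_le.2 this hi)
    · intro hi
      have : ({i} : Finset (Fin n)) ≤ S := singleton_subset_iff.2 hi
      exact e.le_iff_le.2 this (hx i)
  refine ⟨⟨x, fun i j hij => ?_⟩, hmem⟩
  have := (hmem {j} i).1 (hij ▸ hx j)
  exact mem_singleton.1 this

/-- Duality: blue shrubs on all `k`-sets exclude a red Boolean lattice of codimension `k`. -/
theorem no_red_copy {α : Type*} [Fintype α] [DecidableEq α] {n k : ℕ}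
    (hcard : Fintype.card α = n + k) (c : Finset α → Bool) (τ : Finset α → List α → Finset α)
    (hmono : ∀ Y S T, S <+: T → τ Y S ⊆ τ Y T)
    (hmem : ∀ Y, #Y = k → ∀ S, ∀ y ∈ Y, y ∈ τ Y S ↔ y ∈ S)
    (hblue : ∀ Y, #Y = k → ∀ S : List α, S.Nodup → (∀ y ∈ S, y ∈ Y) → c (τ Y S) = true)
    (e : Finset (Fin n) ↪o Finset α) (hred : ∀ q, c (e q) = false) : False := by
  obtain ⟨x, hx⟩ := exists_coordinates e
  let Y : Finset α := (univ.map x)ᶜ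
  have hY : #Y = k := by
    simp [Y, card_compl, hcard]
  let A : List α → Finset (Fin n) := fun S => univ.filter fun i => x i ∈ τ Y S
  have key : ∀ j, ∃ S : List α, S.length = j ∧ S.Nodup ∧ (∀ y ∈ S, y ∈ Y) ∧
      ∀ y ∈ S, y ∈ e (A S) := by
    intro j
    induction j with
    | zero => exact ⟨[], by simp⟩
    | succ j ih =>
      obtain ⟨S, hlen, hnd, hSY, hSe⟩ := ih
      have : ∃ y ∈ Y, y ∈ e (A S) ∧ y ∉ S := by
        by_contra! hcon
        have heq : e (A S) = τ Y S := by
          ext a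
          by_cases ha : a ∈ Y
          · rw [hmem Y hY S a ha]
            exact ⟨hcon a ha, hSe a⟩
          · simp only [Y, mem_compl, not_not, mem_map, mem_univ, true_and] at ha
            obtain ⟨i, rfl⟩ := ha
            rw [hx]
            simp [A]
        have h1 := hred (A S)
        rw [heq, hblue Y hY S hnd hSY] at h1
        exact absurd h1 (by decide)
      obtain ⟨y, hyY, hye, hyS⟩ := this
      have hA : A S ≤ A (S ++ [y]) := by
        intro i hi
        simp only [A, mem_filter, mem_univ, true_and] at hi ⊢
        exact hmono Y _ _ (List.prefix_append S [y]) hi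
      have hsub : e (A S) ⊆ e (A (S ++ [y])) := e.le_iff_le.2 hA
      refine ⟨S ++ [y], by simp [hlen], ?_, ?_, ?_⟩
      · rw [← List.concat_eq_append]
        exact hnd.concat hyS
      · intro z hz
        rcases List.mem_append.1 hz with hz | hz
        · exact hSY z hz
        · rw [List.mem_singleton.1 hz]
          exact hyY
      · intro z hz
        rcases List.mem_append.1 hz with hz | hz
        · exact hsub (hSe z hz)
        · rw [List.mem_singleton.1 hz]
          exact hsub hye
  obtain ⟨S, hlen, hnd, hSY, -⟩ := key (k + 1)
  have h1 : #S.toFinset ≤ #Y := card_le_card fun y hy => hSY y (List.mem_toFinset.1 hy)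
  rw [List.toFinset_card_of_nodup hnd, hlen, hY] at h1
  omega

/-- The `k`-subsets of a set embedded in a field are determined by the values of their monic
polynomials at any `k + 1` points. -/
theorem eq_of_prod_eval_eq {α F : Type*} [DecidableEq α] [Field F] {v : α → F}
    (hv : Function.Injective v) {Y Y' : Finset α} {k : ℕ} (hY : #Y = k) (hY' : #Y' = k)
    (s : Finset F) (hs : k < #s)
    (h : ∀ t ∈ s, ∏ y ∈ Y, (t - v y) = ∏ y ∈ Y', (t - v y)) : Y = Y' := by
  have hdeg : ∀ Z : Finset α, #Z = k →
      (∏ y ∈ Z, (Polynomial.X - Polynomial.C (v y))).degree < ((#s : ℕ) : WithBot ℕ) := by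
    intro Z hZ
    rw [Polynomial.degree_prod]
    simp only [Polynomial.degree_X_sub_C, sum_const, hZ, nsmul_eq_mul, mul_one]
    exact_mod_cast hs
  have hpoly := Polynomial.eq_of_degrees_lt_of_eval_finset_eq s (hdeg Y hY) (hdeg Y' hY') (by
    intro t ht
    simpa [Polynomial.eval_prod] using h t ht)
  ext y
  have h1 := congrArg (Polynomial.eval (v y)) hpoly
  have h2 : ∀ Z : Finset α,
      (∏ z ∈ Z, (Polynomial.X - Polynomial.C (v z))).eval (v y) = 0 ↔ y ∈ Z := by
    intro Z
    simp [Polynomial.eval_prod, prod_eq_zero_iff, sub_eq_zero, hv.eq_iff]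
  rw [← h2 Y, ← h2 Y', h1]

theorem exists_injective_bits {β : Type*} [Fintype β] {r : ℕ} (h : Fintype.card β ≤ 2 ^ r) :
    ∃ f : β → Fin r → Bool, Function.Injective f := by
  obtain ⟨f⟩ := Function.Embedding.nonempty_of_card_le (α := β) (β := Fin r → Bool) (by simpa)
  exact ⟨f, f.injective⟩

/-- A code on the `k`-subsets of `α` in which two words with more than `k` common letters agree. -/
theorem exists_code {α : Type*} [Fintype α] [DecidableEq α] {k m r : ℕ}
    (hα : Fintype.card α ≠ 0) (hm : m ≤ Fintype.card α) (hr : 2 * Fintype.card α ≤ 2 ^ r) :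
    ∃ w : Finset α → Fin m → Fin r → Bool, ∀ Y Y' : Finset α, #Y = k → #Y' = k →
      k < #(univ.filter fun j => w Y j = w Y' j) → Y = Y' := by
  obtain ⟨p, hp, hlt, hle⟩ := Nat.exists_prime_lt_and_le_two_mul _ hα
  have : Fact p.Prime := ⟨hp⟩
  obtain ⟨v⟩ := Function.Embedding.nonempty_of_card_le (α := α) (β := ZMod p) (by
    rw [ZMod.card]; exact hlt.le)
  obtain ⟨pt⟩ := Function.Embedding.nonempty_of_card_le (α := Fin m) (β := ZMod p) (by
    rw [ZMod.card, Fintype.card_fin]; omega)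
  obtain ⟨f, hf⟩ := exists_injective_bits (β := ZMod p) (r := r) (by rw [ZMod.card]; omega)
  refine ⟨fun Y j => f (∏ y ∈ Y, (pt j - v y)), fun Y Y' hY hY' h => ?_⟩
  refine eq_of_prod_eval_eq v.injective hY hY' ((univ.filter _).map pt) (by rwa [card_map]) ?_
  intro t ht
  simp only [mem_map, mem_filter, mem_univ, true_and] at ht
  obtain ⟨j, hj, rfl⟩ := ht
  exact hf hj

theorem exists_coloring_s2 {α : Type*} [Fintype α] [DecidableEq α] {n k r : ℕ}
    (hcard : Fintype.card α = n + k) (hr : 2 * (n + k) ≤ 2 ^ r)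
    (hn : 2 * r * (4 * k + 1) ≤ n) (hr0 : 0 < r) :
    ∃ c : Finset α → Bool, (¬ ∃ e : LPoset ↪o Finset α, ∀ p, c (e p) = true) ∧
      ¬ ∃ e : Finset (Fin n) ↪o Finset α, ∀ q, c (e q) = false := by
  classical
  have hkn : 4 * k + 1 ≤ n := le_trans (Nat.le_mul_of_pos_left _ (by omega)) hn
  obtain ⟨w, hw⟩ := exists_code (α := α) (k := k) (m := 3 * k + 1) (r := r)
    (by omega) (by omega) (by omega)
  obtain ⟨bits, hbits⟩ := exists_injective_bits (β := α) (r := r) (by omega)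
  obtain ⟨P⟩ := Function.Embedding.nonempty_of_card_le
    (α := Fin (3 * k + 1) × Fin r × Bool) (β := α) (by
      simp only [Fintype.card_prod, Fintype.card_fin, Fintype.card_bool, hcard]
      nlinarith)
  have hD : ∀ Y : Finset α, ∃ D : Fin k × Fin r × Bool ↪ α, #Y = k →
      ∀ i, D i ∉ Y ∧ D i ∉ Set.range P := by
    intro Y
    let Z : Finset α := (Y ∪ univ.map P)ᶜ
    by_cases hY : #Y = k
    · have hZ : Fintype.card (Fin k × Fin r × Bool) ≤ Fintype.card Z := by
        have h1 : #(Y ∪ univ.map P) ≤ k + (3 * k + 1) * (r * 2) := by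
          refine (card_union_le _ _).trans ?_
          simp [hY]
        have h2 : (3 * k + 1) * (r * 2) + k * (r * 2) = 2 * r * (4 * k + 1) := by ring
        simp only [Fintype.card_coe, Z, card_compl, hcard, Fintype.card_prod, Fintype.card_fin,
          Fintype.card_bool]
        omega
      obtain ⟨D⟩ := Function.Embedding.nonempty_of_card_le hZ
      refine ⟨D.trans (Function.Embedding.subtype _), fun _ i => ?_⟩
      have h1 : (D i : α) ∉ Y ∪ univ.map P := mem_compl.1 (D i).2
      rw [mem_union, not_or] at h1
      refine ⟨h1.1, ?_⟩
      rintro ⟨q, hq⟩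
      exact h1.2 (mem_map.2 ⟨q, mem_univ _, hq⟩)
    · obtain ⟨D⟩ := Function.Embedding.nonempty_of_card_le
        (α := Fin k × Fin r × Bool) (β := α) (by
          simp only [Fintype.card_prod, Fintype.card_fin, Fintype.card_bool, hcard]
          nlinarith)
      exact ⟨D, fun h => absurd h hY⟩
  choose D hD using hD
  let c : Finset α → Bool := fun Z => decide (∃ Y : Finset α, #Y = k ∧ ∃ S : List α,
    S.Nodup ∧ (∀ y ∈ S, y ∈ Y) ∧ Z = shrub P D w bits Y S)
  refine ⟨c, ?_, ?_⟩
  · rintro ⟨e, he⟩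
    simp only [c, decide_eq_true_eq] at he
    obtain ⟨Y, hY, T, -, hTY, hT⟩ := he .top
    have hbelow : ∀ p, ∃ S, S <+: T ∧ e p = shrub P D w bits Y S := by
      intro p
      obtain ⟨Y', hY', S, hnd, hSY, hS⟩ := he p
      have hle : e p ⊆ e .top := e.le_iff_le.2 (Or.inr rfl)
      rw [hS, hT] at hle
      obtain rfl : Y' = Y := eq_of_shrub_subset (by omega) (fun i => (hD Y hY i).2) hY' hY
        (hw _ _ hY' hY) hTY hle
      refine ⟨S, prefix_of_shrub_subset hr0 hbits (fun i => (hD _ hY i).1)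
        (fun i => (hD _ hY i).2) ?_ hTY hle, hS⟩
      rw [← hY, ← List.toFinset_card_of_nodup hnd]
      exact card_le_card fun y hy => hSY y (List.mem_toFinset.1 hy)
    obtain ⟨S₁, h₁, hS₁⟩ := hbelow .left
    obtain ⟨S₂, h₂, hS₂⟩ := hbelow .right
    rcases List.prefix_or_prefix_of_prefix h₁ h₂ with h | h
    · have hle : e .left ≤ e .right := by
        rw [hS₁, hS₂]
        exact shrub_mono h
      rcases e.le_iff_le.1 hle with h | h <;> cases h
    · have hle : e .right ≤ e .left := by
        rw [hS₁, hS₂]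
        exact shrub_mono h
      rcases e.le_iff_le.1 hle with h | h <;> cases h
  · rintro ⟨e, he⟩
    refine no_red_copy hcard c (shrub P D w bits) (fun Y S T h => shrub_mono h) ?_ ?_ e he
    · intro Y hY S y hy
      exact mem_shrub_of_mem (fun i => (hD Y hY i).1) hy
    · intro Y hY S hnd hSY
      exact decide_eq_true ⟨Y, hY, S, hnd, hSY, rfl⟩

/-- The set `S`, the first `#S` blocks of a sequence of blocks, and the part `T` of the next one. -/
def blob {n : ℕ} (S : Finset (Fin n)) (T : Finset Bool) : Finset (Fin n ⊕ Fin (n + 1) × Bool) :=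
  S.disjSum (univ.filter fun q => (q.1 : ℕ) < #S ∨ (q.1 : ℕ) = #S ∧ q.2 ∈ T)

theorem inl_mem_blob {n : ℕ} {S : Finset (Fin n)} {T : Finset Bool} {i : Fin n} :
    Sum.inl i ∈ blob S T ↔ i ∈ S := by
  simp [blob]

theorem inr_mem_blob {n : ℕ} {S : Finset (Fin n)} {T : Finset Bool} {q : Fin (n + 1) × Bool} :
    Sum.inr q ∈ blob S T ↔ (q.1 : ℕ) < #S ∨ (q.1 : ℕ) = #S ∧ q.2 ∈ T := by
  simp [blob]

theorem blob_subset_blob_iff {n : ℕ} {S : Finset (Fin n)} {T T' : Finset Bool} :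
    blob S T ⊆ blob S T' ↔ T ⊆ T' := by
  constructor
  · intro h b hb
    have hS : #S < n + 1 := Nat.lt_succ_of_le (by simpa using card_le_univ S)
    have := h (inr_mem_blob.2 (Or.inr ⟨rfl, hb⟩) : Sum.inr (⟨#S, hS⟩, b) ∈ blob S T)
    simpa [inr_mem_blob] using this
  · rintro h (i | q) hx
    · rw [inl_mem_blob] at hx ⊢
      exact hx
    · rw [inr_mem_blob] at hx ⊢
      exact hx.imp_right (And.imp_right (@h _))

theorem blob_subset_blob_of_ssubset {n : ℕ} {S S' : Finset (Fin n)} {T T' : Finset Bool}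
    (h : S ⊂ S') : blob S T ⊆ blob S' T' := by
  have hc := card_lt_card h
  rintro (i | q) hx
  · rw [inl_mem_blob] at hx ⊢
    exact h.1 hx
  · rw [inr_mem_blob] at hx ⊢
    omega

/-- The poset `𝚲` embeds into the Boolean lattice on two points. -/
def lambdaEmbedding : LPoset ↪o Finset Bool :=
  OrderEmbedding.ofMapLEIff
    (fun p => match p with
      | .top => univ
      | .left => {true}
      | .right => {false})
    (by
      intro a b
      change _ ↔ (a = b ∨ b = LPoset.top)
      cases a <;> cases b <;> decide)

/-- The blob argument: a Boolean lattice of large dimension contains a blue `𝚲` or a red `Q_n`. -/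
theorem exists_posetRamsey_witness (n : ℕ) : ∃ N : ℕ, ∀ c : Finset (Fin N) → Bool,
    (∃ e : LPoset ↪o Finset (Fin N), ∀ p, c (e p) = true) ∨
    (∃ e : Finset (Fin n) ↪o Finset (Fin N), ∀ q, c (e q) = false) := by
  let σ := Fintype.equivFin (Fin n ⊕ Fin (n + 1) × Bool)
  refine ⟨Fintype.card (Fin n ⊕ Fin (n + 1) × Bool), fun c => ?_⟩
  let g : Finset (Fin n ⊕ Fin (n + 1) × Bool) ↪o _ := mapEmbedding σ.toEmbedding
  by_cases h : ∃ S, ∀ T, c (g (blob S T)) = true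
  · obtain ⟨S, hS⟩ := h
    exact Or.inl ⟨(lambdaEmbedding.trans
      (OrderEmbedding.ofMapLEIff (blob S) fun _ _ => blob_subset_blob_iff)).trans g,
      fun p => hS _⟩
  · push Not at h
    choose T hT using h
    have hle : ∀ S S', blob S (T S) ≤ blob S' (T S') ↔ S ≤ S' := by
      intro S S'
      constructor
      · intro hle i hi
        exact inl_mem_blob.1 (hle (inl_mem_blob.2 hi))
      · intro hle
        rcases eq_or_ssubset_of_subset hle with rfl | hlt
        · exact le_rfl
        · exact blob_subset_blob_of_ssubset hlt
    exact Or.inr ⟨(OrderEmbedding.ofMapLEIff (fun S => blob S (T S)) hle).trans g,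
      fun q => Bool.eq_false_iff.2 (hT q)⟩

/-- The arithmetic behind the choice of the length `Nat.log 2 n + 3` of the binary encodings. -/
theorem encoding_length_bounds {n k : ℕ} (hn : 2 ^ 16 ≤ n) (hk : 15 * (k * Nat.log 2 n) < n) :
    2 * (n + k) ≤ 2 ^ (Nat.log 2 n + 3) ∧ 2 * (Nat.log 2 n + 3) * (4 * k + 1) ≤ n := by
  have hl : 16 ≤ Nat.log 2 n := Nat.le_log_of_pow_le (by norm_num) hn
  have hup : n < 2 ^ (Nat.log 2 n + 1) := Nat.lt_pow_succ_log_self (by norm_num) n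
  have hlow : 2 ^ Nat.log 2 n ≤ n := Nat.pow_log_le_self 2 (by omega)
  generalize Nat.log 2 n = l at *
  have hkl : k * 16 ≤ k * l := Nat.mul_le_mul_left k hl
  have hexp : 100 * l ≤ 2 ^ l := by
    clear hup hlow hkl hk
    induction l, hl using Nat.le_induction with
    | base => norm_num
    | succ l hl ih => rw [pow_succ]; omega
  refine ⟨?_, ?_⟩
  · rw [pow_succ] at hup
    rw [pow_add]
    omega
  · have : 2 * (l + 3) * (4 * k + 1) = 8 * (k * l) + 2 * l + 24 * k + 6 := by ring
    omega

/-- For every integer `n ≥ 2^16`,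
`R(𝚲, Q_n) ≥ n + (1/15)·(n / log n)` (log base 2). -/
theorem lambda_ramsey_lower (n : ℕ) (hn : 2 ^ 16 ≤ n) :
    (n : ℝ) + (1 / 15) * ((n : ℝ) / Real.logb 2 (n : ℝ)) ≤
      (posetRamsey LPoset (Finset (Fin n)) : ℝ) := by
  have hne : {N : ℕ | ∀ c : Finset (Fin N) → Bool,
      (∃ e : LPoset ↪o Finset (Fin N), ∀ p, c (e p) = true) ∨
      (∃ e : Finset (Fin n) ↪o Finset (Fin N), ∀ q, c (e q) = false)}.Nonempty :=
    exists_posetRamsey_witness n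
  have hmem := Nat.sInf_mem hne
  change posetRamsey LPoset (Finset (Fin n)) ∈ _ at hmem
  generalize posetRamsey LPoset (Finset (Fin n)) = N at hmem ⊢
  by_contra! hlt
  have hnN : n ≤ N := by
    rcases hmem fun _ => false with ⟨e, he⟩ | ⟨e, -⟩
    · exact absurd (he .top) (by simp)
    · obtain ⟨x, -⟩ := exists_coordinates e
      simpa using Fintype.card_le_of_embedding x
  obtain ⟨k, rfl⟩ := Nat.exists_eq_add_of_le hnN
  have hn0 : (0 : ℝ) < n := by
    have : 0 < n := lt_of_lt_of_le (by norm_num) hn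
    exact_mod_cast this
  have hl : 16 ≤ Nat.log 2 n := Nat.le_log_of_pow_le (by norm_num) hn
  have hlog : (Nat.log 2 n : ℝ) ≤ Real.logb 2 n := by
    exact_mod_cast Real.natLog_le_logb n 2
  have hlog0 : 0 < Real.logb 2 (n : ℝ) :=
    lt_of_lt_of_le (by exact_mod_cast (by omega : 0 < Nat.log 2 n)) hlog
  have hk : 15 * (k * Nat.log 2 n) < n := by
    push_cast at hlt
    have h1 : 15 * (k : ℝ) < n / Real.logb 2 n := by linarith
    rw [lt_div_iff₀ hlog0] at h1
    have h2 : (k : ℝ) * Nat.log 2 n ≤ k * Real.logb 2 n := by gcongr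
    have h3 : 15 * ((k : ℝ) * Nat.log 2 n) < n := by linarith
    exact_mod_cast h3
  obtain ⟨h1, h2⟩ := encoding_length_bounds hn hk
  obtain ⟨c, hblue, hred⟩ := exists_coloring_s2 (α := Fin (n + k)) (n := n) (k := k)
    (r := Nat.log 2 n + 3) (by simp) h1 h2 (by omega)
  exact (hmem c).elim hblue hred
end

section
/- Let ℓ ≥ 2 and let t_1, …, t_ℓ be fixed positive integers. For every ε > 0 there exists n_0 such that for all integers n ≥ n_0, R(K_{t_1,…,t_ℓ}, Q_n) ≤ n + (2ℓ + ε)·(n / log n). -/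
open Finset

/-- The complete multipartite poset `K_{t 0, …, t (ℓ-1)}`: pairwise disjoint antichains
`A^0, …, A^{ℓ-1}` with `|A^i| = t i`, where an element of `A^i` is strictly below an
element of `A^j` iff `i < j`. -/
def Multipartite (ℓ : ℕ) (t : Fin ℓ → ℕ) : Type := Σ i : Fin ℓ, Fin (t i)

instance (ℓ : ℕ) (t : Fin ℓ → ℕ) : PartialOrder (Multipartite ℓ t) where
  le x y := x.1 < y.1 ∨ x = y
  le_refl x := Or.inr rfl
  le_trans x y z h₁ h₂ := by
    rcases h₁ with h₁ | rfl
    · rcases h₂ with h₂ | rfl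
      · exact Or.inl (h₁.trans h₂)
      · exact Or.inl h₁
    · exact h₂
  le_antisymm x y h₁ h₂ := by
    rcases h₁ with h₁ | rfl
    · rcases h₂ with h₂ | rfl
      · exact absurd (h₁.trans h₂) (lt_irrefl _)
      · rfl
    · rfl

/-- Below `S` there is a chain of length `i + 1` in `{S | p S}` avoiding `R` level by level. -/
def HasAvoidingChain {α : Type*} [Preorder α] (p : α → Prop) (R : α → ℕ → Prop) : ℕ → α → Prop
  | 0, S => ∃ U ≤ S, p U ∧ ¬ R U 0
  | m + 1, S => ∃ U ≤ S, p U ∧ HasAvoidingChain p R m U ∧ ¬ R U (m + 1)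

/-- Either a predicate `R` on `α × {0, …, k}` has a monotone selector `i` on `{S | p S}`,
or there is a chain in `{S | p S}` of length `k + 1` avoiding `R` level by level. -/
theorem exists_monotone_selector_or_chain {α : Type*} [Preorder α] (p : α → Prop)
    (R : α → ℕ → Prop) (k : ℕ) :
    (∃ i : α → ℕ, Monotone i ∧ (∀ S, i S ≤ k) ∧ ∀ S, p S → R S (i S)) ∨
    (∃ s : ℕ → α, Monotone s ∧ ∀ m ≤ k, p (s m) ∧ ¬ R (s m) m) := by
  classical
  have hmono : ∀ i S S', S ≤ S' → HasAvoidingChain p R i S → HasAvoidingChain p R i S' := by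
    intro i S S' h hb
    cases i with
    | zero => obtain ⟨U, hU, h2⟩ := hb; exact ⟨U, hU.trans h, h2⟩
    | succ m => obtain ⟨U, hU, h2⟩ := hb; exact ⟨U, hU.trans h, h2⟩
  have hchain : ∀ i S, HasAvoidingChain p R i S →
      ∃ s : ℕ → α, Monotone s ∧ (∀ m, s m ≤ S) ∧ ∀ m ≤ i, p (s m) ∧ ¬ R (s m) m := by
    intro i
    induction i with
    | zero =>
      rintro S ⟨U, hU, hp, hR⟩
      refine ⟨fun _ => U, monotone_const, fun _ => hU, fun m hm => ?_⟩
      obtain rfl : m = 0 := by omega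
      exact ⟨hp, hR⟩
    | succ i ih =>
      rintro S ⟨U, hU, hp, hb, hR⟩
      obtain ⟨s, hs, hsU, h⟩ := ih U hb
      refine ⟨fun m => if m ≤ i then s m else U, ?_, ?_, ?_⟩
      · intro a b hab
        dsimp only
        split_ifs with h1 h2
        · exact hs hab
        · exact hsU a
        · omega
        · exact le_rfl
      · intro m
        dsimp only
        split_ifs
        · exact (hsU m).trans hU
        · exact hU
      · intro m hm
        dsimp only
        split_ifs with h1
        · exact h m h1
        · obtain rfl : m = i + 1 := by omega
          exact ⟨hp, hR⟩
  rcases Classical.em (∃ S : α, HasAvoidingChain p R k S) with ⟨S, hS⟩ | hk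
  · obtain ⟨s, hs, -, h⟩ := hchain k S hS
    exact Or.inr ⟨s, hs, h⟩
  · push Not at hk
    left
    have hex : ∀ S, ∃ i, ¬ HasAvoidingChain p R i S := fun S => ⟨k, hk S⟩
    refine ⟨fun S => Nat.find (hex S), ?_, fun S => Nat.find_le (hk S), ?_⟩
    · intro S S' h
      exact Nat.find_le fun hb => Nat.find_spec (hex S') (hmono _ _ _ h hb)
    · intro S hp
      have hspec := Nat.find_spec (hex S)
      have hmin := fun m => Nat.find_min (hex S) (m := m)
      dsimp only
      generalize Nat.find (hex S) = i at hspec hmin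
      by_contra hR
      cases i with
      | zero => exact hspec ⟨S, le_rfl, hp, hR⟩
      | succ m => exact hspec ⟨S, le_rfl, hp, not_not.1 (hmin m (Nat.lt_succ_self m)), hR⟩

/-- The set of the first `i` elements in the linear order given by the permutation `τ`. -/
def permPrefix {k : ℕ} (τ : Equiv.Perm (Fin k)) (i : ℕ) : Finset (Fin k) :=
  univ.filter fun y => (τ y).val < i

theorem mem_permPrefix {k : ℕ} {τ : Equiv.Perm (Fin k)} {i : ℕ} {y : Fin k} :
    y ∈ permPrefix τ i ↔ (τ y).val < i := by
  simp [permPrefix]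

theorem permPrefix_mono {k : ℕ} (τ : Equiv.Perm (Fin k)) : Monotone (permPrefix τ) :=
  fun _ _ h _ hy => mem_permPrefix.2 ((mem_permPrefix.1 hy).trans_le h)

theorem card_permPrefix_eq {k : ℕ} (τ σ : Equiv.Perm (Fin k)) (i : ℕ) :
    (permPrefix τ i).card = (permPrefix σ i).card := by
  refine Finset.card_equiv (τ.trans σ.symm) fun y => ?_
  simp [mem_permPrefix]

theorem permPrefix_eq_of_subset {k : ℕ} {τ σ : Equiv.Perm (Fin k)} {i : ℕ}
    (h : permPrefix τ i ⊆ permPrefix σ i) : permPrefix τ i = permPrefix σ i :=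
  Finset.eq_of_subset_of_card_le h (card_permPrefix_eq σ τ i).le

theorem permPrefix_nonempty {k : ℕ} (τ : Equiv.Perm (Fin k)) (i : Fin k) :
    (permPrefix τ (i + 1)).Nonempty :=
  ⟨τ.symm i, mem_permPrefix.2 (by simp)⟩

theorem perm_eq_of_permPrefix_eq {k : ℕ} {τ σ : Equiv.Perm (Fin k)}
    (h : ∀ i : Fin k, permPrefix τ (i + 1) = permPrefix σ (i + 1)) : τ = σ := by
  have key : ∀ {τ σ : Equiv.Perm (Fin k)},
      (∀ i : Fin k, permPrefix τ (i + 1) = permPrefix σ (i + 1)) → ∀ y, τ y ≤ σ y := by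
    intro τ σ h y
    have h1 : y ∈ permPrefix σ (σ y + 1) := mem_permPrefix.2 (by omega)
    rw [← h, mem_permPrefix] at h1
    exact Fin.le_def.2 (by omega)
  ext y
  exact congrArg _ (le_antisymm (key h y) (key (fun i => (h i).symm) y))

/-- A family of more than `T ^ k` permutations has at least `r ≤ T` different prefixes
of some common positive length. -/
theorem exists_many_permPrefix {k T r : ℕ} (hr : r ≤ T) (F : Finset (Equiv.Perm (Fin k)))
    (hF : T ^ k < F.card) :
    ∃ i : Fin k, r ≤ (F.image fun τ => permPrefix τ (i + 1)).card := by
  by_contra! hlt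
  have hle : F.card ≤
      (Fintype.piFinset fun i : Fin k => F.image fun τ => permPrefix τ (i + 1)).card := by
    refine Finset.card_le_card_of_injOn (fun τ i => permPrefix τ (i + 1)) ?_ ?_
    · intro τ hτ
      exact Fintype.mem_piFinset.2 fun i => Finset.mem_image_of_mem _ hτ
    · intro τ _ σ _ h
      exact perm_eq_of_permPrefix_eq fun i => congrFun h i
  rw [Fintype.card_piFinset] at hle
  have : ∏ i : Fin k, (F.image fun τ => permPrefix τ (i + 1)).card ≤ T ^ k := by
    refine (Finset.prod_le_pow_card _ _ T fun i _ => ((hlt i).le.trans hr)).trans_eq ?_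
    simp
  omega

/-- The subset of `Fin ℓ × Fin k` made of all blocks before the `j`-th one and the part `B` of
the `j`-th block. -/
def blockPrefix (ℓ : ℕ) {k : ℕ} (j : ℕ) (B : Finset (Fin k)) : Finset (Fin ℓ × Fin k) :=
  univ.filter fun y => y.1.val < j ∨ (y.1.val = j ∧ y.2 ∈ B)

theorem mem_blockPrefix {ℓ k j : ℕ} {B : Finset (Fin k)} {y : Fin ℓ × Fin k} :
    y ∈ blockPrefix ℓ j B ↔ y.1.val < j ∨ (y.1.val = j ∧ y.2 ∈ B) := by
  simp [blockPrefix]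

theorem blockPrefix_subset {ℓ k j : ℕ} {B B' : Finset (Fin k)} (h : B ⊆ B') :
    blockPrefix ℓ j B ⊆ blockPrefix ℓ j B' := by
  intro y hy
  rw [mem_blockPrefix] at hy ⊢
  exact hy.imp_right fun h1 => ⟨h1.1, h h1.2⟩

theorem blockPrefix_subset_of_lt {ℓ k j j' : ℕ} (hj : j < j') (B B' : Finset (Fin k)) :
    blockPrefix ℓ j B ⊆ blockPrefix ℓ j' B' := by
  intro y hy
  rw [mem_blockPrefix] at hy ⊢
  omega

theorem subset_of_blockPrefix_subset {ℓ k j : ℕ} (hj : j < ℓ) {B B' : Finset (Fin k)}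
    (h : blockPrefix ℓ j B ⊆ blockPrefix ℓ j B') : B ⊆ B' := by
  intro y hy
  have := h (mem_blockPrefix.2 (Or.inr ⟨rfl, hy⟩) : ((⟨j, hj⟩ : Fin ℓ), y) ∈ _)
  simpa [mem_blockPrefix] using this

/-- There is a blue copy below `M` of the first `j` layers of the complete multipartite poset. -/
def HasLayers {P : Type*} [Preorder P] {ℓ : ℕ} (t : Fin ℓ → ℕ) (blue : P → Prop) (j : ℕ)
    (M : P) : Prop :=
  ∃ f : Multipartite ℓ t → P, (∀ x, x.1.val < j → blue (f x) ∧ f x ≤ M) ∧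
    ∀ x y, x.1.val < j → y.1.val < j → (f x ≤ f y ↔ x ≤ y)

theorem HasLayers.mono {P : Type*} [Preorder P] {ℓ : ℕ} {t : Fin ℓ → ℕ} {blue : P → Prop}
    {j : ℕ} {M M' : P} (h : HasLayers t blue j M) (hM : M ≤ M') : HasLayers t blue j M' := by
  obtain ⟨f, h1, h2⟩ := h
  exact ⟨f, fun x hx => ⟨(h1 x hx).1, (h1 x hx).2.trans hM⟩, h2⟩

/-- A blue antichain above `M` may be added as the next layer. -/
theorem HasLayers.succ {P : Type*} [Preorder P] {ℓ : ℕ} {t : Fin ℓ → ℕ} {blue : P → Prop}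
    {j : Fin ℓ} {M M' : P} (h : HasLayers t blue j M) (g : Fin (t j) → P)
    (hblue : ∀ a, blue (g a)) (hM' : ∀ a, g a ≤ M') (hM : ∀ a, M < g a) (hMM' : M ≤ M')
    (hanti : ∀ a b, g a ≤ g b → a = b) : HasLayers t blue (j + 1) M' := by
  obtain ⟨f, h1, h2⟩ := h
  have hcase : ∀ x : Multipartite ℓ t, x.1.val < j + 1 → x.1.val < j ∨ ∃ a, x = ⟨j, a⟩ := by
    rintro ⟨i, a⟩ hx
    rcases Nat.lt_succ_iff_lt_or_eq.1 hx with h | h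
    · exact Or.inl h
    · obtain rfl : i = j := Fin.ext h
      exact Or.inr ⟨a, rfl⟩
  let F : Multipartite ℓ t → P := fun x => if h : x.1 = j then g (h ▸ x.2) else f x
  have hFj : ∀ a, F ⟨j, a⟩ = g a := fun a => by simp [F]
  have hFlt : ∀ x : Multipartite ℓ t, x.1.val < j → F x = f x := fun x hx => by
    have : x.1 ≠ j := fun h => by rw [h] at hx; exact lt_irrefl _ hx
    simp [F, this]
  refine ⟨F, fun x hx => ?_, fun x y hx hy => ?_⟩
  · rcases hcase x hx with h | ⟨a, rfl⟩
    · rw [hFlt x h]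
      exact ⟨(h1 x h).1, (h1 x h).2.trans hMM'⟩
    · rw [hFj]
      exact ⟨hblue a, hM' a⟩
  · rcases hcase x hx with hxj | ⟨a, rfl⟩ <;> rcases hcase y hy with hyj | ⟨b, rfl⟩
    · rw [hFlt x hxj, hFlt y hyj]
      exact h2 x y hxj hyj
    · rw [hFlt x hxj, hFj]
      exact iff_of_true ((h1 x hxj).2.trans (hM b).le) (Or.inl hxj)
    · rw [hFlt y hyj, hFj]
      refine iff_of_false (fun h => (hM a).not_ge (h.trans (h1 y hyj).2)) ?_
      rintro (h | rfl)
      · exact lt_asymm h hyj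
      · exact lt_irrefl _ hyj
    · rw [hFj, hFj]
      constructor
      · intro h
        obtain rfl := hanti a b h
        exact le_rfl
      · rintro (h | h)
        · exact absurd h (lt_irrefl _)
        · obtain rfl : a = b := by cases h; rfl
          exact le_rfl

/-- If more than `4 ^ n * T ^ k` permutations `τ` of a block each come with a blue chain
`(s τ i, permPrefix τ i)`, then two common bounds enclose a blue antichain of size `r ≤ T`. -/
theorem exists_antichain_of_chains {n k T r : ℕ} (hr : r ≤ T) (hk : 4 ^ n * T ^ k < k.factorial)
    (s : Equiv.Perm (Fin k) → ℕ → Finset (Fin n)) :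
    ∃ (τ₀ : Equiv.Perm (Fin k)) (i : Fin k) (u : Fin r → Equiv.Perm (Fin k)),
      (∀ a, s (u a) 0 = s τ₀ 0 ∧ s (u a) k = s τ₀ k) ∧
      ∀ a b, permPrefix (u a) (i + 1) ⊆ permPrefix (u b) (i + 1) → a = b := by
  classical
  obtain ⟨⟨A, B⟩, -, hF⟩ := Finset.exists_lt_card_fiber_of_mul_lt_card_of_maps_to
    (s := (univ : Finset (Equiv.Perm (Fin k))))
    (t := (univ : Finset (Finset (Fin n) × Finset (Fin n))))
    (f := fun τ => (s τ 0, s τ k)) (n := T ^ k) (fun _ _ => mem_univ _) (by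
      have : (2 ^ n * 2 ^ n : ℕ) = 4 ^ n := by rw [← mul_pow]; norm_num
      simpa [Fintype.card_perm, this] using hk)
  obtain ⟨i, hi⟩ := exists_many_permPrefix hr _ hF
  set F : Finset (Equiv.Perm (Fin k)) := univ.filter fun τ => (s τ 0, s τ k) = (A, B) with hFdef
  obtain ⟨τ₀, hτ₀⟩ : F.Nonempty := Finset.card_pos.1 (by omega)
  obtain ⟨v⟩ := Function.Embedding.nonempty_of_card_le (α := Fin r)
    (β := F.image fun τ => permPrefix τ (i + 1)) (by
      rwa [Fintype.card_fin, Fintype.card_coe])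
  have hv : ∀ a, ∃ τ ∈ F, permPrefix τ (i + 1) = v a := fun a => Finset.mem_image.1 (v a).2
  choose u huF hu using hv
  have hmem : ∀ τ ∈ F, s τ 0 = A ∧ s τ k = B := fun τ h => by simpa [hFdef] using h
  refine ⟨τ₀, i, u, fun a => ?_, fun a b hab => ?_⟩
  · rw [(hmem _ (huF a)).1, (hmem _ (huF a)).2, (hmem _ hτ₀).1, (hmem _ hτ₀).2]
    exact ⟨rfl, rfl⟩
  · have h := permPrefix_eq_of_subset hab
    rw [hu, hu] at h
    exact v.injective (Subtype.ext h)

/-- The Ramsey property for the lattice of subsets of the disjoint union of `Fin n` and `ℓ`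
blocks of size `k`. -/
theorem blue_multipartite_or_red_boolean {n k ℓ T : ℕ} (t : Fin ℓ → ℕ) (hT : ∀ i, t i ≤ T)
    (hk : 4 ^ n * T ^ k < k.factorial)
    (blue : Finset (Fin n) × Finset (Fin ℓ × Fin k) → Prop) :
    (∃ e : Multipartite ℓ t ↪o Finset (Fin n) × Finset (Fin ℓ × Fin k), ∀ x, blue (e x)) ∨
    (∃ e : Finset (Fin n) ↪o Finset (Fin n) × Finset (Fin ℓ × Fin k), ∀ S, ¬ blue (e S)) := by
  classical
  by_cases hfull : ∃ M, HasLayers t blue ℓ M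
  · obtain ⟨M, f, h1, h2⟩ := hfull
    exact Or.inl ⟨OrderEmbedding.ofMapLEIff f fun x y => h2 x y x.1.2 y.1.2,
      fun x => (h1 x x.1.2).1⟩
  right
  push Not at hfull
  let Q : Finset (Fin n) → ℕ → Prop := fun S j => HasLayers t blue j (S, blockPrefix ℓ j ∅)
  let L : Finset (Fin n) → ℕ := fun S => Nat.findGreatest (Q S) ℓ
  have hQL : ∀ S, Q S (L S) := fun S => Nat.findGreatest_spec (Nat.zero_le ℓ)
    ⟨fun _ => (S, ∅), fun x hx => absurd hx (Nat.not_lt_zero _),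
      fun x _ hx => absurd hx (Nat.not_lt_zero _)⟩
  have hLlt : ∀ S, L S < ℓ := fun S => lt_of_le_of_ne (Nat.findGreatest_le ℓ) fun h => by
    have := hQL S
    rw [h] at this
    exact hfull _ this
  have hLmono : Monotone L := fun S S' h =>
    Nat.findGreatest_mono_left (fun j hj => hj.mono (Prod.mk_le_mk.2 ⟨h, le_rfl⟩)) ℓ
  have hsel : ∀ j : Fin ℓ, ∃ (τ : Equiv.Perm (Fin k)) (i : Finset (Fin n) → ℕ), Monotone i ∧
      ∀ S, L S = j → ¬ blue (S, blockPrefix ℓ j (permPrefix τ (i S))) := by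
    intro j
    by_contra! hno
    have hchain : ∀ τ : Equiv.Perm (Fin k), ∃ s : ℕ → Finset (Fin n), Monotone s ∧
        ∀ m ≤ k, L (s m) = j ∧ blue (s m, blockPrefix ℓ j (permPrefix τ m)) := by
      intro τ
      rcases exists_monotone_selector_or_chain (fun S => L S = j)
        (fun S m => ¬ blue (S, blockPrefix ℓ j (permPrefix τ m))) k with ⟨i, hi, -, h⟩ | ⟨s, hs, h⟩
      · obtain ⟨S, hS, hb⟩ := hno τ i hi
        exact absurd hb (h S hS)
      · exact ⟨s, hs, fun m hm => ⟨(h m hm).1, not_not.1 (h m hm).2⟩⟩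
    choose s hs hsb using hchain
    obtain ⟨τ₀, i, u, hu, hanti⟩ := exists_antichain_of_chains (hT j) hk s
    have hbase : HasLayers t blue j (s τ₀ 0, blockPrefix ℓ j ∅) := by
      have := hQL (s τ₀ 0)
      rwa [(hsb τ₀ 0 (Nat.zero_le k)).1] at this
    have hnext : Q (s τ₀ k) (j + 1) := by
      refine hbase.succ
        (fun a => (s (u a) (i + 1), blockPrefix ℓ j (permPrefix (u a) (i + 1)))) ?_ ?_ ?_ ?_ ?_
      · exact fun a => (hsb (u a) (i + 1) i.2).2
      · refine fun a => Prod.mk_le_mk.2 ⟨?_, blockPrefix_subset_of_lt (Nat.lt_succ_self _) _ _⟩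
        rw [← (hu a).2]
        exact hs (u a) i.2
      · refine fun a => lt_of_le_not_ge (Prod.mk_le_mk.2 ⟨?_, blockPrefix_subset (by simp)⟩) ?_
        · rw [← (hu a).1]
          exact hs (u a) (Nat.zero_le _)
        · intro h
          obtain ⟨y, hy⟩ := permPrefix_nonempty (u a) i
          exact absurd (subset_of_blockPrefix_subset j.2 (Prod.mk_le_mk.1 h).2 hy) (by simp)
      · exact Prod.mk_le_mk.2
          ⟨hs τ₀ (Nat.zero_le k), blockPrefix_subset_of_lt (Nat.lt_succ_self _) _ _⟩
      · exact fun a b h => hanti a b (subset_of_blockPrefix_subset j.2 (Prod.mk_le_mk.1 h).2)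
    have : j + 1 ≤ L (s τ₀ k) := Nat.le_findGreatest j.2 hnext
    rw [(hsb τ₀ k le_rfl).1] at this
    omega
  choose τ i hi hred using hsel
  let J : Finset (Fin n) → Fin ℓ := fun S => ⟨L S, hLlt S⟩
  refine ⟨OrderEmbedding.ofMapLEIff
    (fun S => (S, blockPrefix ℓ (J S) (permPrefix (τ (J S)) (i (J S) S)))) fun S S' => ?_,
    fun S => hred (J S) S rfl⟩
  refine ⟨fun h => (Prod.mk_le_mk.1 h).1, fun h => Prod.mk_le_mk.2 ⟨h, ?_⟩⟩
  rcases (hLmono h).lt_or_eq with hlt | heq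
  · exact blockPrefix_subset_of_lt hlt _ _
  · have hJ : J S = J S' := Fin.ext heq
    rw [hJ]
    exact blockPrefix_subset (permPrefix_mono _ (hi _ h))

theorem posetRamsey_le {n k ℓ T : ℕ} (t : Fin ℓ → ℕ) (hT : ∀ i, t i ≤ T)
    (hk : 4 ^ n * T ^ k < k.factorial) :
    posetRamsey (Multipartite ℓ t) (Finset (Fin n)) ≤ n + ℓ * k := by
  refine Nat.sInf_le fun c => ?_
  let E : Fin n ⊕ Fin ℓ × Fin k ≃ Fin (n + ℓ * k) :=
    (Equiv.sumCongr (Equiv.refl _) finProdFinEquiv).trans finSumFinEquiv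
  let Φ : Finset (Fin n) × Finset (Fin ℓ × Fin k) ↪o Finset (Fin (n + ℓ * k)) :=
    (Finset.sumEquiv.symm.toOrderEmbedding).trans (Finset.mapEmbedding E.toEmbedding)
  rcases blue_multipartite_or_red_boolean t hT hk (fun M => c (Φ M) = true) with
    ⟨e, he⟩ | ⟨e, he⟩
  · exact Or.inl ⟨e.trans Φ, he⟩
  · exact Or.inr ⟨e.trans Φ, fun S => Bool.eq_false_iff.2 (he S)⟩

/-- Slightly more than `2 n / log n` elements have more than `4 ^ n * T ^ k` permutations. -/
theorem exists_factorial_gt (T : ℕ) (hT : 1 ≤ T) {δ : ℝ} (hδ : 0 < δ) :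
    ∃ n₀ : ℕ, ∀ n : ℕ, n₀ ≤ n → ∃ k : ℕ, 4 ^ n * T ^ k < k.factorial ∧
      (k : ℝ) ≤ (2 + δ) * ((n : ℝ) / Real.logb 2 n) := by
  set η : ℝ := δ / (8 + 2 * δ) with hη
  have hη0 : 0 < η := by positivity
  have hη1 : (2 + δ / 2) * (1 - η) = 2 + δ / 4 := by rw [hη]; field_simp; ring
  have hη2 : 0 < 1 - η := by
    by_contra! h
    nlinarith
  have hlog2 : 0 < Real.log 2 := Real.log_pos one_lt_two
  have small : ∀ r > (0 : ℝ), ∀ C > (0 : ℝ), ∀ᶠ n : ℕ in Filter.atTop,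
      C * Real.logb 2 n ≤ (n : ℝ) ^ r := by
    intro r hr C hC
    have h := ((isLittleO_log_rpow_atTop hr).comp_tendsto tendsto_natCast_atTop_atTop).bound
      (c := Real.log 2 / C) (by positivity)
    filter_upwards [h, Filter.eventually_ge_atTop 1] with n hn h1
    have h1' : (1 : ℝ) ≤ n := by exact_mod_cast h1
    simp only [Function.comp, Real.norm_eq_abs] at hn
    rw [abs_of_nonneg (Real.log_nonneg h1'), abs_of_nonneg (by positivity)] at hn
    rw [Real.logb]
    calc C * (Real.log n / Real.log 2) ≤ C * ((Real.log 2 / C * (n : ℝ) ^ r) / Real.log 2) := by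
          gcongr
      _ = (n : ℝ) ^ r := by field_simp
  have hT0 : (0 : ℝ) < T := by exact_mod_cast hT
  have hev : ∀ᶠ n : ℕ in Filter.atTop, ∃ k : ℕ, 4 ^ n * T ^ k < k.factorial ∧
      (k : ℝ) ≤ (2 + δ) * ((n : ℝ) / Real.logb 2 n) := by
    filter_upwards [small 1 one_pos (2 / δ) (by positivity),
      small η hη0 (T * Real.exp 1) (by positivity), Filter.eventually_ge_atTop 2] with n hn1 hn2 h2
    have hn0 : (0 : ℝ) < n := by positivity
    have hlogn : 0 < Real.logb 2 n := Real.logb_pos one_lt_two (by exact_mod_cast h2)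
    set q : ℝ := (n : ℝ) / Real.logb 2 n with hq
    have hqn : q * Real.logb 2 n = n := by rw [hq]; field_simp
    have hq0 : 0 < q := by positivity
    have hq1 : 1 ≤ δ / 2 * q := by
      rw [Real.rpow_one] at hn1
      rw [hq, ← mul_div_assoc, le_div_iff₀ hlogn]
      calc 1 * Real.logb 2 n = δ / 2 * (2 / δ * Real.logb 2 n) := by field_simp
        _ ≤ δ / 2 * n := by gcongr
    refine ⟨⌊(2 + δ) * q⌋₊, ?_, Nat.floor_le (by positivity)⟩
    have hfloor := Nat.lt_floor_add_one ((2 + δ) * q)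
    generalize ⌊(2 + δ) * q⌋₊ = k at hfloor
    have hkq : (2 + δ / 2) * q ≤ k := by linarith
    have hk_pow : T * (n : ℝ) ^ (1 - η) * Real.exp 1 ≤ k := by
      have : T * (n : ℝ) ^ (1 - η) * Real.exp 1 ≤ q := by
        rw [hq, le_div_iff₀ hlogn]
        calc T * (n : ℝ) ^ (1 - η) * Real.exp 1 * Real.logb 2 n
            = (n : ℝ) ^ (1 - η) * (T * Real.exp 1 * Real.logb 2 n) := by ring
          _ ≤ (n : ℝ) ^ (1 - η) * (n : ℝ) ^ η := by gcongr
          _ = n := by rw [← Real.rpow_add hn0]; simp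
      nlinarith
    have hfact : (T * (n : ℝ) ^ (1 - η)) ^ k ≤ k.factorial := by
      have h := Real.pow_div_factorial_le_exp (k : ℝ) (Nat.cast_nonneg k) k
      rw [div_le_iff₀ (by positivity), ← Real.exp_one_pow] at h
      have h3 : (T * (n : ℝ) ^ (1 - η) * Real.exp 1) ^ k ≤ Real.exp 1 ^ k * k.factorial :=
        (pow_le_pow_left₀ (by positivity) hk_pow k).trans h
      rw [mul_pow, mul_comm] at h3
      exact le_of_mul_le_mul_left h3 (by positivity)
    have hpow : (4 : ℝ) ^ n < ((n : ℝ) ^ (1 - η)) ^ k := by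
      have h4 : (4 : ℝ) ^ n = (2 : ℝ) ^ (2 * (n : ℝ)) := by
        rw [Real.rpow_mul two_pos.le, Real.rpow_natCast]
        norm_num
      have hnk : ((n : ℝ) ^ (1 - η)) ^ k = (2 : ℝ) ^ (Real.logb 2 n * ((1 - η) * k)) := by
        rw [Real.rpow_mul two_pos.le, Real.rpow_logb two_pos (by norm_num) hn0,
          Real.rpow_mul hn0.le, Real.rpow_natCast]
      rw [h4, hnk]
      refine Real.rpow_lt_rpow_of_exponent_lt one_lt_two ?_
      calc 2 * (n : ℝ) < (2 + δ / 4) * n := by nlinarith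
        _ = Real.logb 2 n * ((1 - η) * ((2 + δ / 2) * q)) := by
          rw [← hη1]; linear_combination (-(2 + δ / 2) * (1 - η)) * hqn
        _ ≤ Real.logb 2 n * ((1 - η) * k) := by gcongr
    have : (4 : ℝ) ^ n * T ^ k < k.factorial := by
      refine lt_of_lt_of_le ?_ hfact
      rw [mul_pow, mul_comm]
      gcongr
    exact_mod_cast this
  exact Filter.eventually_atTop.1 hev

/-- For fixed `ℓ ≥ 2` and positive integers `t_1, …, t_ℓ`: for every `ε > 0`
there is `n₀` such that for all `n ≥ n₀`,
`R(K_{t_1,…,t_ℓ}, Q_n) ≤ n + (2ℓ + ε)·(n / log n)`. -/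
theorem multipartite_ramsey_upper (ℓ : ℕ) (hℓ : 2 ≤ ℓ) (t : Fin ℓ → ℕ)
    (ht : ∀ i, 1 ≤ t i) (ε : ℝ) (hε : 0 < ε) :
    ∃ n₀ : ℕ, ∀ n : ℕ, n₀ ≤ n →
      (posetRamsey (Multipartite ℓ t) (Finset (Fin n)) : ℝ) ≤
        (n : ℝ) + (2 * (ℓ : ℝ) + ε) * ((n : ℝ) / Real.logb 2 (n : ℝ)) := by
  have hℓ0 : (0 : ℝ) < ℓ := by positivity
  have hT : ∀ i, t i ≤ 1 + ∑ i, t i := fun i =>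
    (Finset.single_le_sum (fun _ _ => Nat.zero_le _) (mem_univ i)).trans (Nat.le_add_left _ _)
  obtain ⟨n₀, h⟩ := exists_factorial_gt (1 + ∑ i, t i) (Nat.le_add_right _ _) (div_pos hε hℓ0)
  refine ⟨n₀, fun n hn => ?_⟩
  obtain ⟨k, hk, hkle⟩ := h n hn
  calc (posetRamsey (Multipartite ℓ t) (Finset (Fin n)) : ℝ) ≤ ((n + ℓ * k : ℕ) : ℝ) := by
        exact_mod_cast posetRamsey_le t hT hk
    _ = n + ℓ * (k : ℝ) := by push_cast; ring
    _ ≤ n + ℓ * ((2 + ε / ℓ) * ((n : ℝ) / Real.logb 2 n)) := by gcongr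
    _ = n + (2 * (ℓ : ℝ) + ε) * ((n : ℝ) / Real.logb 2 n) := by field_simp
end

section
/- Let s : ℕ → ℕ be a function with s(n) ≥ 1 for all n and s(n) = n^{o(1)}, i.e. for every δ > 0 one has s(n) ≤ n^δ for all sufficiently large n. Then for every ε > 0 there exists n_0 such that for all integers n ≥ n_0, R(D_{s(n)}, Q_n) ≤ n + (2 + ε)·(n / log n) and R(V_{s(n)}, Q_n) ≤ n + (1 + ε)·(n / log n). -/
open Finset

section MultipartiteEmbeddings

variable {α : Type*} [PartialOrder α] {s : ℕ}

/-- An element below an antichain of size `s` spans an `s`-fork. -/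
lemma exists_fork_embedding (b : α) (p : Fin s → α) (hb : ∀ j, b < p j)
    (hp : ∀ j j', p j ≤ p j' → j = j') :
    ∃ e : Multipartite 2 ![1, s] ↪o α, ∀ z, e z = b ∨ ∃ j, e z = p j := by
  let f : Multipartite 2 ![1, s] → α := fun z => match z with
    | ⟨0, _⟩ => b
    | ⟨1, j⟩ => p j
  have hf : ∀ x y, f x ≤ f y ↔ x ≤ y := by
    rintro ⟨i, x⟩ ⟨j, y⟩
    have hfst : (⟨i, x⟩ : Multipartite 2 ![1, s]) = ⟨j, y⟩ → i ≠ j → False :=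
      fun h hij => hij (congrArg Sigma.fst h)
    change _ ↔ (i < j ∨ _)
    fin_cases i <;> fin_cases j
    · have : x = y := Subsingleton.elim (α := Fin 1) x y
      subst this
      exact iff_of_true le_rfl (Or.inr rfl)
    · exact iff_of_true (hb y).le (Or.inl (by decide))
    · exact iff_of_false (hb x).not_ge fun h => h.elim (by decide) fun h => hfst h (by decide)
    · simp only [f, Fin.mk_one, lt_self_iff_false, false_or]
      constructor
      · intro h
        rw [hp _ _ h]
      · intro h
        cases h
        exact le_rfl
  refine ⟨OrderEmbedding.ofMapLEIff f hf, ?_⟩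
  rintro ⟨i, x⟩
  fin_cases i
  · exact Or.inl rfl
  · exact Or.inr ⟨x, rfl⟩

/-- An antichain of size `s` strictly between two elements spans an `s`-diamond. -/
lemma exists_diamond_embedding (b t : α) (hbt : b < t) (p : Fin s → α) (hb : ∀ j, b < p j)
    (ht : ∀ j, p j < t) (hp : ∀ j j', p j ≤ p j' → j = j') :
    ∃ e : Multipartite 3 ![1, s, 1] ↪o α, ∀ z, e z = b ∨ e z = t ∨ ∃ j, e z = p j := by
  let f : Multipartite 3 ![1, s, 1] → α := fun z => match z with
    | ⟨0, _⟩ => b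
    | ⟨1, j⟩ => p j
    | ⟨2, _⟩ => t
  have hf : ∀ x y, f x ≤ f y ↔ x ≤ y := by
    rintro ⟨i, x⟩ ⟨j, y⟩
    have hfst : (⟨i, x⟩ : Multipartite 3 ![1, s, 1]) = ⟨j, y⟩ → i ≠ j → False :=
      fun h hij => hij (congrArg Sigma.fst h)
    change _ ↔ (i < j ∨ _)
    fin_cases i <;> fin_cases j
    · have : x = y := Subsingleton.elim (α := Fin 1) x y
      subst this
      exact iff_of_true le_rfl (Or.inr rfl)
    · exact iff_of_true (hb y).le (Or.inl (by decide))
    · exact iff_of_true hbt.le (Or.inl (by decide))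
    · exact iff_of_false (hb x).not_ge fun h => h.elim (by decide) fun h => hfst h (by decide)
    · simp only [f, Fin.mk_one, lt_self_iff_false, false_or]
      constructor
      · intro h
        rw [hp _ _ h]
      · intro h
        cases h
        exact le_rfl
    · exact iff_of_true (ht x).le (Or.inl (by decide))
    · exact iff_of_false hbt.not_ge fun h => h.elim (by decide) fun h => hfst h (by decide)
    · exact iff_of_false (ht y).not_ge fun h => h.elim (by decide) fun h => hfst h (by decide)
    · have : x = y := Subsingleton.elim (α := Fin 1) x y
      subst this
      exact iff_of_true le_rfl (Or.inr rfl)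
  refine ⟨OrderEmbedding.ofMapLEIff f hf, ?_⟩
  rintro ⟨i, x⟩
  fin_cases i
  · exact Or.inl rfl
  · exact Or.inr (Or.inr ⟨x, rfl⟩)
  · exact Or.inr (Or.inl rfl)

end MultipartiteEmbeddings

/-- In a coloring of `α × {0, …, k}` there is either a red section given by a monotone function,
or a blue sequence that is monotone in `α` and visits every level. -/
lemma exists_monotone_section_or_chain {α : Type*} [PartialOrder α] (k : ℕ)
    (red : α → ℕ → Prop) :
    (∃ f : α → ℕ, Monotone f ∧ ∀ a, red a (f a)) ∨
    (∃ x : ℕ → α, Monotone x ∧ ∀ i ≤ k, ¬ red (x i) i) := by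
  classical
  let B : α → ℕ → Prop := fun a j =>
    ∃ x : ℕ → α, Monotone x ∧ (∀ i ≤ j, ¬ red (x i) i) ∧ ∀ i, x i ≤ a
  by_cases h : ∃ a, ∀ j, B a j
  · obtain ⟨a, ha⟩ := h
    obtain ⟨x, hx, hr, -⟩ := ha k
    exact Or.inr ⟨x, hx, hr⟩
  · push Not at h
    refine Or.inl ⟨fun a => Nat.find (h a), fun a b hab => ?_, fun a => ?_⟩
    · refine Nat.find_min' _ fun ⟨x, hx, hr, hxa⟩ => ?_
      exact Nat.find_spec (h b) ⟨x, hx, hr, fun i => (hxa i).trans hab⟩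
    · by_contra hblue
      have hspec := Nat.find_spec (h a)
      set m := Nat.find (h a)
      obtain ⟨x, hx, hr, hxa⟩ : ∃ x : ℕ → α, Monotone x ∧ (∀ i < m, ¬ red (x i) i) ∧
          ∀ i, x i ≤ a := by
        rcases Nat.eq_zero_or_pos m with h0 | h0
        · exact ⟨fun _ => a, monotone_const, by simp [h0], fun _ => le_rfl⟩
        · obtain ⟨x, hx, hr, hxa⟩ := not_not.1 (Nat.find_min (h a) (m := m - 1) (by omega))
          exact ⟨x, hx, fun i hi => hr i (by omega), hxa⟩
      refine hspec ⟨fun i => if i < m then x i else a, fun i j hij => ?_, fun i hi => ?_,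
        fun i => ?_⟩
      · dsimp only
        split_ifs with h1 h2
        · exact hx hij
        · exact hxa i
        · omega
        · exact le_rfl
      · dsimp only
        split_ifs with h1
        · exact hr i h1
        · obtain rfl : i = m := by omega
          exact hblue
      · dsimp only
        split_ifs
        · exact hxa i
        · exact le_rfl

section Prefixes

variable {k : ℕ}

/-- The elements of rank less than `i` in the linear order on `Fin k` with rank function `τ`. -/
def rankPrefix (τ : Equiv.Perm (Fin k)) (i : ℕ) : Finset (Fin k) :=
  univ.filter fun y => (τ y : ℕ) < i

lemma mem_rankPrefix {τ : Equiv.Perm (Fin k)} {i : ℕ} {y : Fin k} :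
    y ∈ rankPrefix τ i ↔ (τ y : ℕ) < i := by
  simp [rankPrefix]

lemma rankPrefix_mono (τ : Equiv.Perm (Fin k)) : Monotone (rankPrefix τ) :=
  fun _ _ hij _ hy => mem_rankPrefix.2 ((mem_rankPrefix.1 hy).trans_le hij)

lemma card_rankPrefix (τ : Equiv.Perm (Fin k)) {i : ℕ} (hi : i ≤ k) :
    (rankPrefix τ i).card = i := by
  have h : (rankPrefix τ i).map τ.toEmbedding = univ.filter fun y : Fin k => (y : ℕ) < i := by
    ext y
    simp [mem_rankPrefix]
  rw [← card_map τ.toEmbedding, h, Fin.card_filter_val_lt]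
  omega

lemma rankPrefix_ext {τ σ : Equiv.Perm (Fin k)}
    (h : ∀ i : Fin k, rankPrefix τ i = rankPrefix σ i) : τ = σ := by
  ext y
  have h1 := h (τ y)
  have h2 := h (σ y)
  have h3 := mem_rankPrefix (τ := σ) (i := τ y) (y := y)
  have h4 := mem_rankPrefix (τ := τ) (i := σ y) (y := y)
  rw [← h1, mem_rankPrefix] at h3
  rw [h2, mem_rankPrefix] at h4
  omega

/-- If the permutations of `Fin k` are split into few classes, then some class has more than `s`
different prefixes of a common length. -/
lemma exists_lt_card_image_rankPrefix {β : Type*} [Fintype β] [DecidableEq β] {s : ℕ}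
    (g : Equiv.Perm (Fin k) → β) (h : Fintype.card β * s ^ k < k.factorial) :
    ∃ b, ∃ i : Fin k, s < ((univ.filter fun τ => g τ = b).image (rankPrefix · i)).card := by
  by_contra! hle
  refine h.not_ge ?_
  have hfiber : ∀ b ∈ (univ : Finset β), (univ.filter fun τ => g τ = b).card ≤ s ^ k := by
    intro b _
    calc (univ.filter fun τ => g τ = b).card
        ≤ (Fintype.piFinset fun i : Fin k =>
            (univ.filter fun τ => g τ = b).image (rankPrefix · i)).card := by
          refine card_le_card_of_injOn (fun τ i => rankPrefix τ i) (fun τ hτ => ?_)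
            fun τ _ σ _ hτσ => rankPrefix_ext (congrFun hτσ)
          exact mem_coe.2 (Fintype.mem_piFinset.2 fun i => mem_image_of_mem _ hτ)
      _ ≤ ∏ _i : Fin k, s := by
          rw [Fintype.card_piFinset]
          exact prod_le_prod' fun i _ => hle b i
      _ = s ^ k := by simp
  calc k.factorial = (univ : Finset (Equiv.Perm (Fin k))).card := by
        rw [card_univ, Fintype.card_perm, Fintype.card_fin]
    _ = ∑ b : β, (univ.filter fun τ => g τ = b).card :=
        card_eq_sum_card_fiberwise fun _ _ => mem_coe.2 (mem_univ _)
    _ ≤ ∑ _b : β, s ^ k := sum_le_sum hfiber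
    _ = Fintype.card β * s ^ k := by simp

/-- If the permutations of `Fin k` are split into few classes, then some class contains `s`
permutations with pairwise
incomparable prefixes of a common length. -/
lemma exists_incomparable_rankPrefix {β : Type*} [Fintype β] [DecidableEq β] {s : ℕ} (hs : 1 ≤ s)
    (g : Equiv.Perm (Fin k) → β) (h : Fintype.card β * s ^ k < k.factorial) :
    ∃ b, ∃ i, 0 < i ∧ i < k ∧ ∃ σ : Fin s → Equiv.Perm (Fin k), (∀ j, g (σ j) = b) ∧
      ∀ j j', rankPrefix (σ j) i ⊆ rankPrefix (σ j') i → j = j' := by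
  obtain ⟨b, i, hi⟩ := exists_lt_card_image_rankPrefix g h
  set S := (univ.filter fun τ => g τ = b).image (rankPrefix · i) with hS
  have hpos : 0 < (i : ℕ) := by
    by_contra! h0
    have : S ⊆ {∅} := by
      intro T hT
      obtain ⟨τ, -, rfl⟩ := mem_image.1 hT
      rw [mem_singleton, ← card_eq_zero, card_rankPrefix τ i.2.le]
      omega
    have := card_le_card this
    simp only [card_singleton] at this
    omega
  obtain ⟨e⟩ : Nonempty (Fin s ↪ S) := by
    rw [Function.Embedding.nonempty_iff_card_le]
    simpa using hi.le
  have hrep : ∀ j, ∃ τ, g τ = b ∧ rankPrefix τ i = (e j : Finset (Fin k)) := by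
    intro j
    obtain ⟨τ, hτ, h⟩ := mem_image.1 (e j).2
    exact ⟨τ, (mem_filter.1 hτ).2, h⟩
  choose σ hσ hσe using hrep
  refine ⟨b, i, hpos, i.2, σ, hσ, fun j j' hjj => e.injective (Subtype.ext ?_)⟩
  rw [← hσe, ← hσe]
  refine eq_of_subset_of_card_le hjj ?_
  rw [card_rankPrefix _ i.2.le, card_rankPrefix _ i.2.le]

end Prefixes

section Colorings

variable {n k s : ℕ}

/-- The Boolean lattice of dimension `n + k` as a product of Boolean lattices. -/
def finsetFinAddOrderIso (n k : ℕ) :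
    Finset (Fin n) × Finset (Fin k) ≃o Finset (Fin (n + k)) :=
  Finset.sumEquiv.symm.trans
    { finSumFinEquiv.finsetCongr with
      map_rel_iff' := by
        intro a b
        exact map_subset_map }

/-- If there is no red copy of `Q_n`, then for every linear order of `Fin k` there is a blue chain
whose trace on `Fin k` runs through all initial segments. -/
lemma exists_blue_chains (c : Finset (Fin n) × Finset (Fin k) → Bool)
    (hc : ¬ ∃ e : Finset (Fin n) ↪o Finset (Fin n) × Finset (Fin k), ∀ q, c (e q) = false)
    (τ : Equiv.Perm (Fin k)) :
    ∃ x : ℕ → Finset (Fin n), Monotone x ∧ ∀ i ≤ k, c (x i, rankPrefix τ i) = true := by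
  rcases exists_monotone_section_or_chain k
    (fun (Z : Finset (Fin n)) i => c (Z, rankPrefix τ i) = false) with ⟨f, hf, hr⟩ | ⟨x, hx, hb⟩
  · refine absurd ⟨OrderEmbedding.ofMapLEIff (fun Z => (Z, rankPrefix τ (f Z))) ?_, hr⟩ hc
    exact fun a b => ⟨fun h => h.1, fun h => ⟨h, rankPrefix_mono τ (hf h)⟩⟩
  · exact ⟨x, hx, fun i hi => by simpa using hb i hi⟩

lemma rankPrefix_chain_lt {x : ℕ → Finset (Fin n)} (hx : Monotone x) (τ : Equiv.Perm (Fin k))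
    {i j : ℕ} (hij : i < j) (hj : j ≤ k) : (x i, rankPrefix τ i) < (x j, rankPrefix τ j) := by
  refine lt_of_le_of_ne ⟨hx hij.le, rankPrefix_mono τ hij.le⟩ fun h => ?_
  have h' := congrArg (fun z => z.2.card) h
  simp only [card_rankPrefix τ hj, card_rankPrefix τ (hij.le.trans hj)] at h'
  omega

lemma rankPrefix_zero (τ : Equiv.Perm (Fin k)) : rankPrefix τ 0 = ∅ := by
  simp [rankPrefix]

lemma rankPrefix_self (τ : Equiv.Perm (Fin k)) : rankPrefix τ k = univ := by
  simp [rankPrefix]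

/-- It suffices to consider colorings of the product of two Boolean lattices. -/
lemma posetRamsey_le_of_prod {P : Type*} [PartialOrder P]
    (h : ∀ c : Finset (Fin n) × Finset (Fin k) → Bool,
      (¬ ∃ e : Finset (Fin n) ↪o Finset (Fin n) × Finset (Fin k), ∀ q, c (e q) = false) →
      ∃ e : P ↪o Finset (Fin n) × Finset (Fin k), ∀ p, c (e p) = true) :
    posetRamsey P (Finset (Fin n)) ≤ n + k := by
  refine Nat.sInf_le fun c => ?_
  let φ := finsetFinAddOrderIso n k
  by_cases hr : ∃ e : Finset (Fin n) ↪o Finset (Fin n) × Finset (Fin k), ∀ q, c (φ (e q)) = false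
  · obtain ⟨e, he⟩ := hr
    exact Or.inr ⟨e.trans φ.toOrderEmbedding, he⟩
  · obtain ⟨e, he⟩ := h (fun z => c (φ z)) hr
    exact Or.inl ⟨e.trans φ.toOrderEmbedding, he⟩

lemma posetRamsey_fork_le (hs : 1 ≤ s) (h : 2 ^ n * s ^ k < k.factorial) :
    posetRamsey (Multipartite 2 ![1, s]) (Finset (Fin n)) ≤ n + k := by
  refine posetRamsey_le_of_prod fun c hc => ?_
  choose x hx hblue using exists_blue_chains c hc
  obtain ⟨b, i, hi, hik, σ, hσ, hanti⟩ :=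
    exists_incomparable_rankPrefix hs (fun τ => x τ 0) (by simpa using h)
  have hbot : ∀ j, (x (σ j) 0, rankPrefix (σ j) 0) = (b, ∅) := fun j => by
    rw [hσ j, rankPrefix_zero]
  obtain ⟨e, he⟩ := exists_fork_embedding (b, (∅ : Finset (Fin k)))
    (fun j => (x (σ j) i, rankPrefix (σ j) i))
    (fun j => hbot j ▸ rankPrefix_chain_lt (hx (σ j)) (σ j) hi hik.le)
    (fun j j' hjj => hanti j j' hjj.2)
  refine ⟨e, fun z => ?_⟩
  rcases he z with h | ⟨j, h⟩
  · rw [h, ← hbot ⟨0, hs⟩]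
    exact hblue _ 0 k.zero_le
  · rw [h]
    exact hblue _ i hik.le

lemma posetRamsey_diamond_le (hs : 1 ≤ s) (h : 2 ^ (2 * n) * s ^ k < k.factorial) :
    posetRamsey (Multipartite 3 ![1, s, 1]) (Finset (Fin n)) ≤ n + k := by
  refine posetRamsey_le_of_prod fun c hc => ?_
  choose x hx hblue using exists_blue_chains c hc
  obtain ⟨⟨b, t⟩, i, hi, hik, σ, hσ, hanti⟩ :=
    exists_incomparable_rankPrefix hs (fun τ => (x τ 0, x τ k))
      (by simpa [two_mul, pow_add] using h)
  simp only [Prod.mk.injEq] at hσ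
  have hbot : ∀ j, (x (σ j) 0, rankPrefix (σ j) 0) = (b, ∅) := fun j => by
    rw [(hσ j).1, rankPrefix_zero]
  have htop : ∀ j, (x (σ j) k, rankPrefix (σ j) k) = (t, univ) := fun j => by
    rw [(hσ j).2, rankPrefix_self]
  have hb : ∀ j, (b, ∅) < (x (σ j) i, rankPrefix (σ j) i) :=
    fun j => hbot j ▸ rankPrefix_chain_lt (hx (σ j)) (σ j) hi hik.le
  have ht : ∀ j, (x (σ j) i, rankPrefix (σ j) i) < (t, univ) :=
    fun j => htop j ▸ rankPrefix_chain_lt (hx (σ j)) (σ j) hik le_rfl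
  obtain ⟨e, he⟩ := exists_diamond_embedding (b, (∅ : Finset (Fin k))) (t, univ)
    ((hb ⟨0, hs⟩).trans (ht ⟨0, hs⟩)) (fun j => (x (σ j) i, rankPrefix (σ j) i)) hb ht
    (fun j j' hjj => hanti j j' hjj.2)
  refine ⟨e, fun z => ?_⟩
  rcases he z with h | h | ⟨j, h⟩
  · rw [h, ← hbot ⟨0, hs⟩]
    exact hblue _ 0 k.zero_le
  · rw [h, ← htop ⟨0, hs⟩]
    exact hblue _ k le_rfl
  · rw [h]
    exact hblue _ i hik.le

end Colorings

section Asymptotics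

open Filter

lemma two_pow_mul_pow_lt_factorial_of_log {m s k : ℕ} (hs : 1 ≤ s) (hk : 1 ≤ k)
    (h : m * Real.log 2 + k * Real.log s + k < k * Real.log k) :
    2 ^ m * s ^ k < k.factorial := by
  have hs0 : (0 : ℝ) < s := by exact_mod_cast hs
  have hk0 : (0 : ℝ) < k := by exact_mod_cast hk
  have hfac : (0 : ℝ) < k.factorial := by exact_mod_cast k.factorial_pos
  have hlt : (2 : ℝ) ^ m * (s : ℝ) ^ k * Real.exp k < (k : ℝ) ^ k := by
    rw [← Real.log_lt_log_iff (by positivity) (by positivity),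
      Real.log_mul (by positivity) (by positivity), Real.log_mul (by positivity) (by positivity),
      Real.log_exp, Real.log_pow, Real.log_pow, Real.log_pow]
    exact h
  have hle : (k : ℝ) ^ k ≤ Real.exp k * k.factorial := by
    have := Real.pow_div_factorial_le_exp (k : ℝ) hk0.le k
    rwa [div_le_iff₀ hfac] at this
  have : (2 : ℝ) ^ m * (s : ℝ) ^ k < k.factorial := by
    have he := Real.exp_pos k
    by_contra! hcon
    nlinarith
  exact_mod_cast this

lemma eventually_two_pow_mul_pow_lt_factorial (s : ℕ → ℕ) (hs1 : ∀ n, 1 ≤ s n)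
    (hs : ∀ δ : ℝ, 0 < δ → ∃ n₁ : ℕ, ∀ n : ℕ, n₁ ≤ n → (s n : ℝ) ≤ (n : ℝ) ^ δ)
    (C : ℕ) (hC : 1 ≤ C) (ε : ℝ) (hε : 0 < ε) :
    ∀ᶠ n : ℕ in atTop, 2 ^ (C * n) * s n ^ ⌊(C + ε) * (n / Real.logb 2 n)⌋₊ <
      (⌊(C + ε) * (n / Real.logb 2 n)⌋₊).factorial := by
  have hC' : (1 : ℝ) ≤ C := by exact_mod_cast hC
  have hl2 : 0 < Real.log 2 := Real.log_pos one_lt_two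
  obtain ⟨δ, hδ, hδC⟩ : ∃ δ : ℝ, 0 < δ ∧ 12 * (δ * (C + ε)) = ε :=
    ⟨ε / (12 * (C + ε)), by positivity, by field_simp⟩
  obtain ⟨n₁, hn₁⟩ := hs δ hδ
  have hcast := tendsto_natCast_atTop_atTop (R := ℝ)
  have hsmall := hcast.eventually
    (Real.isLittleO_log_id_atTop.bound (show 0 < ε / 2 * Real.log 2 by positivity))
  have hsmall' := hcast.eventually
    ((isLittleO_log_rpow_atTop hδ).bound hl2)
  have hlarge := hcast.eventually (Real.tendsto_log_atTop.eventually_ge_atTop (1 / δ))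
  filter_upwards [hsmall, hsmall', hlarge, eventually_ge_atTop n₁, eventually_ge_atTop 2]
    with n h1 h2 h3 h4 h5
  have hn0 : (0 : ℝ) < n := by
    have : 0 < n := by omega
    exact_mod_cast this
  have hL : 0 < Real.log n := lt_of_lt_of_le (by positivity) h3
  rw [id, Real.norm_of_nonneg hL.le, Real.norm_of_nonneg hn0.le] at h1
  rw [Real.norm_of_nonneg hL.le, Real.norm_of_nonneg (by positivity)] at h2
  rw [div_le_iff₀ hδ] at h3
  set L := Real.log n with hLdef
  set r := ((C : ℝ) + ε) * (n / Real.logb 2 n) with hr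
  have hrL : r * L = (C + ε) * (n * Real.log 2) := by
    rw [hr, Real.logb, ← hLdef]
    field_simp
  set k := ⌊r⌋₊ with hk
  have hkr : r - 1 < k := Nat.sub_one_lt_floor r
  have hkL : (C + ε / 2) * (n * Real.log 2) < k * L := by
    nlinarith
  have hk_ge : (n : ℝ) ^ (1 - δ) ≤ k := by
    rw [Real.rpow_sub hn0, Real.rpow_one, div_le_iff₀ (by positivity)]
    have hu : 0 < n * Real.log 2 := by positivity
    have hkn : (n : ℝ) * Real.log 2 ≤ k * L := by nlinarith
    have hk0 : (0 : ℝ) ≤ k := k.cast_nonneg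
    have : (k : ℝ) * L ≤ k * (Real.log 2 * n ^ δ) := mul_le_mul_of_nonneg_left h2 hk0
    nlinarith
  have hk0 : (0 : ℝ) < k := lt_of_lt_of_le (by positivity) hk_ge
  have hlogk : (1 - δ) * L ≤ Real.log k := by
    rw [hLdef, ← Real.log_rpow hn0]
    exact Real.log_le_log (by positivity) hk_ge
  have hs0 : (0 : ℝ) < s n := by exact_mod_cast hs1 n
  have hlogs : Real.log (s n) ≤ δ * L := by
    rw [hLdef, ← Real.log_rpow hn0]
    exact Real.log_le_log hs0 (hn₁ n h4)
  refine two_pow_mul_pow_lt_factorial_of_log (hs1 n) (by exact_mod_cast hk0) ?_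
  have hδ1 : 0 < 1 - 3 * δ := by nlinarith
  have hkey : (k : ℝ) * ((1 - 3 * δ) * L) ≤ k * (Real.log k - Real.log (s n) - 1) :=
    mul_le_mul_of_nonneg_left (by linarith) hk0.le
  have hu : 0 < n * Real.log 2 := by positivity
  have hconst : (C : ℝ) ≤ (1 - 3 * δ) * (C + ε / 2) := by nlinarith
  have hmain : (C : ℝ) * (n * Real.log 2) < (1 - 3 * δ) * (k * L) :=
    calc (C : ℝ) * (n * Real.log 2) ≤ (1 - 3 * δ) * (C + ε / 2) * (n * Real.log 2) :=
          mul_le_mul_of_nonneg_right hconst hu.le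
      _ = (1 - 3 * δ) * ((C + ε / 2) * (n * Real.log 2)) := by ring
      _ < (1 - 3 * δ) * (k * L) := mul_lt_mul_of_pos_left hkL hδ1
  push_cast
  nlinarith

end Asymptotics

/-- Let `s : ℕ → ℕ` with `s n ≥ 1` and `s n = n^{o(1)}`. Then for every
`ε > 0` there is `n₀` such that for all `n ≥ n₀`,
`R(D_{s n}, Q_n) ≤ n + (2 + ε)·(n / log n)` and `R(V_{s n}, Q_n) ≤ n + (1 + ε)·(n / log n)`,
where the diamond is `D_s = K_{1,s,1}` and the fork is `V_s = K_{1,s}`. -/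
theorem diamond_fork_ramsey_upper (s : ℕ → ℕ) (hs1 : ∀ n, 1 ≤ s n)
    (hs : ∀ δ : ℝ, 0 < δ → ∃ n₁ : ℕ, ∀ n : ℕ, n₁ ≤ n → (s n : ℝ) ≤ (n : ℝ) ^ δ)
    (ε : ℝ) (hε : 0 < ε) :
    ∃ n₀ : ℕ, ∀ n : ℕ, n₀ ≤ n →
      (posetRamsey (Multipartite 3 ![1, s n, 1]) (Finset (Fin n)) : ℝ) ≤
        (n : ℝ) + (2 + ε) * ((n : ℝ) / Real.logb 2 (n : ℝ)) ∧
      (posetRamsey (Multipartite 2 ![1, s n]) (Finset (Fin n)) : ℝ) ≤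
        (n : ℝ) + (1 + ε) * ((n : ℝ) / Real.logb 2 (n : ℝ)) := by
  have hfork := eventually_two_pow_mul_pow_lt_factorial s hs1 hs 1 le_rfl ε hε
  have hdiamond := eventually_two_pow_mul_pow_lt_factorial s hs1 hs 2 one_le_two ε hε
  obtain ⟨n₀, hn₀⟩ := Filter.eventually_atTop.1 (hfork.and hdiamond)
  refine ⟨n₀, fun n hn => ?_⟩
  obtain ⟨h₁, h₂⟩ := hn₀ n hn
  rw [one_mul] at h₁
  push_cast at h₁ h₂
  have hlog : 0 ≤ (n : ℝ) / Real.logb 2 n := by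
    rw [Real.logb]
    positivity
  constructor
  · calc (posetRamsey (Multipartite 3 ![1, s n, 1]) (Finset (Fin n)) : ℝ)
        ≤ ((n + ⌊(2 + ε) * (n / Real.logb 2 n)⌋₊ : ℕ) : ℝ) :=
          Nat.cast_le.2 (posetRamsey_diamond_le (hs1 n) h₂)
      _ ≤ n + (2 + ε) * (n / Real.logb 2 n) := by
          push_cast
          gcongr
          exact Nat.floor_le (by positivity)
  · calc (posetRamsey (Multipartite 2 ![1, s n]) (Finset (Fin n)) : ℝ)
        ≤ ((n + ⌊(1 + ε) * (n / Real.logb 2 n)⌋₊ : ℕ) : ℝ) :=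
          Nat.cast_le.2 (posetRamsey_fork_le (hs1 n) h₁)
      _ ≤ n + (1 + ε) * (n / Real.logb 2 n) := by
          push_cast
          gcongr
          exact Nat.floor_le (by positivity)
end

section
/- Let 𝒩 be the 4-element N-shaped poset, with elements W, X, Y, Z satisfying W < Y, X < Y, X < Z, and with W,X incomparable, W,Z incomparable, and Y,Z incomparable. Then for every integer n ≥ 2^16, R(𝒩, Q_n) ≥ n + n/(15·log n), and for every ε > 0 there exists n_0 such that for all n ≥ n_0, R(𝒩, Q_n) ≤ n + (1 + ε)·(n / log n). -/
open Finset

/-- The N-shaped poset `𝒩`: elements `W, X, Y, Z` with `W < Y`, `X < Y`, `X < Z`, and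
`W,X` incomparable, `W,Z` incomparable, `Y,Z` incomparable. -/
inductive NPoset : Type
  | W | X | Y | Z
  deriving DecidableEq

namespace NPoset

def leB : NPoset → NPoset → Bool
  | W, W => true
  | W, Y => true
  | X, X => true
  | X, Y => true
  | X, Z => true
  | Y, Y => true
  | Z, Z => true
  | _, _ => false

instance : PartialOrder NPoset where
  le a b := leB a b = true
  le_refl a := by cases a <;> rfl
  le_trans a b c h₁ h₂ := by
    cases a <;> cases b <;> cases c <;> simp_all [leB]
  le_antisymm a b h₁ h₂ := by
    cases a <;> cases b <;> simp_all [leB]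

end NPoset

/-- A finite set without an induced copy of the N-shaped poset. -/
def NFree {β : Type*} [PartialOrder β] (D : Finset β) : Prop :=
  ∀ w ∈ D, ∀ x ∈ D, ∀ y ∈ D, ∀ z ∈ D, w < y → x < y → x < z →
    ¬ w ≤ x → ¬ x ≤ w → ¬ w ≤ z → ¬ y ≤ z → ¬ z ≤ y → False

/-- A finite set that is not the disjoint union of two nonempty mutually incomparable parts. -/
def CompConnected {β : Type*} [PartialOrder β] (D : Finset β) : Prop :=
  ∀ p : β → Prop, (∃ x ∈ D, p x) → (∃ x ∈ D, ¬ p x) →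
    ∃ x ∈ D, ∃ y ∈ D, p x ∧ ¬ p y ∧ (x ≤ y ∨ y ≤ x)

theorem NFree.mono {β : Type*} [PartialOrder β] {D E : Finset β} (h : NFree D) (hE : E ⊆ D) :
    NFree E := fun w hw x hx y hy z hz =>
  h w (hE hw) x (hE hx) y (hE hy) z (hE hz)

/-- In a connected N-free set some element lies strictly below all maximal elements. -/
theorem NFree.exists_lt_maximal {β : Type*} [PartialOrder β] {D : Finset β} (hN : NFree D)
    (hc : CompConnected D) (hD : D.Nontrivial) :
    ∃ x ∈ D, ∀ m, Maximal (· ∈ D) m → x < m := by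
  classical
  let M : β → Finset β := fun x => D.filter fun m => Maximal (· ∈ D) m ∧ x < m
  obtain ⟨x₀, hx₀, m₀, hm₀, hxm⟩ : ∃ x ∈ D, ∃ m, Maximal (· ∈ D) m ∧ x < m := by
    obtain ⟨a, ha, b, hb, hab⟩ := hD
    obtain ⟨x, hx, y, hy, hxa, hya, h⟩ := hc (fun x => x = a) ⟨a, ha, rfl⟩ ⟨b, hb, hab.symm⟩
    have hxy : x ≠ y := fun h => hya (h ▸ hxa)
    rcases h with h | h
    · obtain ⟨m, hm, hm'⟩ := D.exists_le_maximal hy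
      exact ⟨x, hx, m, hm', (lt_of_le_of_ne h hxy).trans_le hm⟩
    · obtain ⟨m, hm, hm'⟩ := D.exists_le_maximal hx
      exact ⟨y, hy, m, hm', (lt_of_le_of_ne h hxy.symm).trans_le hm⟩
  obtain ⟨x, hx, hmax⟩ := D.exists_max_image (fun x => (M x).card) ⟨x₀, hx₀⟩
  refine ⟨x, hx, fun m' hm' => ?_⟩
  by_contra hlt
  have hne : (M x).Nonempty := by
    rw [← card_pos]
    refine lt_of_lt_of_le (card_pos.2 ⟨m₀, ?_⟩) (hmax x₀ hx₀)
    simp only [M, mem_filter]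
    exact ⟨hm₀.1, hm₀, hxm⟩
  obtain ⟨m₁, hm₁⟩ := hne
  have hm₁D : m₁ ∈ D := (mem_filter.1 hm₁).1
  obtain ⟨z₁, hz₁, z₂, hz₂, ⟨m, hm, hzm⟩, hp₂, h⟩ := hc (fun z => ∃ m ∈ M x, z ≤ m)
    ⟨m₁, hm₁D, m₁, hm₁, le_rfl⟩
    ⟨m', hm'.1, by
      rintro ⟨m, hm, hle⟩
      obtain ⟨hmD, hm, hxm⟩ := mem_filter.1 hm
      exact hlt (hm'.eq_of_le hmD hle ▸ hxm)⟩
  have h12 : z₁ ≤ z₂ := h.resolve_right fun h => hp₂ ⟨m, hm, h.trans hzm⟩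
  have h12' : z₁ < z₂ := lt_of_le_of_ne h12 fun h => hp₂ ⟨m, hm, h ▸ hzm⟩
  obtain ⟨m₂, hz₂m, hm₂⟩ := D.exists_le_maximal hz₂
  have hm₂x : m₂ ∉ M x := fun h => hp₂ ⟨m₂, h, hz₂m⟩
  have hxm₂ : ¬ x < m₂ := fun h => hm₂x (mem_filter.2 ⟨hm₂.1, hm₂, h⟩)
  obtain ⟨hmD, hmm, hxm'⟩ := mem_filter.1 hm
  have hz₁m : z₁ < m := lt_of_le_of_ne hzm fun h => by
    have := hmm.eq_of_le hz₂ (h ▸ h12)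
    exact h12'.ne (h.trans this)
  have hz₁m₂ : z₁ < m₂ := h12'.trans_le hz₂m
  have hmm₂ : m ≠ m₂ := fun h => hm₂x (h ▸ hm)
  refine hN x hx z₁ hz₁ m hmD m₂ hm₂.1 hxm' hz₁m hz₁m₂ (fun h => hxm₂ (h.trans_lt hz₁m₂)) ?_ ?_
    (fun h => hmm₂ (hmm.eq_of_le hm₂.1 h)) (fun h => hmm₂ (hm₂.eq_of_le hmD h).symm)
  · intro h
    have hsub : M x ⊂ M z₁ := by
      refine ssubset_iff_of_subset (fun a ha => ?_) |>.2
        ⟨m₂, mem_filter.2 ⟨hm₂.1, hm₂, hz₁m₂⟩, hm₂x⟩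
      obtain ⟨h1, h2, h3⟩ := mem_filter.1 ha
      exact mem_filter.2 ⟨h1, h2, h.trans_lt h3⟩
    exact absurd (hmax z₁ hz₁) (not_le.2 (card_lt_card hsub))
  · intro h
    rcases h.lt_or_eq with h | h
    · exact hxm₂ h
    · subst h
      exact hmm₂ (hm₂.eq_of_le hmD hxm'.le).symm

/-- A connected N-free set with at least two elements is a series composition. -/
theorem NFree.exists_series {β : Type*} [PartialOrder β] {D : Finset β} (hN : NFree D)
    (hc : CompConnected D) (hD : D.Nontrivial) :
    ∃ p : β → Prop, (∃ x ∈ D, p x) ∧ (∃ x ∈ D, ¬ p x) ∧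
      ∀ x ∈ D, ∀ y ∈ D, p x → ¬ p y → x ≤ y := by
  obtain ⟨x₀, hx₀, hx₀m⟩ := hN.exists_lt_maximal hc hD
  obtain ⟨m₀, hm₀⟩ := D.exists_maximal ⟨x₀, hx₀⟩
  refine ⟨fun x => ∀ m, Maximal (· ∈ D) m → x < m, ⟨x₀, hx₀, hx₀m⟩,
    ⟨m₀, hm₀.1, fun h => (h m₀ hm₀).false⟩, fun x hx r hr hxm hrm => ?_⟩
  by_contra hxr
  obtain ⟨m, hm, hrm⟩ : ∃ m, Maximal (· ∈ D) m ∧ ¬ r < m := by simpa using hrm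
  obtain ⟨m', hrm', hm'⟩ := D.exists_le_maximal hr
  have hrlt : r < m' := lt_of_le_of_ne hrm' fun h => hxr (h ▸ (hxm m' hm').le)
  have hne : m' ≠ m := fun h => hrm (h ▸ hrlt)
  refine hN r hr x hx m' hm'.1 m hm.1 hrlt (hxm m' hm') (hxm m hm)
    (fun h => hrm (h.trans_lt (hxm m hm))) hxr (fun h => ?_)
    (fun h => hne (hm'.eq_of_le hm.1 h)) (fun h => hne (hm.eq_of_le hm'.1 h).symm)
  rcases h.lt_or_eq with h | h
  · exact hrm h
  · exact hxr (h ▸ (hxm m hm).le)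

/-- `D` meets the graph of every monotone function with values in `[P, Q]`. -/
def Blocks {α ι : Type*} [PartialOrder α] (D : Finset (α × Finset ι)) (P Q : Finset ι) : Prop :=
  ∀ f : α → Finset ι, Monotone f → (∀ s, P ⊆ f s) → (∀ s, f s ⊆ Q) → ∃ s, (s, f s) ∈ D

section Blocks

variable {α ι : Type*} [PartialOrder α]

theorem Blocks.exists_mem [Nonempty α] {D : Finset (α × Finset ι)} {P Q T : Finset ι}
    (h : Blocks D P Q) (hP : P ⊆ T) (hQ : T ⊆ Q) : ∃ s, (s, T) ∈ D :=
  h (fun _ => T) monotone_const (fun _ => hP) (fun _ => hQ)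

/-- A non-blocking set is avoided by a function that leaves `P` only above the set. -/
theorem exists_lazy_of_not_blocks {D : Finset (α × Finset ι)} {P Q : Finset ι} (hPQ : P ⊆ Q)
    (h : ¬ Blocks D P Q) :
    ∃ f : α → Finset ι, Monotone f ∧ (∀ s, P ⊆ f s) ∧ (∀ s, f s ⊆ Q) ∧ (∀ s, (s, f s) ∉ D) ∧
      ∀ s, f s ≠ P → ∃ d ∈ D, d ≤ (s, f s) := by
  classical
  obtain ⟨f, hf, hP, hQ, hD⟩ : ∃ f : α → Finset ι, Monotone f ∧ (∀ s, P ⊆ f s) ∧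
      (∀ s, f s ⊆ Q) ∧ (∀ s, (s, f s) ∉ D) := by
    simpa [Blocks] using h
  refine ⟨fun s => if ∃ d ∈ D, d ≤ (s, f s) then f s else P, ?_, ?_, ?_, ?_, ?_⟩
  · intro s t hst
    by_cases h : ∃ d ∈ D, d ≤ (s, f s)
    · have h' : ∃ d ∈ D, d ≤ (t, f t) := by
        obtain ⟨d, hd, hle⟩ := h
        exact ⟨d, hd, hle.trans ⟨hst, hf hst⟩⟩
      simp only [if_pos h, if_pos h']
      exact hf hst
    · simp only [if_neg h]
      split_ifs
      exacts [hP t, le_rfl]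
  · intro s
    dsimp only
    split_ifs
    exacts [hP s, Subset.rfl]
  · intro s
    dsimp only
    split_ifs
    exacts [hQ s, hPQ]
  · intro s
    dsimp only
    split_ifs with h
    · exact hD s
    · exact fun hs => h ⟨_, hs, le_rfl, hP s⟩
  · intro s
    dsimp only
    split_ifs with h
    · exact fun _ => h
    · exact fun h => absurd rfl h

/-- If two mutually incomparable sets together block `[P, Q]`, so does one of them. -/
theorem Blocks.of_parallel {D D₁ D₂ : Finset (α × Finset ι)} {P Q : Finset ι} (hPQ : P ⊆ Q)
    (h : Blocks D P Q) (hD : ∀ d ∈ D, d ∈ D₁ ∨ d ∈ D₂)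
    (hpar : ∀ x ∈ D₁, ∀ y ∈ D₂, ¬ (x ≤ y ∨ y ≤ x)) :
    Blocks D₁ P Q ∨ Blocks D₂ P Q := by
  classical
  by_contra hcon
  rw [not_or] at hcon
  obtain ⟨f₁, hf₁, hP₁, hQ₁, hD₁, hl₁⟩ := exists_lazy_of_not_blocks hPQ hcon.1
  obtain ⟨f₂, hf₂, hP₂, hQ₂, hD₂, hl₂⟩ := exists_lazy_of_not_blocks hPQ hcon.2
  obtain ⟨s, hs⟩ := h (fun s => f₁ s ∪ f₂ s)
    (fun s t hst => union_subset_union (hf₁ hst) (hf₂ hst))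
    (fun s => (hP₁ s).trans subset_union_left) (fun s => union_subset (hQ₁ s) (hQ₂ s))
  rcases hD _ hs with hs | hs
  · by_cases h2 : f₂ s = P
    · rw [h2, union_eq_left.2 (hP₁ s)] at hs
      exact hD₁ s hs
    · obtain ⟨d, hd, hle⟩ := hl₂ s h2
      exact hpar _ hs d hd (.inr (hle.trans ⟨le_rfl, subset_union_right⟩))
  · by_cases h1 : f₁ s = P
    · rw [h1, union_eq_right.2 (hP₂ s)] at hs
      exact hD₂ s hs
    · obtain ⟨d, hd, hle⟩ := hl₁ s h1
      exact hpar d hd _ hs (.inl (hle.trans ⟨le_rfl, subset_union_left⟩))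

end Blocks

section Counting

variable {α ι : Type*} [PartialOrder α] [DecidableEq ι]

/-- In a connected N-free set of elements with second coordinate strictly between `P` and `Q`,
there is a set `b` that is an end of every blocked interval `[insert y P, Q.erase y']`. -/
theorem NFree.exists_common_end [Nonempty α] {B : Finset (α × Finset ι)} (hN : NFree B)
    (hc : CompConnected B) (hB : B.Nontrivial) {P Q : Finset ι}
    (hPQ : ∀ x ∈ B, P ⊂ x.2 ∧ x.2 ⊂ Q) :
    ∃ b : Finset ι, ∀ y y', y' ∈ Q → insert y P ⊆ Q.erase y' →
      Blocks B (insert y P) (Q.erase y') → insert y P = b ∨ Q.erase y' = b := by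
  classical
  obtain ⟨p, ⟨u, hu, hpu⟩, ⟨v, hv, hpv⟩, hp⟩ := hN.exists_series hc hB
  let b := (B.filter p).sup Prod.snd
  have hle : ∀ x ∈ B, p x → x.2 ⊆ b := fun x hx h =>
    le_sup (f := Prod.snd) (mem_filter.2 ⟨hx, h⟩)
  have hge : ∀ x ∈ B, ¬ p x → b ⊆ x.2 := fun x hx h =>
    Finset.sup_le fun w hw => (hp w (mem_filter.1 hw).1 x hx (mem_filter.1 hw).2 h).2
  refine ⟨b, fun y y' hy' hyy h => ?_⟩
  have hcomp : ∀ T, insert y P ⊆ T → T ⊆ Q.erase y' → T ⊆ b ∨ b ⊆ T := fun T h1 h2 => by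
    obtain ⟨s, hs⟩ := h.exists_mem h1 h2
    by_cases hps : p (s, T)
    · exact .inl (hle _ hs hps)
    · exact .inr (hge _ hs hps)
  have key : Q.erase y' ⊆ b ∨ b ⊆ insert y P := by
    by_contra hcon
    rw [not_or, not_subset, not_subset] at hcon
    obtain ⟨⟨q, hq, hqb⟩, r, hr, hrP⟩ := hcon
    rcases hcomp (insert q (insert y P)) (subset_insert _ _)
      (insert_subset hq hyy) with h | h
    · exact hqb (h (mem_insert_self _ _))
    · rcases mem_insert.1 (h hr) with h | h
      · exact hqb (h ▸ hr)
      · exact hrP h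
  rcases key with h | h
  · right
    refine h.antisymm ?_
    have hvQ := (hPQ v hv).2
    have h1 : Q.erase y' ⊆ v.2 := h.trans (hge v hv hpv)
    have h2 : y' ∉ v.2 := fun h' => hvQ.2 fun z hz => by
      by_cases hzy : z = y'
      · exact hzy ▸ h'
      · exact h1 (mem_erase.2 ⟨hzy, hz⟩)
    exact (hge v hv hpv).trans fun z hz => mem_erase.2 ⟨fun h => h2 (h ▸ hz), hvQ.1 hz⟩
  · left
    refine Subset.antisymm ?_ h
    have huP := (hPQ u hu).1
    have h1 : u.2 ⊆ insert y P := (hle u hu hpu).trans h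
    have h2 : y ∈ u.2 := by
      by_contra h'
      exact huP.2 fun z hz => (mem_insert.1 (h1 hz)).resolve_left fun h => h' (h ▸ hz)
    exact (insert_subset h2 huP.1).trans (hle u hu hpu)

theorem card_mul_card_le_card_filter_ne (R S : Finset ι) :
    R.card * S.card ≤ ((R ×ˢ S).filter fun a => a.1 ≠ a.2).card + R.card ∧
      R.card * S.card ≤ ((R ×ˢ S).filter fun a => a.1 ≠ a.2).card + S.card := by
  have h := card_filter_add_card_filter_not (s := R ×ˢ S) (fun a : ι × ι => a.1 = a.2)
  rw [card_product] at h
  have h1 : ((R ×ˢ S).filter fun a => a.1 = a.2).card ≤ R.card := by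
    refine (card_le_card fun a ha => ?_).trans (card_image_le (s := R) (f := fun x => (x, x)))
    obtain ⟨x, y⟩ := a
    simp only [mem_filter, mem_product, mem_image] at ha ⊢
    exact ⟨x, ha.1.1, by rw [← ha.2]⟩
  have h2 : ((R ×ˢ S).filter fun a => a.1 = a.2).card ≤ S.card := by
    refine (card_le_card fun a ha => ?_).trans (card_image_le (s := S) (f := fun x => (x, x)))
    obtain ⟨x, y⟩ := a
    simp only [mem_filter, mem_product, mem_image] at ha ⊢
    exact ⟨y, ha.1.2, by rw [← ha.2]⟩
  constructor <;> simp only [ne_eq] <;> omega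

/-- The main count: an N-free set blocking the intervals `[insert y P, Q.erase y']` for all pairs
`(y, y')` in `A` has at least `|A| (|Q \ P| - 2)! / 2` elements. -/
theorem NFree.card_mul_factorial_le [Nonempty α] (m : ℕ) : ∀ (P Q : Finset ι), P ⊆ Q →
    (Q \ P).card = m + 2 → ∀ B : Finset (α × Finset ι), NFree B →
    (∀ x ∈ B, P ⊂ x.2 ∧ x.2 ⊂ Q) → ∀ A : Finset (ι × ι),
    (∀ a ∈ A, a.1 ∈ Q \ P ∧ a.2 ∈ Q \ P ∧ a.1 ≠ a.2 ∧ Blocks B (insert a.1 P) (Q.erase a.2)) →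
    A.card * m.factorial ≤ 2 * B.card := by
  classical
  have hsub : ∀ {P Q : Finset ι} {y y' : ι}, P ⊆ Q → y ∈ Q \ P → y' ∈ Q \ P → y ≠ y' →
      insert y P ⊆ Q.erase y' := by
    intro P Q y y' hPQ hy hy' hne
    rw [mem_sdiff] at hy hy'
    refine insert_subset (mem_erase.2 ⟨hne, hy.1⟩) fun z hz => mem_erase.2 ⟨?_, hPQ hz⟩
    exact fun h => hy'.2 (h ▸ hz)
  induction m with
  | zero =>
    intro P Q hPQ hcard B hN hB A hA
    rcases A.eq_empty_or_nonempty with rfl | ⟨a, ha⟩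
    · simp
    have hA2 : A.card ≤ 2 := by
      have : A ⊆ (Q \ P).offDiag := fun a ha => by
        obtain ⟨h1, h2, h3, -⟩ := hA a ha
        exact mem_offDiag.2 ⟨h1, h2, h3⟩
      have := card_le_card this
      rwa [offDiag_card, hcard] at this
    have hB1 : 0 < B.card := by
      obtain ⟨h1, h2, h3, h4⟩ := hA a ha
      obtain ⟨s, hs⟩ := h4.exists_mem Subset.rfl (hsub hPQ h1 h2 h3)
      exact card_pos.2 ⟨_, hs⟩
    simp only [Nat.factorial_zero]
    omega
  | succ m ih =>
    intro P Q hPQ hcard B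
    induction B using Finset.strongInduction with
    | H B ihB =>
    intro hN hB A hA
    rcases A.eq_empty_or_nonempty with rfl | ⟨a₀, ha₀⟩
    · simp
    by_cases hc : CompConnected B
    · have hne : ∀ a ∈ A, insert a.1 P ≠ Q.erase a.2 := by
        intro a ha h
        obtain ⟨h1, h2, h3, h4⟩ := hA a ha
        have : Q \ P ⊆ {a.1, a.2} := by
          intro z hz
          rw [mem_sdiff] at hz
          by_cases hz2 : z = a.2
          · simp [hz2]
          · have : z ∈ insert a.1 P := h ▸ mem_erase.2 ⟨hz2, hz.1⟩
            rcases mem_insert.1 this with h | h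
            · simp [h]
            · exact absurd h hz.2
        have := (card_le_card this).trans card_le_two
        omega
      have hnt : B.Nontrivial := by
        obtain ⟨h1, h2, h3, h4⟩ := hA a₀ ha₀
        obtain ⟨s, hs⟩ := h4.exists_mem Subset.rfl (hsub hPQ h1 h2 h3)
        obtain ⟨t, ht⟩ := h4.exists_mem (hsub hPQ h1 h2 h3) Subset.rfl
        exact ⟨_, hs, _, ht, fun h => hne a₀ ha₀ (congrArg Prod.snd h)⟩
      obtain ⟨b, hb⟩ := hN.exists_common_end hc hnt hB
      have hb' : ∀ a ∈ A, insert a.1 P = b ∨ Q.erase a.2 = b := fun a ha => by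
        obtain ⟨h1, h2, h3, h4⟩ := hA a ha
        exact hb _ _ (mem_sdiff.1 h2).1 (hsub hPQ h1 h2 h3) h4
      have hcross : ∀ a ∈ A, ∀ a' ∈ A, insert a.1 P ≠ Q.erase a'.2 := by
        intro a ha a' ha' h
        have h1 : (insert a.1 P \ P).card ≤ 1 := by
          refine (card_le_card fun z hz => ?_).trans (card_singleton a.1).le
          rw [mem_sdiff, mem_insert] at hz
          exact mem_singleton.2 (hz.1.resolve_right hz.2)
        have h2 : m + 2 ≤ (Q.erase a'.2 \ P).card := by
          rw [erase_sdiff_comm]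
          have := pred_card_le_card_erase (s := Q \ P) (a := a'.2)
          omega
        rw [h] at h1
        omega
      rcases hb' a₀ ha₀ with h₀ | h₀
      · have hrow : ∀ a ∈ A, a.1 = a₀.1 := by
          intro a ha
          rcases hb' a ha with h | h
          · have h1 : a.1 ∈ insert a₀.1 P := by
              rw [h₀, ← h]; exact mem_insert_self _ _
            exact (mem_insert.1 h1).resolve_right (mem_sdiff.1 (hA a ha).1).2
          · exact absurd (h₀.trans h.symm) (hcross a₀ ha₀ a ha)
        set y := a₀.1 with hy
        have hyQ := mem_sdiff.1 (hA a₀ ha₀).1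
        have hP' : insert y P ⊆ Q := insert_subset hyQ.1 hPQ
        have hsd : Q \ insert y P = (Q \ P).erase y := by
          ext z; simp only [mem_sdiff, mem_insert, mem_erase]; tauto
        have hcard' : (Q \ insert y P).card = m + 2 := by
          rw [hsd, card_erase_of_mem (hA a₀ ha₀).1]; omega
        have hAcard : (A.image Prod.snd).card = A.card :=
          card_image_of_injOn fun a ha a' ha' h =>
            Prod.ext ((hrow a ha).trans (hrow a' ha').symm) h
        have := ih (insert y P) Q hP' hcard' (B.filter fun x => insert y P ⊂ x.2)
          (hN.mono (filter_subset _ _))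
          (fun x hx => ⟨(mem_filter.1 hx).2, (hB x (mem_filter.1 hx).1).2⟩)
          (((Q \ insert y P) ×ˢ A.image Prod.snd).filter fun a => a.1 ≠ a.2) (by
            intro a ha
            simp only [mem_filter, mem_product, mem_image] at ha
            obtain ⟨⟨h1, a', ha', h2⟩, h3⟩ := ha
            obtain ⟨h4, h5, h6, h7⟩ := hA a' ha'
            rw [hrow a' ha', h2] at h7
            rw [hrow a' ha'] at h6
            refine ⟨h1, ?_, h3, ?_⟩
            · rw [hsd, ← h2]
              exact mem_erase.2 ⟨h6.symm, h5⟩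
            · intro f hf hfP hfQ
              obtain ⟨s, hs⟩ := h7 f hf (fun s => (subset_insert _ _).trans (hfP s)) hfQ
              refine ⟨s, mem_filter.2 ⟨hs, ?_⟩⟩
              refine ((ssubset_insert (mem_sdiff.1 h1).2)).trans_subset (hfP s))
        have hcnt := (card_mul_card_le_card_filter_ne (Q \ insert y P) (A.image Prod.snd)).2
        rw [hcard', hAcard] at hcnt
        calc A.card * (m + 1).factorial = ((m + 1) * A.card) * m.factorial := by
              rw [Nat.factorial_succ]; ring
          _ ≤ _ := Nat.mul_le_mul_right _ (by linarith)
          _ ≤ _ := this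
          _ ≤ _ := Nat.mul_le_mul_left _ (card_le_card (filter_subset _ _))
      · have hcol : ∀ a ∈ A, a.2 = a₀.2 := by
          intro a ha
          rcases hb' a ha with h | h
          · exact absurd (h.trans h₀.symm) (hcross a ha a₀ ha₀)
          · by_contra hne
            have h1 : a.2 ∈ Q.erase a₀.2 := mem_erase.2 ⟨hne, (mem_sdiff.1 (hA a ha).2.1).1⟩
            rw [h₀, ← h] at h1
            exact notMem_erase _ _ h1
        set y := a₀.2 with hy
        have hyQ := mem_sdiff.1 (hA a₀ ha₀).2.1
        have hP' : P ⊆ Q.erase y := fun z hz => mem_erase.2 ⟨fun h : z = y => hyQ.2 (by rwa [← hy, ← h]), hPQ hz⟩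
        have hsd : Q.erase y \ P = (Q \ P).erase y := erase_sdiff_comm _ _ _
        have hcard' : (Q.erase y \ P).card = m + 2 := by
          rw [hsd, card_erase_of_mem (hA a₀ ha₀).2.1]; omega
        have hAcard : (A.image Prod.fst).card = A.card :=
          card_image_of_injOn fun a ha a' ha' h =>
            Prod.ext h ((hcol a ha).trans (hcol a' ha').symm)
        have := ih P (Q.erase y) hP' hcard' (B.filter fun x => x.2 ⊂ Q.erase y)
          (hN.mono (filter_subset _ _))
          (fun x hx => ⟨(hB x (mem_filter.1 hx).1).1, (mem_filter.1 hx).2⟩)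
          ((A.image Prod.fst ×ˢ (Q.erase y \ P)).filter fun a => a.1 ≠ a.2) (by
            intro a ha
            simp only [mem_filter, mem_product, mem_image] at ha
            obtain ⟨⟨⟨a', ha', h2⟩, h1⟩, h3⟩ := ha
            obtain ⟨h4, h5, h6, h7⟩ := hA a' ha'
            rw [hcol a' ha', h2] at h7
            rw [hcol a' ha'] at h6
            refine ⟨?_, h1, h3, ?_⟩
            · rw [hsd, ← h2]
              exact mem_erase.2 ⟨h6, h4⟩
            · intro f hf hfP hfQ
              obtain ⟨s, hs⟩ := h7 f hf hfP (fun s => (hfQ s).trans (erase_subset _ _))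
              refine ⟨s, mem_filter.2 ⟨hs, ?_⟩⟩
              exact Finset.ssubset_of_subset_of_ssubset (hfQ s) (erase_ssubset (mem_sdiff.1 h1).1))
        have hcnt := (card_mul_card_le_card_filter_ne (A.image Prod.fst) (Q.erase y \ P)).1
        rw [hcard', hAcard] at hcnt
        calc A.card * (m + 1).factorial = (A.card * (m + 1)) * m.factorial := by
              rw [Nat.factorial_succ]; ring
          _ ≤ _ := Nat.mul_le_mul_right _ (by linarith)
          _ ≤ _ := this
          _ ≤ _ := Nat.mul_le_mul_left _ (card_le_card (filter_subset _ _))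
    · obtain ⟨p, ⟨u, hu, hpu⟩, ⟨v, hv, hpv⟩, hp⟩ : ∃ p : α × Finset ι → Prop,
          (∃ x ∈ B, p x) ∧ (∃ x ∈ B, ¬ p x) ∧
          ∀ x ∈ B, ∀ y ∈ B, p x → ¬ p y → ¬ (x ≤ y ∨ y ≤ x) := by
        unfold CompConnected at hc
        push Not at hc
        obtain ⟨p, h1, h2, h3⟩ := hc
        exact ⟨p, h1, h2, fun x hx y hy hpx hpy => not_or.2 (h3 x hx y hy hpx hpy)⟩
      have hs1 : B.filter p ⊂ B := filter_ssubset.2 ⟨v, hv, hpv⟩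
      have hs2 : B.filter (fun x => ¬ p x) ⊂ B := filter_ssubset.2 ⟨u, hu, not_not.2 hpu⟩
      let A₁ := A.filter fun a => Blocks (B.filter p) (insert a.1 P) (Q.erase a.2)
      let A₂ := A.filter fun a => Blocks (B.filter fun x => ¬ p x) (insert a.1 P) (Q.erase a.2)
      have h1 := ihB _ hs1 (hN.mono hs1.1) (fun x hx => hB x (hs1.1 hx)) A₁ fun a ha => by
        obtain ⟨h1, h2, h3, -⟩ := hA a (mem_filter.1 ha).1
        exact ⟨h1, h2, h3, (mem_filter.1 ha).2⟩
      have h2 := ihB _ hs2 (hN.mono hs2.1) (fun x hx => hB x (hs2.1 hx)) A₂ fun a ha => by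
        obtain ⟨h1, h2, h3, -⟩ := hA a (mem_filter.1 ha).1
        exact ⟨h1, h2, h3, (mem_filter.1 ha).2⟩
      have hAA : A.card ≤ A₁.card + A₂.card := by
        refine (card_le_card fun a ha => ?_).trans (card_union_le _ _)
        obtain ⟨h1, h2, h3, h4⟩ := hA a ha
        rcases h4.of_parallel (D₁ := B.filter p) (D₂ := B.filter fun x => ¬ p x)
          (hsub hPQ h1 h2 h3)
          (fun d hd => by by_cases h : p d <;> simp [hd, h])
          (fun x hx y hy => hp x (mem_filter.1 hx).1 y (mem_filter.1 hy).1 (mem_filter.1 hx).2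
            (mem_filter.1 hy).2) with h | h
        · exact mem_union_left _ (mem_filter.2 ⟨ha, h⟩)
        · exact mem_union_right _ (mem_filter.2 ⟨ha, h⟩)
      have hBB := card_filter_add_card_filter_not (s := B) p
      calc A.card * (m + 1).factorial ≤ (A₁.card + A₂.card) * (m + 1).factorial :=
            Nat.mul_le_mul_right _ hAA
        _ ≤ 2 * B.card := by rw [add_mul]; omega

/-- An N-free set blocking all monotone functions into subsets of a `k`-set is large. -/
theorem NFree.factorial_le [Nonempty α] {Q : Finset ι} {k : ℕ} (hk : Q.card = k) (h2 : 2 ≤ k)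
    {B : Finset (α × Finset ι)} (hN : NFree B) (h : Blocks B ∅ Q) :
    k.factorial ≤ 2 * B.card := by
  classical
  obtain ⟨m, rfl⟩ := Nat.exists_eq_add_of_le' h2
  have := NFree.card_mul_factorial_le m ∅ Q (empty_subset _) (by simpa using hk)
    (B.filter fun x => ∅ ⊂ x.2 ∧ x.2 ⊂ Q) (hN.mono (filter_subset _ _))
    (fun x hx => (mem_filter.1 hx).2) Q.offDiag fun a ha => by
      obtain ⟨h1, h2, h3⟩ := mem_offDiag.1 ha
      refine ⟨by simpa using h1, by simpa using h2, h3, fun f hf hfP hfQ => ?_⟩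
      obtain ⟨s, hs⟩ := h f hf (fun _ => empty_subset _) fun s => (hfQ s).trans (erase_subset _ _)
      refine ⟨s, mem_filter.2 ⟨hs, ?_, Finset.ssubset_of_subset_of_ssubset (hfQ s) (erase_ssubset h2)⟩⟩
      exact Finset.ssubset_of_ssubset_of_subset
        (empty_ssubset.2 (insert_nonempty a.1 ∅)) (hfP s)
  rw [offDiag_card, hk] at this
  calc (m + 2).factorial = ((m + 2) * (m + 2) - (m + 2)) * m.factorial := by
        have : (m + 2) * (m + 2) - (m + 2) = (m + 2) * (m + 1) := by
          rw [Nat.sub_eq_iff_eq_add (by nlinarith)]; ring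
        rw [this, Nat.factorial_succ, Nat.factorial_succ]; ring
    _ ≤ _ := this
    _ ≤ _ := Nat.mul_le_mul_left _ (card_le_card (filter_subset _ _))

end Counting

/-- Four elements in N-shaped position give an induced copy of `NPoset`. -/
theorem exists_nposet_embedding {β : Type*} [PartialOrder β] {w x y z : β} (hwy : w < y)
    (hxy : x < y) (hxz : x < z) (hwx : ¬ w ≤ x) (hxw : ¬ x ≤ w) (hwz : ¬ w ≤ z) (hyz : ¬ y ≤ z)
    (hzy : ¬ z ≤ y) :
    ∃ e : NPoset ↪o β, e .W = w ∧ e .X = x ∧ e .Y = y ∧ e .Z = z := by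
  have hzw : ¬ z ≤ w := fun h => hxw (hxz.le.trans h)
  refine ⟨OrderEmbedding.ofMapLEIff
    (fun | .W => w | .X => x | .Y => y | .Z => z) ?_, rfl, rfl, rfl, rfl⟩
  have hle : ∀ a b : NPoset, a ≤ b ↔ NPoset.leB a b = true := fun _ _ => Iff.rfl
  intro a b
  rw [hle]
  cases a <;> cases b <;>
    simp [NPoset.leB, hwy.le, hxy.le, hxz.le, hwx, hxw, hwz, hyz, hzy, hzw, hwy.not_ge,
      hxy.not_ge, hxz.not_ge]

theorem posetRamsey_set_mem_of_factorial {n k : ℕ} (hk : 2 ≤ k)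
    (h : 2 * 2 ^ (n + k) < k.factorial) (c : Finset (Fin (n + k)) → Bool) :
    (∃ e : NPoset ↪o Finset (Fin (n + k)), ∀ p, c (e p) = true) ∨
      (∃ e : Finset (Fin n) ↪o Finset (Fin (n + k)), ∀ q, c (e q) = false) := by
  classical
  let Φ : Finset (Fin n) × Finset (Fin k) ≃o Finset (Fin (n + k)) :=
    Finset.sumEquiv.symm.trans
      { toEquiv := finSumFinEquiv.finsetCongr
        map_rel_iff' := by
          intro s t
          exact map_subset_map }
  by_contra hcon
  rw [not_or] at hcon
  obtain ⟨hblue, hred⟩ := hcon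
  let B : Finset (Finset (Fin n) × Finset (Fin k)) := univ.filter fun x => c (Φ x) = true
  have hN : NFree B := by
    intro w hw x hx y hy z hz h1 h2 h3 h4 h5 h6 h7 h8
    obtain ⟨e, rfl, rfl, rfl, rfl⟩ := exists_nposet_embedding h1 h2 h3 h4 h5 h6 h7 h8
    refine hblue ⟨e.trans Φ.toOrderEmbedding, fun p => ?_⟩
    cases p
    exacts [(mem_filter.1 hw).2, (mem_filter.1 hx).2, (mem_filter.1 hy).2, (mem_filter.1 hz).2]
  have hB : Blocks B ∅ univ := by
    intro f hf _ _
    by_contra hno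
    push Not at hno
    refine hred ⟨(OrderEmbedding.ofMapLEIff (fun s => ((s, f s) : Finset (Fin n) × Finset (Fin k)))
      fun s t => ⟨fun h => (Prod.mk_le_mk.1 h).1, fun h => Prod.mk_le_mk.2 ⟨h, hf h⟩⟩).trans Φ.toOrderEmbedding, fun q => ?_⟩
    have := hno q
    simpa [B] using this
  have h1 := hN.factorial_le (card_fin k) hk hB
  have h2 : B.card ≤ 2 ^ (n + k) := by
    refine (card_le_univ B).trans (le_of_eq ?_)
    simp [pow_add]
  omega

theorem posetRamsey_le_of_factorial {n k : ℕ} (hk : 2 ≤ k)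
    (h : 2 * 2 ^ (n + k) < k.factorial) :
    posetRamsey NPoset (Finset (Fin n)) ≤ n + k :=
  Nat.sInf_le (posetRamsey_set_mem_of_factorial hk h)

section Asymptotics

open Filter Topology

theorem exists_two_mul_two_pow_lt_factorial (n : ℕ) :
    ∃ k, 2 ≤ k ∧ 2 * 2 ^ (n + k) < k.factorial := by
  have h := FloorSemiring.tendsto_pow_div_factorial_atTop (2 : ℝ)
  have h' := (h.eventually (gt_mem_nhds (show (0 : ℝ) < 1 / 2 ^ (n + 1) by positivity))).and
    (eventually_ge_atTop 2)
  obtain ⟨k, hk, hk2⟩ := h'.exists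
  refine ⟨k, hk2, ?_⟩
  rw [div_lt_div_iff₀ (by positivity) (by positivity)] at hk
  have : (2 : ℝ) * 2 ^ (n + k) < k.factorial := by
    calc (2 : ℝ) * 2 ^ (n + k) = 2 ^ k * 2 ^ (n + 1) := by ring
      _ < _ := by linarith
  exact_mod_cast this

/-- A real lower bound on `k!`: if `k (log₂ k - 4) ≥ n` then `k! > 2 · 2 ^ (n + k)`. -/
theorem two_mul_two_pow_lt_factorial {n k : ℕ} (hk : 2 ≤ k)
    (h : (n : ℝ) ≤ k * (Real.logb 2 k - 4)) : 2 * 2 ^ (n + k) < k.factorial := by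
  have hk0 : (0 : ℝ) < k := by exact_mod_cast (by omega : 0 < k)
  have h1 := Real.pow_div_factorial_le_exp (k : ℝ) hk0.le k
  have hf : (0 : ℝ) < k.factorial := by exact_mod_cast k.factorial_pos
  rw [div_le_iff₀ hf] at h1
  have h2 : Real.exp k < 4 ^ k := by
    rw [← Real.exp_one_pow]
    exact pow_lt_pow_left₀ (by linarith [Real.exp_one_lt_d9]) (Real.exp_pos _).le (by omega)
  have h3 : (2 : ℝ) ^ n * 16 ^ k ≤ k ^ k := by
    have e1 : (2 : ℝ) ^ n * 16 ^ k = (2 : ℝ) ^ ((n : ℝ) + 4 * k) := by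
      rw [Real.rpow_add two_pos, Real.rpow_natCast, Real.rpow_mul two_pos.le, Real.rpow_natCast]
      norm_num
    have e2 : (k : ℝ) ^ k = (2 : ℝ) ^ (Real.logb 2 k * k) := by
      rw [Real.rpow_mul two_pos.le, Real.rpow_logb two_pos (by norm_num) hk0, Real.rpow_natCast]
    rw [e1, e2]
    exact Real.rpow_le_rpow_of_exponent_le one_le_two (by linarith)
  have h4 : (2 : ℝ) ^ n * 16 ^ k < 4 ^ k * k.factorial :=
    (h3.trans h1).trans_lt (mul_lt_mul_of_pos_right h2 hf)
  have e : (16 : ℝ) ^ k = 4 ^ k * (2 ^ k * 2 ^ k) := by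
    rw [← mul_pow, ← mul_pow]; norm_num
  rw [e] at h4
  have h5 : (2 : ℝ) ^ n * (2 ^ k * 2 ^ k) < k.factorial := by
    have : (0 : ℝ) < 4 ^ k := by positivity
    nlinarith
  have h6 : (2 : ℝ) ≤ 2 ^ k := by
    calc (2 : ℝ) = 2 ^ 1 := (pow_one _).symm
      _ ≤ 2 ^ k := pow_le_pow_right₀ one_le_two (by omega)
  have : (2 : ℝ) * 2 ^ (n + k) < k.factorial := by
    refine lt_of_le_of_lt ?_ h5
    rw [pow_add]
    have : (0 : ℝ) ≤ 2 ^ n * 2 ^ k := by positivity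
    nlinarith
  exact_mod_cast this

theorem tendsto_logb_two_atTop : Tendsto (fun n : ℕ => Real.logb 2 n) atTop atTop :=
  (Real.tendsto_logb_atTop one_lt_two).comp tendsto_natCast_atTop_atTop

theorem tendsto_logb_two_div_self : Tendsto (fun x : ℝ => Real.logb 2 x / x) atTop (𝓝 0) := by
  have h := Real.isLittleO_log_id_atTop.tendsto_div_nhds_zero
  have := h.div_const (Real.log 2)
  simp only [zero_div] at this
  refine this.congr fun x => ?_
  simp only [Real.logb, id]
  ring

theorem posetRamsey_upper (ε : ℝ) (hε : 0 < ε) : ∃ n₀ : ℕ, ∀ n : ℕ, n₀ ≤ n →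
    (posetRamsey NPoset (Finset (Fin n)) : ℝ) ≤
      (n : ℝ) + (1 + ε) * ((n : ℝ) / Real.logb 2 (n : ℝ)) := by
  have t1 := tendsto_logb_two_atTop
  have t2 : Tendsto (fun n : ℕ => Real.logb 2 n / n) atTop (𝓝 0) :=
    tendsto_logb_two_div_self.comp tendsto_natCast_atTop_atTop
  have t3 : Tendsto (fun n : ℕ => (Real.logb 2 (Real.logb 2 n) + 4) / Real.logb 2 n)
      atTop (𝓝 0) := by
    have := (tendsto_logb_two_div_self.comp t1).add (t1.const_div_atTop 4)
    simp only [add_zero] at this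
    exact this.congr fun n => by simp [add_div]
  have hδ : 0 < 1 - 1 / (1 + ε / 2) := by
    rw [sub_pos, div_lt_one (by positivity)]; linarith
  have ev := (t1.eventually_ge_atTop 1).and ((t2.eventually (gt_mem_nhds
    (show (0 : ℝ) < min (ε / 2) (1 / 2) by positivity))).and
    ((t3.eventually (gt_mem_nhds hδ)).and (eventually_ge_atTop 1)))
  obtain ⟨n₀, hn₀⟩ := eventually_atTop.1 ev
  refine ⟨n₀, fun n hn => ?_⟩
  obtain ⟨hL, h2, h3, hn1⟩ := hn₀ n hn
  set L := Real.logb 2 n with hLdef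
  have hn0 : (0 : ℝ) < n := by exact_mod_cast hn1
  have hL0 : 0 < L := by linarith
  have hx0 : 0 < (n : ℝ) / L := by positivity
  set k := ⌊(1 + ε) * ((n : ℝ) / L)⌋₊ with hk
  have hkle : (k : ℝ) ≤ (1 + ε) * (n / L) := Nat.floor_le (by positivity)
  have hklt : (1 + ε) * (n / L) < k + 1 := Nat.lt_floor_add_one _
  have hεL : 1 < ε / 2 * (n / L) ∧ 2 < n / L := by
    rw [lt_min_iff, div_lt_iff₀ hn0, div_lt_iff₀ hn0] at h2
    constructor
    · rw [← mul_div_assoc, lt_div_iff₀ hL0]; linarith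
    · rw [lt_div_iff₀ hL0]; linarith
  have hkge : (1 + ε / 2) * (n / L) ≤ k := by nlinarith [hεL.1]
  have hkge' : n / L ≤ k := by nlinarith
  have hk2 : 2 ≤ k := by
    have : (2 : ℝ) ≤ k := by linarith [hεL.2]
    exact_mod_cast this
  have hlogk : L - Real.logb 2 L ≤ Real.logb 2 k := by
    rw [hLdef, ← Real.logb_div hn0.ne' (by rw [← hLdef]; exact hL0.ne')]
    exact Real.logb_le_logb_of_le one_lt_two (by rw [← hLdef]; exact hx0) hkge'
  have h4 : L / (1 + ε / 2) ≤ L - Real.logb 2 L - 4 := by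
    rw [div_lt_iff₀ hL0] at h3
    have : L / (1 + ε / 2) = 1 / (1 + ε / 2) * L := by ring
    rw [this]
    nlinarith
  have h5 : (n : ℝ) ≤ k * (Real.logb 2 k - 4) := by
    have : (n : ℝ) = (1 + ε / 2) * (n / L) * (L / (1 + ε / 2)) := by
      field_simp
    rw [this]
    exact mul_le_mul hkge (by linarith) (by positivity) (by positivity)
  have h6 := posetRamsey_le_of_factorial hk2 (two_mul_two_pow_lt_factorial hk2 h5)
  calc (posetRamsey NPoset (Finset (Fin n)) : ℝ) ≤ ((n + k : ℕ) : ℝ) := by exact_mod_cast h6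
    _ ≤ _ := by push_cast; linarith

end Asymptotics

section LowerBound

open Polynomial in
/-- The Reed-Solomon property: distinct `k`-subsets of a field have root polynomials that agree in
at most `k` points. -/
theorem card_agree_le {F ι : Type*} [Field F] [Fintype ι] [DecidableEq F] {ev : ι → F}
    (hev : Function.Injective ev) {k : ℕ} {s t : Finset F} (hs : s.card = k) (ht : t.card = k)
    (hst : s ≠ t) :
    (univ.filter fun i => (∏ a ∈ s, (X - C a)).eval (ev i) =
      (∏ a ∈ t, (X - C a)).eval (ev i)).card ≤ k := by
  set p := ∏ a ∈ s, (X - C a)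
  set q := ∏ a ∈ t, (X - C a)
  have hpq : p - q ≠ 0 := by
    intro h
    have h1 := congrArg roots (sub_eq_zero.1 h)
    rw [roots_prod_X_sub_C, roots_prod_X_sub_C] at h1
    exact hst (Finset.val_injective h1)
  have hdeg : (p - q).natDegree ≤ k := by
    refine (natDegree_sub_le _ _).trans (max_le ?_ ?_)
    · exact ((natDegree_finsetProd_X_sub_C_eq_card s id).trans hs).le
    · exact ((natDegree_finsetProd_X_sub_C_eq_card t id).trans ht).le
  rw [← card_image_of_injective _ hev]
  calc _ ≤ (p - q).roots.toFinset.card := card_le_card fun x hx => by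
        obtain ⟨i, hi, rfl⟩ := mem_image.1 hx
        rw [Multiset.mem_toFinset, mem_roots hpq, IsRoot, eval_sub, (mem_filter.1 hi).2, sub_self]
    _ ≤ Multiset.card (p - q).roots := Multiset.toFinset_card_le _
    _ ≤ k := (card_roots' _).trans hdeg

/-- The blocks `i` such that `pos (i, ·)` meets `Y` number at most `|Y|`. -/
theorem card_touched_le {V ι κ : Type*} [DecidableEq V] [Fintype ι] {pos : ι × κ → V}
    (hpos : Function.Injective pos) (Y : Finset V) [DecidablePred fun i => ∃ b, pos (i, b) ∈ Y] :
    (univ.filter fun i => ∃ b, pos (i, b) ∈ Y).card ≤ Y.card := by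
  classical
  rcases isEmpty_or_nonempty (ι × κ) with h | h
  · rw [filter_false_of_mem]
    · simp
    · rintro i - ⟨b, -⟩
      exact h.false (i, b)
  · refine (card_le_card fun i hi => ?_).trans
      (card_image_le (s := Y) (f := fun v => (Function.invFun pos v).1))
    obtain ⟨b, hb⟩ := (mem_filter.1 hi).2
    exact mem_image.2 ⟨_, hb, by rw [Function.leftInverse_invFun hpos]⟩

/-- If `pos` has more than `2k` blocks, then for every `k`-set `Y` there are `k` blocks that miss
`Y`. -/
theorem exists_untouched {V ι κ : Type*} [DecidableEq V] [Fintype ι] [Nonempty ι] {pos : ι × κ → V}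
    (hpos : Function.Injective pos) {k : ℕ} (hι : 2 * k ≤ Fintype.card ι) (Y : Finset V)
    (hY : Y.card = k) :
    ∃ g : ℕ → ι, (∀ i < k, ∀ j < k, g i = g j → i = j) ∧ ∀ j < k, ∀ b, pos (g j, b) ∉ Y := by
  classical
  have h := card_touched_le hpos Y
  have h' := card_filter_add_card_filter_not (s := (univ : Finset ι))
    (fun i => ∃ b, pos (i, b) ∈ Y)
  rw [card_univ] at h'
  obtain ⟨e⟩ : Nonempty (Fin k ↪ {i // i ∈ univ.filter fun i => ¬ ∃ b, pos (i, b) ∈ Y}) := by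
    refine Function.Embedding.nonempty_of_card_le ?_
    rw [Fintype.card_fin, Fintype.card_coe]
    omega
  refine ⟨fun j => if h : j < k then e ⟨j, h⟩ else Classical.arbitrary ι, ?_, ?_⟩
  · intro i hi j hj hij
    simp only [dif_pos hi, dif_pos hj] at hij
    simpa using e.injective (Subtype.ext hij)
  · intro j hj b hb
    simp only [dif_pos hj] at hb
    exact (mem_filter.1 (e ⟨j, hj⟩).2).2 ⟨b, hb⟩

/-- Data for building pairwise incomparable shrubs over the `k`-subsets of `V`: disjoint blocks of
pairs of elements of `V`, bit encodings of `k`-subsets in the blocks `ι₁` any two of which differ in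
a block missing both subsets, and bit encodings of elements in blocks `ι₂` missing the subset. -/
structure ShrubSystem (V ι₁ ι₂ κ : Type*) (k : ℕ) where
  pos : (ι₁ ⊕ ι₂) × κ × Bool → V
  pos_injective : Function.Injective pos
  code : Finset V → ι₁ → κ → Bool
  code_sep : ∀ Y Y' : Finset V, Y.card = k → Y'.card = k → Y ≠ Y' →
    ∃ i b, code Y i b ≠ code Y' i b ∧ ∀ c, pos (.inl i, c) ∉ Y ∧ pos (.inl i, c) ∉ Y'
  sym : V → κ → Bool
  sym_injective : Function.Injective sym
  slot : Finset V → ℕ → ι₂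
  slot_injOn : ∀ Y : Finset V, Y.card = k → ∀ i < k, ∀ j < k, slot Y i = slot Y j → i = j
  slot_notMem : ∀ Y : Finset V, Y.card = k → ∀ j < k, ∀ c, pos (.inr (slot Y j), c) ∉ Y

/-- `σ` is an ordered list of distinct elements of the `k`-set `Y`. -/
structure IsBranch {V : Type*} (k : ℕ) (Y : Finset V) (σ : List V) : Prop where
  card_eq : Y.card = k
  nodup : σ.Nodup
  mem : ∀ v ∈ σ, v ∈ Y

theorem IsBranch.length_le {V : Type*} {k : ℕ} {Y : Finset V} {σ : List V} (h : IsBranch k Y σ) :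
    σ.length ≤ k := by
  classical
  rw [← h.card_eq, ← List.toFinset_card_of_nodup h.nodup]
  exact card_le_card fun v hv => h.mem v (List.mem_toFinset.1 hv)

namespace ShrubSystem

variable {V ι₁ ι₂ κ : Type*} [Fintype V] {k : ℕ}

open Classical in
/-- The element of the shrub of `Y` attached to an ordered list `σ` of elements of `Y`. It consists
of `σ`, an encoding of `Y` and an encoding of `σ`. -/
noncomputable def node (S : ShrubSystem V ι₁ ι₂ κ k) (Y : Finset V) (σ : List V) : Finset V :=
  univ.filter fun v => v ∈ σ ∨ (v ∉ Y ∧ ∃ i b, v = S.pos (.inl i, b, S.code Y i b)) ∨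
    ∃ j, ∃ h : j < σ.length, ∃ b, v = S.pos (.inr (S.slot Y j), b, S.sym σ[j] b)

theorem mem_node {S : ShrubSystem V ι₁ ι₂ κ k} {Y : Finset V} {σ : List V} {v : V} :
    v ∈ S.node Y σ ↔ v ∈ σ ∨ (v ∉ Y ∧ ∃ i b, v = S.pos (.inl i, b, S.code Y i b)) ∨
      ∃ j, ∃ h : j < σ.length, ∃ b, v = S.pos (.inr (S.slot Y j), b, S.sym σ[j] b) := by
  simp [node]

theorem node_mono (S : ShrubSystem V ι₁ ι₂ κ k) (Y : Finset V) {σ τ : List V} (h : σ <+: τ) :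
    S.node Y σ ⊆ S.node Y τ := by
  intro v hv
  rw [mem_node] at hv ⊢
  rcases hv with hv | hv | ⟨j, hj, b, hv⟩
  · exact .inl (h.subset hv)
  · exact .inr (.inl hv)
  · exact .inr (.inr ⟨j, hj.trans_le h.length_le, b, by rw [← h.getElem hj]; exact hv⟩)

theorem mem_of_mem_node {S : ShrubSystem V ι₁ ι₂ κ k} {Y : Finset V} {σ : List V}
    (h : IsBranch k Y σ) {v : V} (hv : v ∈ S.node Y σ) (hvY : v ∈ Y) : v ∈ σ := by
  rcases mem_node.1 hv with hv | ⟨hv, -⟩ | ⟨j, hj, b, rfl⟩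
  · exact hv
  · exact absurd hvY hv
  · exact absurd hvY (S.slot_notMem Y h.card_eq j (hj.trans_le h.length_le) _)

theorem eq_of_node_subset {S : ShrubSystem V ι₁ ι₂ κ k} {Y Y' : Finset V} {σ σ' : List V}
    (h : IsBranch k Y σ) (h' : IsBranch k Y' σ') (hsub : S.node Y σ ⊆ S.node Y' σ') : Y = Y' := by
  by_contra hne
  obtain ⟨i, b, hb, hi⟩ := S.code_sep Y Y' h.card_eq h'.card_eq hne
  have hv : S.pos (.inl i, b, S.code Y i b) ∈ S.node Y σ :=
    mem_node.2 (.inr (.inl ⟨(hi _).1, i, b, rfl⟩))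
  rcases mem_node.1 (hsub hv) with hv | ⟨-, i', b', hv⟩ | ⟨j, hj, b', hv⟩
  · exact (hi _).2 (h'.mem _ hv)
  · have := S.pos_injective hv
    simp only [Prod.mk.injEq, Sum.inl.injEq] at this
    obtain ⟨rfl, rfl, h3⟩ := this
    exact hb h3
  · have := S.pos_injective hv
    simp at this

theorem prefix_of_node_subset [Nonempty κ] {S : ShrubSystem V ι₁ ι₂ κ k} {Y : Finset V}
    {σ σ' : List V} (h : IsBranch k Y σ) (h' : IsBranch k Y σ')
    (hsub : S.node Y σ ⊆ S.node Y σ') : σ <+: σ' := by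
  have key : ∀ j (hj : j < σ.length) (b : κ), ∃ hj' : j < σ'.length,
      S.sym σ[j] b = S.sym σ'[j] b := by
    intro j hj b
    have hjk := hj.trans_le h.length_le
    have hv : S.pos (.inr (S.slot Y j), b, S.sym σ[j] b) ∈ S.node Y σ :=
      mem_node.2 (.inr (.inr ⟨j, hj, b, rfl⟩))
    rcases mem_node.1 (hsub hv) with hv | ⟨-, i', b', hv⟩ | ⟨j', hj', b', hv⟩
    · exact absurd (h'.mem _ hv) (S.slot_notMem Y h.card_eq j hjk _)
    · have := S.pos_injective hv
      simp at this
    · have := S.pos_injective hv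
      simp only [Prod.mk.injEq, Sum.inr.injEq] at this
      obtain ⟨h1, rfl, h3⟩ := this
      obtain rfl := S.slot_injOn Y h.card_eq j hjk j' (hj'.trans_le h'.length_le) h1
      exact ⟨hj', h3⟩
  have hlt : ∀ j, j < σ.length → j < σ'.length := fun j hj =>
    (key j hj (Classical.arbitrary κ)).1
  refine List.prefix_iff_getElem.2 ⟨?_, fun j hj => S.sym_injective (funext fun b => ?_)⟩
  · by_contra hlen
    exact absurd (hlt σ'.length (by omega)) (lt_irrefl _)
  · exact (key j hj b).2

/-- The coloring in which exactly the shrub nodes are blue. -/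
noncomputable def coloring (S : ShrubSystem V ι₁ ι₂ κ k) (Z : Finset V) : Bool :=
  open Classical in decide (∃ Y σ, IsBranch k Y σ ∧ Z = S.node Y σ)

theorem coloring_eq_true {S : ShrubSystem V ι₁ ι₂ κ k} {Z : Finset V} :
    S.coloring Z = true ↔ ∃ Y σ, IsBranch k Y σ ∧ Z = S.node Y σ := by
  simp [coloring]

theorem not_blue_nposet [Nonempty κ] (S : ShrubSystem V ι₁ ι₂ κ k) :
    ¬ ∃ e : NPoset ↪o Finset V, ∀ p, S.coloring (e p) = true := by
  rintro ⟨e, he⟩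
  have hle : ∀ a b : NPoset, a ≤ b ↔ NPoset.leB a b = true := fun _ _ => Iff.rfl
  obtain ⟨Y₁, σ₁, h₁, e₁⟩ := coloring_eq_true.1 (he .W)
  obtain ⟨Y₂, σ₂, h₂, e₂⟩ := coloring_eq_true.1 (he .X)
  obtain ⟨Y₃, σ₃, h₃, e₃⟩ := coloring_eq_true.1 (he .Y)
  have s₁ : S.node Y₁ σ₁ ⊆ S.node Y₃ σ₃ := by
    rw [← e₁, ← e₃]; exact e.le_iff_le.2 ((hle _ _).2 rfl)
  have s₂ : S.node Y₂ σ₂ ⊆ S.node Y₃ σ₃ := by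
    rw [← e₂, ← e₃]; exact e.le_iff_le.2 ((hle _ _).2 rfl)
  obtain rfl := eq_of_node_subset h₁ h₃ s₁
  obtain rfl := eq_of_node_subset h₂ h₃ s₂
  rcases List.prefix_or_prefix_of_prefix (prefix_of_node_subset h₁ h₃ s₁)
    (prefix_of_node_subset h₂ h₃ s₂) with h | h
  · have : e .W ≤ e .X := by rw [e₁, e₂]; exact S.node_mono _ h
    simpa [hle, NPoset.leB] using e.le_iff_le.1 this
  · have : e .X ≤ e .W := by rw [e₁, e₂]; exact S.node_mono _ h
    simpa [hle, NPoset.leB] using e.le_iff_le.1 this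

theorem not_red_cube {n : ℕ} (hV : Fintype.card V = n + k) (S : ShrubSystem V ι₁ ι₂ κ k) :
    ¬ ∃ e : Finset (Fin n) ↪o Finset V, ∀ q, S.coloring (e q) = false := by
  classical
  rintro ⟨e, he⟩
  have hx : ∀ i : Fin n, ∃ v, v ∈ e {i} ∧ v ∉ e {i}ᶜ := by
    intro i
    refine not_subset.1 fun h => ?_
    have : ({i} : Finset (Fin n)) ≤ {i}ᶜ := e.le_iff_le.1 h
    simpa using this (mem_singleton_self i)
  choose x hx1 hx2 using hx
  have hmem : ∀ i s, x i ∈ e s ↔ i ∈ s := by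
    intro i s
    constructor
    · intro h
      by_contra hi
      have : s ≤ {i}ᶜ := fun j hj => by
        rw [mem_compl, mem_singleton]
        rintro rfl
        exact hi hj
      exact hx2 i (e.le_iff_le.2 this h)
    · intro h
      exact e.le_iff_le.2 (singleton_subset_iff.2 h) (hx1 i)
  have hinj : Function.Injective x := fun i j h => by
    have := (hmem i {j}).1 (h ▸ hx1 j)
    simpa using this
  set Y : Finset V := (univ.image x)ᶜ with hY
  have hYcard : Y.card = k := by
    rw [hY, card_compl, card_image_of_injective _ hinj, card_univ, Fintype.card_fin, hV]
    omega
  have hmemY : ∀ v, v ∉ Y ↔ ∃ i, x i = v := fun v => by simp [hY]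
  let s : List V → Finset (Fin n) := fun σ => univ.filter fun i => x i ∈ S.node Y σ
  have key : ∀ m, ∃ σ : List V, σ.length = m ∧ IsBranch k Y σ ∧ ∀ v ∈ σ, v ∈ e (s σ) := by
    intro m
    induction m with
    | zero => exact ⟨[], rfl, ⟨hYcard, List.nodup_nil, by simp⟩, by simp⟩
    | succ m ih =>
      obtain ⟨σ, hlen, hσ, hσe⟩ := ih
      obtain ⟨y, hy, hye, hyσ⟩ : ∃ y ∈ Y, y ∈ e (s σ) ∧ y ∉ σ := by
        by_contra hcon
        push Not at hcon
        have hblue : S.coloring (e (s σ)) = true := by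
          refine coloring_eq_true.2 ⟨Y, σ, hσ, ?_⟩
          ext v
          by_cases hv : v ∈ Y
          · exact ⟨fun h => mem_node.2 (.inl (hcon v hv h)),
              fun h => hσe v (mem_of_mem_node hσ h hv)⟩
          · obtain ⟨i, rfl⟩ := (hmemY v).1 hv
            rw [hmem]
            simp [s]
        rw [he] at hblue
        exact Bool.false_ne_true hblue
      have hpre : σ <+: σ ++ [y] := List.prefix_append _ _
      have hsub : e (s σ) ≤ e (s (σ ++ [y])) := e.le_iff_le.2 fun i hi => by
        simp only [s, mem_filter] at hi ⊢
        exact ⟨hi.1, S.node_mono Y hpre hi.2⟩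
      refine ⟨σ ++ [y], by simp [hlen], ⟨hYcard, ?_, ?_⟩, ?_⟩
      · rw [List.nodup_append]
        refine ⟨hσ.nodup, List.nodup_singleton _, ?_⟩
        intro a ha b hb
        rw [List.mem_singleton] at hb
        rintro rfl
        exact hyσ (hb ▸ ha)
      · intro v hv
        rcases List.mem_append.1 hv with h | h
        · exact hσ.mem v h
        · exact List.mem_singleton.1 h ▸ hy
      · intro v hv
        rcases List.mem_append.1 hv with h | h
        · exact hsub (hσe v h)
        · exact hsub (List.mem_singleton.1 h ▸ hye)
  obtain ⟨σ, hlen, hσ, -⟩ := key (k + 1)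
  have := hσ.length_le
  omega

end ShrubSystem

/-- Shrub systems exist once `V` has room for `5k + 2` blocks of `B` pairs, where `B` bits suffice
to encode a prime field that is larger than `V`. -/
theorem exists_shrubSystem {N k B : ℕ} (hN : 3 * k + 1 ≤ N) (hB : 2 * N ≤ 2 ^ B)
    (hroom : 2 * B * (5 * k + 2) ≤ N) :
    Nonempty (ShrubSystem (Fin N) (Fin (3 * k + 1)) (Fin (2 * k + 1)) (Fin B) k) := by
  classical
  obtain ⟨p, hp, hNp, hpN⟩ := Nat.exists_prime_lt_and_le_two_mul N (by omega)
  have : Fact p.Prime := ⟨hp⟩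
  obtain ⟨pos⟩ : Nonempty ((Fin (3 * k + 1) ⊕ Fin (2 * k + 1)) × Fin B × Bool ↪ Fin N) := by
    refine Function.Embedding.nonempty_of_card_le ?_
    simp only [Fintype.card_prod, Fintype.card_sum, Fintype.card_fin, Fintype.card_bool]
    calc _ = 2 * B * (5 * k + 2) := by ring
      _ ≤ N := hroom
  obtain ⟨enc⟩ : Nonempty (ZMod p ↪ (Fin B → Bool)) := by
    refine Function.Embedding.nonempty_of_card_le ?_
    simp only [ZMod.card, Fintype.card_fun, Fintype.card_fin, Fintype.card_bool]
    omega
  obtain ⟨inc⟩ : Nonempty (Fin N ↪ ZMod p) :=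
    Function.Embedding.nonempty_of_card_le (by simp [ZMod.card, hNp.le])
  obtain ⟨ev⟩ : Nonempty (Fin (3 * k + 1) ↪ ZMod p) :=
    Function.Embedding.nonempty_of_card_le (by rw [ZMod.card, Fintype.card_fin]; omega)
  let val : Finset (Fin N) → Fin (3 * k + 1) → ZMod p := fun Y i =>
    (∏ a ∈ Y.map inc, (Polynomial.X - Polynomial.C a)).eval (ev i)
  have hl : Function.Injective fun a : Fin (3 * k + 1) × Fin B × Bool => pos (.inl a.1, a.2) := by
    rintro ⟨a, b⟩ ⟨c, d⟩ h
    simpa using pos.injective h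
  have hr : Function.Injective fun a : Fin (2 * k + 1) × Fin B × Bool => pos (.inr a.1, a.2) := by
    rintro ⟨a, b⟩ ⟨c, d⟩ h
    simpa using pos.injective h
  have hslot : ∀ Y : Finset (Fin N), ∃ g : ℕ → Fin (2 * k + 1), Y.card = k →
      (∀ i < k, ∀ j < k, g i = g j → i = j) ∧ ∀ j < k, ∀ c, pos (.inr (g j), c) ∉ Y := by
    intro Y
    by_cases hY : Y.card = k
    · obtain ⟨g, hg⟩ := exists_untouched hr (by simp) Y hY
      exact ⟨g, fun _ => hg⟩
    · exact ⟨fun _ => 0, fun h => absurd h hY⟩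
  choose slot hslot using hslot
  refine ⟨⟨pos, pos.injective, fun Y i => enc (val Y i), fun Y Y' hY hY' hne => ?_,
    fun v => enc (inc v), enc.injective.comp inc.injective, slot, fun Y hY => (hslot Y hY).1,
    fun Y hY => (hslot Y hY).2⟩⟩
  have h1 : #{i | val Y i = val Y' i} ≤ k := card_agree_le ev.injective (s := Y.map inc) (t := Y'.map inc)
    ((card_map _).trans hY) ((card_map _).trans hY') fun h => hne (map_injective _ h)
  have h2 : #{i | ∃ c, pos (.inl i, c) ∈ Y} ≤ #Y := card_touched_le hl Y
  have h3 : #{i | ∃ c, pos (.inl i, c) ∈ Y'} ≤ #Y' := card_touched_le hl Y'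
  obtain ⟨i, hi⟩ : ∃ i, i ∉ ((univ.filter fun i => val Y i = val Y' i) ∪
      univ.filter fun i => ∃ c, pos (.inl i, c) ∈ Y) ∪
      univ.filter fun i => ∃ c, pos (.inl i, c) ∈ Y' := by
    by_contra hcon
    push Not at hcon
    have h4 := (card_le_card fun i (_ : i ∈ univ) => hcon i).trans (card_union_le _ _)
    have h5 := card_union_le (univ.filter fun i => val Y i = val Y' i)
      (univ.filter fun i => ∃ c, pos (.inl i, c) ∈ Y)
    rw [card_univ, Fintype.card_fin] at h4
    omega
  simp only [mem_union, mem_filter, mem_univ, true_and, not_or, not_exists] at hi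
  obtain ⟨b, hb⟩ := Function.ne_iff.1 fun h => hi.1.1 (enc.injective h)
  exact ⟨i, b, hb, fun c => ⟨hi.1.2 c, hi.2 c⟩⟩

theorem le_of_posetRamsey_mem {n N : ℕ} (hn : 2 ^ 16 ≤ n)
    (h : ∀ c : Finset (Fin N) → Bool, (∃ e : NPoset ↪o Finset (Fin N), ∀ p, c (e p) = true) ∨
      (∃ e : Finset (Fin n) ↪o Finset (Fin N), ∀ q, c (e q) = false)) :
    (n : ℝ) + (n : ℝ) / (15 * Real.logb 2 (n : ℝ)) ≤ N := by
  by_contra hlt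
  rw [not_le] at hlt
  rcases lt_or_ge N n with hNn | hnN
  · rcases h fun _ => false with ⟨e, he⟩ | ⟨e, -⟩
    · exact Bool.false_ne_true (he .W)
    · have := Fintype.card_le_of_injective e e.injective
      simp only [Fintype.card_finset, Fintype.card_fin] at this
      exact absurd this (not_le.2 (Nat.pow_lt_pow_right one_lt_two hNn))
  · obtain ⟨k, rfl⟩ := Nat.exists_eq_add_of_le hnN
    set L := Nat.log 2 n with hL
    have hn0 : n ≠ 0 := by omega
    have hL16 : 16 ≤ L := (Nat.le_log_iff_pow_le one_lt_two hn0).2 hn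
    have hLn : 2 ^ L ≤ n := Nat.pow_log_le_self 2 hn0
    have hnL : n < 2 ^ (L + 1) := Nat.lt_pow_succ_log_self one_lt_two n
    have hLlog : (L : ℝ) ≤ Real.logb 2 n := by
      rw [Real.le_logb_iff_rpow_le one_lt_two (by positivity), Real.rpow_natCast]
      exact_mod_cast hLn
    have hL0 : (0 : ℝ) < L := by exact_mod_cast (by omega : 0 < L)
    have hk : 15 * L * k < n := by
      push_cast at hlt
      have h1 : (k : ℝ) < n / (15 * Real.logb 2 n) := by linarith
      rw [lt_div_iff₀ (by linarith)] at h1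
      have h2 : (15 * L * k : ℝ) < n := by
        have : (0 : ℝ) ≤ k := by positivity
        nlinarith
      exact_mod_cast h2
    have hLbig : 20 * L + 60 ≤ 2 ^ L := by
      clear_value L
      clear hk hL0 hLlog hnL hLn hL h hlt
      induction L, hL16 using Nat.le_induction with
      | base => norm_num
      | succ m hm ih => rw [pow_succ]; omega
    have hk240 : 240 * k ≤ n := by nlinarith
    have hkL : 15 * (k * L) < n := by rw [mul_comm k]; linarith
    obtain ⟨S⟩ := exists_shrubSystem (N := n + k) (k := k) (B := L + 3) (by omega)
      (by rw [pow_add] at hnL ⊢; omega)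
      (by
        have : 2 * (L + 3) * (5 * k + 2) = 10 * (k * L) + 30 * k + 4 * L + 12 := by ring
        omega)
    rcases h S.coloring with h | h
    · exact S.not_blue_nposet h
    · exact S.not_red_cube (by simp) h

end LowerBound

/-- For the N-shaped poset `𝒩`: for every `n ≥ 2^16`,
`R(𝒩, Q_n) ≥ n + n/(15·log n)`, and for every `ε > 0` there is `n₀` such that for all
`n ≥ n₀`, `R(𝒩, Q_n) ≤ n + (1 + ε)·(n / log n)`. -/
theorem nposet_ramsey :
    (∀ n : ℕ, 2 ^ 16 ≤ n →
      (n : ℝ) + (n : ℝ) / (15 * Real.logb 2 (n : ℝ)) ≤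
        (posetRamsey NPoset (Finset (Fin n)) : ℝ)) ∧
    (∀ ε : ℝ, 0 < ε → ∃ n₀ : ℕ, ∀ n : ℕ, n₀ ≤ n →
      (posetRamsey NPoset (Finset (Fin n)) : ℝ) ≤
        (n : ℝ) + (1 + ε) * ((n : ℝ) / Real.logb 2 (n : ℝ))) := by
  refine ⟨fun n hn => ?_, posetRamsey_upper⟩
  obtain ⟨k, hk2, hk⟩ := exists_two_mul_two_pow_lt_factorial n
  exact le_of_posetRamsey_mem hn
    (Nat.sInf_mem (s := {N : ℕ | ∀ c : Finset (Fin N) → Bool,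
      (∃ e : NPoset ↪o Finset (Fin N), ∀ p, c (e p) = true) ∨
      (∃ e : Finset (Fin n) ↪o Finset (Fin N), ∀ q, c (e q) = false)})
      ⟨n + k, posetRamsey_set_mem_of_factorial hk2 hk⟩)
end
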